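/- arXiv:1304.6988 — 11 statements merged into one kernel-verified Lean document; each statement's English description precedes it below -/
import Mathlib

section
/- Let N ≥ 1 and p > N. There exists a constant C > 0 depending only on p and N such that the following holds: for every open set Ω ⊆ ℝ^N with finite positive inner radius r_Ω, every nonnegative w ∈ L^1(Ω), and every C^1 function u : ℝ^N → ℝ, not identically zero, with compact support contained in Ω and satisfying the energy identity ∫_Ω |∇u|^p dx = ∫_Ω w(x)|u(x)|^p dx, one has C / r_Ω^{p−N} ≤ ∫_Ω w(x) dx. -/
open MeasureTheory Metric
open scoped ENNReal

theorem lyap_scale (N : ℕ) (f : EuclideanSpace ℝ (Fin N) → ℝ≥0∞) (hf : Measurable f)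
    (x : EuclideanSpace ℝ (Fin N)) (t : ℝ) (ht : 0 < t) :
    ∫⁻ y, f (x + t • (y - x)) = ENNReal.ofReal (t ^ (-(N : ℝ))) * ∫⁻ y, f y := by
  have h1 : ∫⁻ y, f (x + t • (y - x)) = ∫⁻ y, f (x + t • y) :=
    lintegral_sub_right_eq_self (fun y => f (x + t • y)) x
  have h2 : ∫⁻ y, f (x + t • y) = ∫⁻ z, f (x + z) ∂(Measure.map (t • ·) volume) := by
    rw [lintegral_map (by fun_prop) (by fun_prop)]
  rw [h1, h2, Measure.map_addHaar_smul _ ht.ne', lintegral_smul_measure,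
    lintegral_add_left_eq_self f x, smul_eq_mul, finrank_euclideanSpace_fin,
    Real.rpow_neg ht.le, Real.rpow_natCast, abs_of_pos (by positivity)]

theorem lyap_ftc (N : ℕ) (u : EuclideanSpace ℝ (Fin N) → ℝ) (hu : ContDiff ℝ 1 u)
    (x y : EuclideanSpace ℝ (Fin N)) :
    ‖u y - u x‖ₑ ≤ ∫⁻ t in Set.Ioc (0:ℝ) 1, ‖fderiv ℝ u (x + t • (y - x))‖ₑ * ‖y - x‖ₑ := by
  have hc : Continuous (fderiv ℝ u) := hu.continuous_fderiv one_ne_zero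
  have h := intervalIntegral.integral_eq_sub_of_hasDerivAt (a := 0) (b := 1)
    (f := fun t : ℝ => u (x + t • (y - x)))
    (f' := fun t : ℝ => fderiv ℝ u (x + t • (y - x)) (y - x)) ?_ ?_
  · simp only [one_smul, zero_smul, add_zero, add_sub_cancel] at h
    rw [← h, intervalIntegral.integral_of_le zero_le_one]
    refine (enorm_integral_le_lintegral_enorm _).trans (lintegral_mono fun t => ?_)
    exact ContinuousLinearMap.le_opENorm _ _
  · intro t _
    have h1 : HasDerivAt (fun t : ℝ => x + t • (y - x)) (y - x) t := by
      simpa using ((hasDerivAt_id t).smul_const (y - x)).const_add x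
    exact ((hu.differentiable one_ne_zero _).hasFDerivAt).comp_hasDerivAt t h1
  · exact Continuous.intervalIntegrable (by fun_prop) _ _

theorem lyap_morrey (N : ℕ) (p : ℝ) (hp1 : 1 < p)
    (u : EuclideanSpace ℝ (Fin N) → ℝ) (hu : ContDiff ℝ 1 u)
    (x : EuclideanSpace ℝ (Fin N)) (B : Set (EuclideanSpace ℝ (Fin N))) (hB : MeasurableSet B)
    (ρ : ℝ) (hρ : ∀ y ∈ B, ‖y - x‖ ≤ ρ) :
    ∫⁻ y in B, ‖u y - u x‖ₑ ≤ ENNReal.ofReal ρ *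
      ((∫⁻ t in Set.Ioc (0:ℝ) 1, ENNReal.ofReal (t ^ (-(N / p : ℝ)))) *
        ((∫⁻ y, ‖fderiv ℝ u y‖ₑ ^ p) ^ (1 / p) * volume B ^ (1 - 1 / p))) := by
  have hc : Continuous (fderiv ℝ u) := hu.continuous_fderiv one_ne_zero
  have hp0 : 0 < p := by linarith
  have hpq : p.HolderConjugate (p / (p - 1)) := Real.HolderConjugate.conjExponent hp1
  calc ∫⁻ y in B, ‖u y - u x‖ₑ
      ≤ ∫⁻ y in B, ∫⁻ t in Set.Ioc (0:ℝ) 1,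
          ENNReal.ofReal ρ * ‖fderiv ℝ u (x + t • (y - x))‖ₑ := by
        refine setLIntegral_mono' hB fun y hy => ?_
        refine (lyap_ftc N u hu x y).trans (lintegral_mono fun t => ?_)
        rw [mul_comm]
        gcongr
        rw [← ofReal_norm]
        exact ENNReal.ofReal_le_ofReal (hρ y hy)
    _ = ∫⁻ t in Set.Ioc (0:ℝ) 1, ∫⁻ y in B,
          ENNReal.ofReal ρ * ‖fderiv ℝ u (x + t • (y - x))‖ₑ := by
        refine lintegral_lintegral_swap ?_
        refine Measurable.aemeasurable ?_
        refine Measurable.const_mul ?_ _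
        refine Continuous.measurable ?_
        fun_prop
    _ ≤ ∫⁻ t in Set.Ioc (0:ℝ) 1, ENNReal.ofReal ρ * (ENNReal.ofReal (t ^ (-(N / p : ℝ))) *
          ((∫⁻ y, ‖fderiv ℝ u y‖ₑ ^ p) ^ (1 / p) * volume B ^ (1 - 1 / p))) := by
        refine setLIntegral_mono' measurableSet_Ioc fun t ht => ?_
        rw [lintegral_const_mul _ (Continuous.measurable (by fun_prop))]
        gcongr
        have h := ENNReal.lintegral_mul_le_Lp_mul_Lq (volume.restrict B) hpq
          (f := fun y => ‖fderiv ℝ u (x + t • (y - x))‖ₑ) (g := fun _ => 1)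
          (Continuous.measurable (by fun_prop)).aemeasurable aemeasurable_const
        simp only [Pi.mul_apply, mul_one, ENNReal.one_rpow, lintegral_const, one_mul,
          Measure.restrict_apply_univ] at h
        refine h.trans ?_
        have e : 1 / (p / (p - 1)) = 1 - 1 / p := by
          have : p - 1 ≠ 0 := by linarith
          field_simp
        rw [e, ← mul_assoc]
        gcongr
        calc (∫⁻ y in B, ‖fderiv ℝ u (x + t • (y - x))‖ₑ ^ p) ^ (1 / p)
            ≤ (∫⁻ y, ‖fderiv ℝ u (x + t • (y - x))‖ₑ ^ p) ^ (1 / p) := by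
              gcongr
              exact Measure.restrict_le_self
          _ = _ := by
              rw [lyap_scale N (fun z => ‖fderiv ℝ u z‖ₑ ^ p)
                ((Continuous.measurable (by fun_prop)).pow_const p) x t ht.1,
                ENNReal.mul_rpow_of_nonneg _ _ (by positivity),
                ENNReal.ofReal_rpow_of_pos (by have := ht.1; positivity),
                ← Real.rpow_mul ht.1.le]
              congr 3
              ring_nf
    _ = _ := by
        rw [lintegral_const_mul _ (by fun_prop), lintegral_mul_const _ (by fun_prop)]

theorem lyap_sup (N : ℕ) (p : ℝ) (hp1 : 1 < p) (hp : (N : ℝ) < p)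
    (u : EuclideanSpace ℝ (Fin N) → ℝ) (hu : ContDiff ℝ 1 u)
    (hint : Integrable (fun y => ‖fderiv ℝ u y‖ ^ p))
    (x z : EuclideanSpace ℝ (Fin N)) (r : ℝ) (hr : 0 < r) (hz : dist x z ≤ r) (hz0 : u z = 0) :
    |u x| ^ p ≤ (3 * ((∫ t in Set.Ioc (0:ℝ) 1, t ^ (-(N / p : ℝ))) + 1)) ^ p *
      r ^ (p - N) * (volume.real (ball (0 : EuclideanSpace ℝ (Fin N)) 1))⁻¹ *
        ∫ y, ‖fderiv ℝ u y‖ ^ p := by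
  have hp0 : 0 < p := by linarith
  have hc : Continuous (fderiv ℝ u) := hu.continuous_fderiv one_ne_zero
  set B := closedBall x r with hB
  set v := volume.real B with hv
  set V := volume.real (ball (0 : EuclideanSpace ℝ (Fin N)) 1) with hV
  set c := ∫ t in Set.Ioc (0:ℝ) 1, t ^ (-(N / p : ℝ)) with hcdef
  set G := ∫ y, ‖fderiv ℝ u y‖ ^ p with hG
  have hc0 : 0 ≤ c := setIntegral_nonneg measurableSet_Ioc fun t ht => Real.rpow_nonneg ht.1.le _
  have hG0 : 0 ≤ G := integral_nonneg fun y => by positivity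
  have hVpos : 0 < V := ENNReal.toReal_pos (measure_ball_pos _ _ one_pos).ne' measure_ball_lt_top.ne
  have hvV : v = r ^ N * V := by
    rw [hv, measureReal_def, Measure.addHaar_closedBall _ _ hr.le, ENNReal.toReal_mul,
      ENNReal.toReal_ofReal (by positivity), finrank_euclideanSpace_fin]; rfl
  have hvpos : 0 < v := by rw [hvV]; positivity
  have hvE : volume B = ENNReal.ofReal v := by
    rw [hv, ofReal_measureReal measure_closedBall_lt_top.ne]
  have hGE : ∫⁻ y, ‖fderiv ℝ u y‖ₑ ^ p = ENNReal.ofReal G := by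
    rw [hG, ofReal_integral_eq_lintegral_ofReal hint (ae_of_all _ fun y => by positivity)]
    refine lintegral_congr fun y => ?_
    rw [← ofReal_norm, ENNReal.ofReal_rpow_of_nonneg (norm_nonneg _) hp0.le]
  have hcE : ∫⁻ t in Set.Ioc (0:ℝ) 1, ENNReal.ofReal (t ^ (-(N / p : ℝ))) = ENNReal.ofReal c := by
    rw [hcdef, ofReal_integral_eq_lintegral_ofReal]
    · have h : -1 < -(N / p : ℝ) := by
        rw [neg_lt_neg_iff, div_lt_one hp0]; exact hp
      exact (intervalIntegrable_iff_integrableOn_Ioc_of_le zero_le_one).1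
        (intervalIntegral.intervalIntegrable_rpow' h)
    · filter_upwards [ae_restrict_mem measurableSet_Ioc] with t ht using Real.rpow_nonneg ht.1.le _
  have h1 := lyap_morrey N p hp1 u hu x B measurableSet_closedBall r (fun y hy => by
    rw [← dist_eq_norm]; exact hy)
  have h2 := lyap_morrey N p hp1 u hu z B measurableSet_closedBall (2 * r) (fun y hy => by
    rw [← dist_eq_norm]
    have := dist_triangle y x z
    have h' : dist y x ≤ r := hy
    linarith)
  rw [hGE, hcE, hvE, ENNReal.ofReal_rpow_of_nonneg hG0 (by positivity),
    ENNReal.ofReal_rpow_of_pos hvpos, ← ENNReal.ofReal_mul (by positivity),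
    ← ENNReal.ofReal_mul hc0, ← ENNReal.ofReal_mul (by positivity)] at h1 h2
  have h3 : ENNReal.ofReal (|u x| * v) ≤
      ENNReal.ofReal (3 * r * c * (G ^ (1 / p) * v ^ (1 - 1 / p))) := by
    calc ENNReal.ofReal (|u x| * v) = ∫⁻ y in B, ‖u x - u z‖ₑ := by
          rw [lintegral_const, Measure.restrict_apply_univ, hvE, hz0, sub_zero, ← ofReal_norm,
            ENNReal.ofReal_mul (abs_nonneg _), Real.norm_eq_abs]
      _ ≤ ∫⁻ y in B, (‖u y - u x‖ₑ + ‖u y - u z‖ₑ) := by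
          refine lintegral_mono fun y => ?_
          have : u x - u z = -(u y - u x) + (u y - u z) := by ring
          rw [this]
          refine (enorm_add_le _ _).trans ?_
          rw [enorm_neg]
      _ = (∫⁻ y in B, ‖u y - u x‖ₑ) + ∫⁻ y in B, ‖u y - u z‖ₑ := by
          have := hu.continuous
          exact lintegral_add_left (Continuous.measurable (by fun_prop)) _
      _ ≤ _ := by
          refine (add_le_add h1 h2).trans ?_
          rw [← ENNReal.ofReal_add (by positivity) (by positivity)]
          apply le_of_eq
          congr 1
          ring
  have h4 : |u x| * v ≤ 3 * r * c * (G ^ (1 / p) * v ^ (1 - 1 / p)) :=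
    (ENNReal.ofReal_le_ofReal_iff (by positivity)).1 h3
  have h5 : |u x| ≤ 3 * (c + 1) * r * (v ^ (-(1 / p)) * G ^ (1 / p)) := by
    have e : v ^ (1 - 1 / p) = v * v ^ (-(1 / p)) := by
      rw [sub_eq_add_neg, Real.rpow_add hvpos, Real.rpow_one]
    rw [e] at h4
    have h6 : |u x| ≤ 3 * r * c * (G ^ (1 / p) * v ^ (-(1 / p))) := by
      refine le_of_mul_le_mul_right (h4.trans (le_of_eq (by ring))) hvpos
    refine h6.trans ?_
    have : 0 ≤ r * (G ^ (1 / p) * v ^ (-(1 / p))) := by positivity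
    nlinarith
  refine (Real.rpow_le_rpow (abs_nonneg _) h5 hp0.le).trans (le_of_eq ?_)
  rw [Real.mul_rpow (by positivity) (by positivity), Real.mul_rpow (by positivity) hr.le,
    Real.mul_rpow (x := v ^ (-(1 / p))) (by positivity) (by positivity), ← Real.rpow_mul hvpos.le, ← Real.rpow_mul hG0,
    neg_mul, one_div_mul_cancel hp0.ne', Real.rpow_one, Real.rpow_neg_one, hvV,
    Real.rpow_sub hr, Real.rpow_natCast, mul_inv]
  field_simp

/-- Lyapunov inequality for the `p`-Laplacian, case `p > N`:
`C / rΩ^(p-N) ≤ ∫_Ω w`. -/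
theorem lyapunov_inequality_p_gt_N (N : ℕ) (hN : 1 ≤ N) (p : ℝ) (hp : (N : ℝ) < p) :
    ∃ C : ℝ, 0 < C ∧
      ∀ (Ω : Set (EuclideanSpace ℝ (Fin N))) (rΩ : ℝ)
        (w u : EuclideanSpace ℝ (Fin N) → ℝ),
        IsOpen Ω →
        IsLUB ((fun x => infDist x Ωᶜ) '' Ω) rΩ →
        0 < rΩ →
        (∀ x ∈ Ω, 0 ≤ w x) →
        IntegrableOn w Ω →
        ContDiff ℝ 1 u →
        HasCompactSupport u →
        tsupport u ⊆ Ω →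
        u ≠ 0 →
        (∫ x in Ω, ‖fderiv ℝ u x‖ ^ p) = (∫ x in Ω, w x * |u x| ^ p) →
        C / rΩ ^ (p - N) ≤ ∫ x in Ω, w x := by
  have hp1 : 1 < p := lt_of_le_of_lt (by exact_mod_cast hN) hp
  have hp0 : 0 < p := by linarith
  have hc0 : 0 ≤ ∫ t in Set.Ioc (0:ℝ) 1, t ^ (-(N / p : ℝ)) :=
    setIntegral_nonneg measurableSet_Ioc fun t ht => Real.rpow_nonneg ht.1.le _
  have hVpos : 0 < volume.real (ball (0 : EuclideanSpace ℝ (Fin N)) 1) :=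
    ENNReal.toReal_pos (measure_ball_pos _ _ one_pos).ne' measure_ball_lt_top.ne
  set V := volume.real (ball (0 : EuclideanSpace ℝ (Fin N)) 1) with hV
  set D := (3 * ((∫ t in Set.Ioc (0:ℝ) 1, t ^ (-(N / p : ℝ))) + 1)) ^ p with hD
  have hDpos : 0 < D := by positivity
  refine ⟨V / D, by positivity, ?_⟩
  intro Ω r w u hΩ hlub hr hw hwi hu hcs hsub hne heq
  have hc : Continuous (fderiv ℝ u) := hu.continuous_fderiv one_ne_zero
  obtain ⟨x, hx⟩ := (hu.continuous.norm).exists_forall_ge_of_hasCompactSupport hcs.norm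
  simp only [Real.norm_eq_abs] at hx
  have hMpos : 0 < |u x| := by
    obtain ⟨y, hy⟩ := Function.ne_iff.1 hne
    exact lt_of_lt_of_le (abs_pos.2 hy) (hx y)
  have hxΩ : x ∈ Ω := hsub (subset_tsupport u (abs_pos.1 hMpos))
  have hnonempty : (Ωᶜ).Nonempty := by
    by_contra h
    rw [Set.not_nonempty_iff_eq_empty] at h
    have : r ≤ 0 := hlub.2 (by rintro _ ⟨y, -, rfl⟩; simp [h])
    linarith
  obtain ⟨z, hz, hxz⟩ := hΩ.isClosed_compl.exists_infDist_eq_dist hnonempty x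
  have hxr : dist x z ≤ r := by
    rw [← hxz]; exact hlub.1 ⟨x, hxΩ, rfl⟩
  have hz0 : u z = 0 := image_eq_zero_of_notMem_tsupport fun h => hz (hsub h)
  have hcsf : HasCompactSupport (fun y => ‖fderiv ℝ u y‖ ^ p) :=
    (hcs.fderiv (𝕜 := ℝ)).comp_left (g := fun L => ‖L‖ ^ p) (by simp [hp0.ne'])
  have hint : Integrable (fun y => ‖fderiv ℝ u y‖ ^ p) :=
    (hc.norm.rpow_const fun _ => Or.inr hp0.le).integrable_of_hasCompactSupport hcsf
  have hmain := lyap_sup N p hp1 hp u hu hint x z r hr hxr hz0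
  rw [← hD, ← hV] at hmain
  have hset : ∫ y, ‖fderiv ℝ u y‖ ^ p = ∫ y in Ω, ‖fderiv ℝ u y‖ ^ p := by
    symm
    refine setIntegral_eq_integral_of_forall_compl_eq_zero fun y hy => ?_
    have : fderiv ℝ u y = 0 := by
      by_contra h
      exact hy (hsub (support_fderiv_subset ℝ h))
    simp [this, hp0.ne']
  have hle : ∫ y in Ω, w y * |u y| ^ p ≤ (∫ y in Ω, w y) * |u x| ^ p := by
    rw [← integral_mul_const]
    refine integral_mono_of_nonneg ?_ (hwi.mul_const _) ?_
    · filter_upwards [ae_restrict_mem hΩ.measurableSet] with y hy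
      exact mul_nonneg (hw y hy) (by positivity)
    · filter_upwards [ae_restrict_mem hΩ.measurableSet] with y hy
      exact mul_le_mul_of_nonneg_left
        (Real.rpow_le_rpow (abs_nonneg _) (hx y) hp0.le) (hw y hy)
  rw [hset, heq] at hmain
  have hrp : 0 < r ^ (p - N) := by positivity
  have hMp : 0 < |u x| ^ p := by positivity
  have h7 : |u x| ^ p ≤ (D * r ^ (p - N) * V⁻¹ * ∫ y in Ω, w y) * |u x| ^ p := by
    refine hmain.trans ?_
    rw [mul_assoc _ (∫ y in Ω, w y)]
    gcongr
  have h8 : 1 ≤ D * r ^ (p - N) * V⁻¹ * ∫ y in Ω, w y :=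
    le_of_mul_le_mul_right (by rwa [one_mul]) hMp
  rw [div_div, div_le_iff₀ (by positivity)]
  have h9 := mul_le_mul_of_nonneg_right h8 hVpos.le
  calc V = 1 * V := (one_mul _).symm
    _ ≤ _ := h9
    _ = _ := by field_simp
end

section
/- Let N ≥ 1, p > N, and 1 < t < p/N. There exists a constant C(p,t,N) > 0 such that the following holds. Let Ω ⊆ ℝ^N be open with finite positive inner radius r_Ω, let v be a nonnegative function in the Muckenhoupt class A_t(ℝ^N) with g(r_Ω) := sup_{x∈Ω} ∫_{B(x,r_Ω)} v(z)^{−1/(t−1)} dz < ∞, and let w ≥ 0 be locally integrable on Ω. If u is a C^1 function, not identically zero, with compact support contained in Ω satisfying ∫_Ω v(x)|∇u(x)|^p dx = ∫_Ω w(x)|u(x)|^p dx, then 1 ≤ C(p,t,N) · r_Ω^{p−tN} · g(r_Ω)^{t−1} · ∫_Ω w(z) dz. -/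
open MeasureTheory Metric ENNReal

lemma aux_scale {N : ℕ} (f : EuclideanSpace ℝ (Fin N) → ℝ≥0∞) (hf : Measurable f)
    (c x : EuclideanSpace ℝ (Fin N)) (r s : ℝ) (hx : x ∈ closedBall c r) (hs : 0 < s) (hs1 : s ≤ 1) :
    ∫⁻ z in ball c r, f (x + s • (z - x)) ≤
      ENNReal.ofReal (s ^ (-(N : ℝ))) * ∫⁻ z in ball c r, f z := by
  have hF : Measurable ((ball c r).indicator f) := hf.indicator measurableSet_ball
  have h1 : ∫⁻ z in ball c r, f (x + s • (z - x)) ≤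
      ∫⁻ z, (ball c r).indicator f (x + s • (z - x)) := by
    rw [← lintegral_indicator measurableSet_ball]
    refine lintegral_mono fun z => ?_
    by_cases hz : z ∈ ball c r
    · have : x + s • (z - x) ∈ ball c r := by
        rw [mem_ball_iff_norm] at hz ⊢
        rw [mem_closedBall_iff_norm] at hx
        have e : x + s • (z - x) - c = (1 - s) • (x - c) + s • (z - c) := by module
        rw [e]
        calc _ ≤ ‖(1 - s) • (x - c)‖ + ‖s • (z - c)‖ := norm_add_le _ _
          _ = (1 - s) * ‖x - c‖ + s * ‖z - c‖ := by
            rw [norm_smul, norm_smul, Real.norm_of_nonneg (by linarith), Real.norm_of_nonneg hs.le]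
          _ < (1 - s) * r + s * r := by
            have := mul_le_mul_of_nonneg_left hx (sub_nonneg.2 hs1)
            have := mul_lt_mul_of_pos_left hz hs
            linarith
          _ = r := by ring
      simp only [Set.indicator_of_mem hz, Set.indicator_of_mem this]; exact le_rfl
    · simp [Set.indicator_of_notMem hz]
  refine h1.trans (le_of_eq ?_)
  have h2 := lintegral_sub_right_eq_self (μ := (volume : Measure (EuclideanSpace ℝ (Fin N))))
    (fun z => (ball c r).indicator f (x + s • z)) x
  rw [h2]
  have h3 : ∫⁻ z, (ball c r).indicator f (x + s • z) =
      ∫⁻ z, (ball c r).indicator f (x + z) ∂(Measure.map (s • ·) (volume : Measure (EuclideanSpace ℝ (Fin N)))) := by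
    rw [lintegral_map (by fun_prop) (by fun_prop)]
  rw [h3, Measure.map_addHaar_smul _ hs.ne', lintegral_smul_measure, lintegral_add_left_eq_self,
    lintegral_indicator measurableSet_ball, smul_eq_mul]
  congr 2
  rw [finrank_euclideanSpace_fin, abs_of_pos (by positivity), Real.rpow_neg hs.le, Real.rpow_natCast]

lemma aux_ftc {N : ℕ} (u : EuclideanSpace ℝ (Fin N) → ℝ) (hu : ContDiff ℝ 1 u)
    (x z : EuclideanSpace ℝ (Fin N)) :
    ‖u z - u x‖ₑ ≤ ∫⁻ s in Set.Ioc (0:ℝ) 1, ‖fderiv ℝ u (x + s • (z - x))‖ₑ * ‖z - x‖ₑ := by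
  have hg : ContDiff ℝ 1 (fun s : ℝ => u (x + s • (z - x))) := by fun_prop
  have := enorm_sub_le_lintegral_deriv_of_contDiffOn_Icc (hg.contDiffOn (s := Set.Icc 0 1)) zero_le_one
  simp only [one_smul, zero_smul, add_zero, add_sub_cancel] at this
  refine this.trans ?_
  rw [restrict_Ioc_eq_restrict_Icc]
  refine lintegral_mono fun s => ?_
  have hd : HasDerivAt (fun s : ℝ => u (x + s • (z - x))) (fderiv ℝ u (x + s • (z - x)) (z - x)) s := by
    have h1 : HasDerivAt (fun s : ℝ => x + s • (z - x)) (z - x) s := by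
      simpa using ((hasDerivAt_id s).smul_const (z - x)).const_add x
    exact ((hu.differentiable one_ne_zero) _).hasFDerivAt.comp_hasDerivAt s h1
  simp only []
  rw [hd.deriv]
  exact ContinuousLinearMap.le_opENorm _ _

lemma aux_kappa (a : ℝ) (ha : a < 1) :
    ∫⁻ s in Set.Ioc (0:ℝ) 1, ENNReal.ofReal (s ^ (-a)) = ENNReal.ofReal (1 / (1 - a)) := by
  rw [← ofReal_integral_eq_lintegral_ofReal]
  · rw [← intervalIntegral.integral_of_le zero_le_one, integral_rpow (Or.inl (by linarith))]
    congr 1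
    rw [Real.zero_rpow (by linarith), Real.one_rpow]; ring_nf
  · exact (intervalIntegral.intervalIntegrable_rpow' (a := 0) (b := 1) (by linarith : -1 < -a)).1
  · filter_upwards [self_mem_ae_restrict measurableSet_Ioc] with s hs
    exact Real.rpow_nonneg hs.1.le _

lemma aux_morrey {N : ℕ} (u : EuclideanSpace ℝ (Fin N) → ℝ) (hu : ContDiff ℝ 1 u)
    (c x : EuclideanSpace ℝ (Fin N)) (r q : ℝ) (hr : 0 < r) (hx : x ∈ closedBall c r)
    (hq1 : 1 < q) (hq : (N : ℝ) / q < 1) :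
    ∫⁻ z in ball c r, ‖u z - u x‖ₑ ≤ ENNReal.ofReal (2 * r * (1 / (1 - N / q))) *
      ((∫⁻ z in ball c r, ‖fderiv ℝ u z‖ₑ ^ q) ^ (1 / q) * (volume (ball c r)) ^ (1 - 1 / q)) := by
  have hf : Continuous (fun z => ‖fderiv ℝ u z‖ₑ) := (hu.continuous_fderiv one_ne_zero).enorm
  have hq0 : 0 < q := by linarith
  set J := ∫⁻ z in ball c r, ‖fderiv ℝ u z‖ₑ ^ q
  set V := volume (ball c r)
  have hs : ∀ s ∈ Set.Ioc (0:ℝ) 1, ∫⁻ z in ball c r, ‖fderiv ℝ u (x + s • (z - x))‖ₑ ≤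
      ENNReal.ofReal (s ^ (-(N / q) : ℝ)) * (J ^ (1 / q) * V ^ (1 - 1 / q)) := by
    intro s hs
    have hc : Continuous (fun z => ‖fderiv ℝ u (x + s • (z - x))‖ₑ) := hf.comp (by fun_prop)
    have h1 := lintegral_mul_norm_pow_le (μ := volume.restrict (ball c r))
      (f := fun z => ‖fderiv ℝ u (x + s • (z - x))‖ₑ ^ q) (g := fun _ => 1)
      (hc.measurable.pow_const q).aemeasurable aemeasurable_const (p := 1 / q) (q := 1 - 1 / q) (by positivity)
      (by rw [sub_nonneg, div_le_one hq0]; exact hq1.le) (by ring)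
    have h2 := aux_scale (fun z => ‖fderiv ℝ u z‖ₑ ^ q) (hf.measurable.pow_const q) c x r s hx hs.1 hs.2
    simp only [← ENNReal.rpow_mul, mul_one_div_cancel hq0.ne', ENNReal.rpow_one, ENNReal.one_rpow, mul_one,
      lintegral_const, one_mul, Measure.restrict_apply_univ] at h1
    refine h1.trans ?_
    rw [← mul_assoc]
    gcongr
    refine (ENNReal.rpow_le_rpow h2 (by positivity)).trans (le_of_eq ?_)
    rw [ENNReal.mul_rpow_of_nonneg _ _ (by positivity), ENNReal.ofReal_rpow_of_nonneg (Real.rpow_nonneg hs.1.le _) (by positivity),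
      ← Real.rpow_mul hs.1.le]
    congr 3
    ring
  have hzx : ∀ z ∈ ball c r, ‖z - x‖ₑ ≤ ENNReal.ofReal (2 * r) := by
    intro z hz
    rw [← ofReal_norm, ← dist_eq_norm]
    apply ENNReal.ofReal_le_ofReal
    have := dist_triangle_right z x c
    rw [mem_ball] at hz; rw [mem_closedBall] at hx; linarith
  calc ∫⁻ z in ball c r, ‖u z - u x‖ₑ
      ≤ ∫⁻ z in ball c r, ∫⁻ s in Set.Ioc (0:ℝ) 1, ‖fderiv ℝ u (x + s • (z - x))‖ₑ * ENNReal.ofReal (2 * r) := by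
        refine setLIntegral_mono' measurableSet_ball fun z hz => (aux_ftc u hu x z).trans ?_
        refine lintegral_mono fun s => ?_
        gcongr
        exact hzx z hz
    _ = ∫⁻ s in Set.Ioc (0:ℝ) 1, ∫⁻ z in ball c r, ‖fderiv ℝ u (x + s • (z - x))‖ₑ * ENNReal.ofReal (2 * r) := by
        apply lintegral_lintegral_swap
        apply Measurable.aemeasurable
        apply Measurable.mul_const
        exact (hf.comp (g := fun z => ‖fderiv ℝ u z‖ₑ)
          (f := fun a : EuclideanSpace ℝ (Fin N) × ℝ => x + a.2 • (a.1 - x)) (by fun_prop)).measurable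
    _ ≤ ∫⁻ s in Set.Ioc (0:ℝ) 1, ENNReal.ofReal (s ^ (-(N / q) : ℝ)) * ((J ^ (1 / q) * V ^ (1 - 1 / q)) * ENNReal.ofReal (2 * r)) := by
        refine setLIntegral_mono' measurableSet_Ioc fun s h => ?_
        rw [lintegral_mul_const' _ _ ENNReal.ofReal_ne_top, ← mul_assoc]
        gcongr
        exact hs s h
    _ = _ := by
        rw [lintegral_mul_const _ (by fun_prop), aux_kappa _ hq, ENNReal.ofReal_mul (p := 2 * r) (by positivity)]
        ring

lemma aux_holder {α : Type*} [MeasurableSpace α] (μ : Measure α) (f v : α → ℝ≥0∞) (hf : AEMeasurable f μ)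
    (hv : AEMeasurable v μ) (hvt : ∀ z, v z ≠ ⊤) (p t : ℝ) (ht : 1 < t) 
    (hG : ∫⁻ z, v z ^ (-(1 / (t - 1))) ∂μ ≠ ⊤) :
    (∫⁻ z, f z ^ (p / t) ∂μ) ≤ (∫⁻ z, v z * f z ^ p ∂μ) ^ (1 / t) *
      (∫⁻ z, v z ^ (-(1 / (t - 1))) ∂μ) ^ (1 - 1 / t) := by
  have ht0 : 0 < t := by linarith
  have h1 := lintegral_mul_norm_pow_le (μ := μ) (f := fun z => v z * f z ^ p)
    (g := fun z => v z ^ (-(1 / (t - 1)))) (hv.mul (hf.pow_const p)) (hv.pow_const _) (p := 1 / t) (q := 1 - 1 / t)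
    (by positivity) (by rw [sub_nonneg, div_le_one ht0]; exact ht.le) (by ring)
  refine le_trans (lintegral_mono_ae ?_) h1
  filter_upwards [ae_lt_top' (hv.pow_const _) hG] with z hz
  have h0 : v z ≠ 0 := by
    intro h
    rw [h, ENNReal.zero_rpow_of_neg (by have : 0 < t - 1 := by linarith
                                        simpa using this)] at hz
    exact lt_irrefl _ hz
  rw [ENNReal.mul_rpow_of_nonneg _ _ (by positivity), ← ENNReal.rpow_mul, ← ENNReal.rpow_mul,
    mul_right_comm, ← ENNReal.rpow_add _ _ h0 (hvt z)]
  have e : 1 / t + -(1 / (t - 1)) * (1 - 1 / t) = 0 := by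
    have : t - 1 ≠ 0 := by linarith
    field_simp; ring
  rw [e, ENNReal.rpow_zero, one_mul, mul_one_div]

/-- Lyapunov inequality for the weighted `p`-Laplacian with an `A_t` coefficient `v`,
case `p > N`, `1 < t < p/N`:
`1 ≤ C(p,t,N) · rΩ^(p - tN) · g(rΩ)^(t-1) · ∫_Ω w`. -/
theorem lyapunov_inequality_weighted (N : ℕ) (hN : 1 ≤ N) (p t : ℝ)
    (hp : (N : ℝ) < p) (ht1 : 1 < t) (ht2 : t < p / N) :
    ∃ C : ℝ, 0 < C ∧
      ∀ (Ω : Set (EuclideanSpace ℝ (Fin N))) (rΩ : ℝ) (G : ℝ≥0∞)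
        (v w u : EuclideanSpace ℝ (Fin N) → ℝ),
        IsOpen Ω →
        -- `rΩ` is the (finite, positive) inner radius of `Ω`
        IsLUB ((fun x => infDist x Ωᶜ) '' Ω) rΩ →
        0 < rΩ →
        -- `v` is a nonnegative locally integrable weight in the Muckenhoupt class `A_t`
        (∀ x, 0 ≤ v x) →
        LocallyIntegrable v →
        (∃ c : ℝ≥0∞, ∀ (x : EuclideanSpace ℝ (Fin N)) (ρ : ℝ), 0 < ρ →
          (∫⁻ z in ball x ρ, ENNReal.ofReal (v z)) *
            (∫⁻ z in ball x ρ, ENNReal.ofReal (v z) ^ (-(1 / (t - 1)))) ^ (t - 1)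
            ≤ c * volume (ball x ρ) ^ t) →
        -- `G = g(rΩ) = sup_{x ∈ Ω} ∫_{B(x,rΩ)} v^(-1/(t-1))` is finite
        IsLUB ((fun x => ∫⁻ z in ball x rΩ, ENNReal.ofReal (v z) ^ (-(1 / (t - 1)))) '' Ω) G →
        G ≠ ⊤ →
        -- `w ≥ 0` is integrable on `Ω`
        (∀ x ∈ Ω, 0 ≤ w x) →
        IntegrableOn w Ω →
        -- `u` is a nontrivial solution, tested against itself
        ContDiff ℝ 1 u →
        HasCompactSupport u →
        tsupport u ⊆ Ω →
        u ≠ 0 →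
        (∫ x in Ω, v x * ‖fderiv ℝ u x‖ ^ p) = (∫ x in Ω, w x * |u x| ^ p) →
        1 ≤ C * rΩ ^ (p - t * N) * G.toReal ^ (t - 1) * ∫ x in Ω, w x := by
  classical
  have hN0 : (1:ℝ) ≤ N := by exact_mod_cast hN
  have ht0 : 0 < t := by linarith
  have hp0 : 0 < p := by linarith
  set q := p / t with hqdef
  have hNq : (N:ℝ) < q := by
    rw [hqdef, lt_div_iff₀ ht0]
    rw [lt_div_iff₀ (by linarith)] at ht2
    linarith
  have hq1 : 1 < q := by linarith
  have hq0 : 0 < q := by linarith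
  have hNq1 : (N:ℝ) / q < 1 := by rw [div_lt_one hq0]; exact hNq
  set κ : ℝ := 1 / (1 - N / q) with hκ
  have hκ0 : 0 < κ := by rw [hκ]; apply one_div_pos.2; linarith
  set ω : ℝ := (volume (ball (0 : EuclideanSpace ℝ (Fin N)) 1)).toReal with hω
  have hω0 : 0 < ω := ENNReal.toReal_pos (measure_ball_pos _ _ one_pos).ne' measure_ball_lt_top.ne
  refine ⟨(4 * κ) ^ p * ω ^ (-t), by positivity, ?_⟩
  intro Ω r G v w u hΩ hr hr0 hv0 hvloc _ hG hGtop hw0 hwint hu hucs husupp hune heq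
  have hucont := hu.continuous
  -- maximum point
  obtain ⟨x0, hx0⟩ : ∃ x0, ∀ x, |u x| ≤ |u x0| := by
    obtain ⟨x0, h⟩ := hucont.norm.exists_forall_ge_of_hasCompactSupport hucs.norm
    exact ⟨x0, fun x => by simpa using h x⟩
  set M := |u x0| with hM
  have hM0 : 0 < M := by
    obtain ⟨x, hx⟩ := Function.ne_iff.1 hune
    exact lt_of_lt_of_le (abs_pos.2 hx) (hx0 x)
  have hx0Ω : x0 ∈ Ω := husupp (subset_tsupport u (by
    rw [Function.mem_support]; exact abs_pos.1 hM0))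
  have hne : (Ωᶜ).Nonempty := by
    by_contra h
    rw [Set.not_nonempty_iff_eq_empty] at h
    have : r ≤ 0 := hr.2 (by rintro _ ⟨x, _, rfl⟩; simp [h])
    linarith
  obtain ⟨y, hyΩ, hy⟩ := hΩ.isClosed_compl.exists_infDist_eq_dist hne x0
  have hyr : dist x0 y ≤ r := by rw [← hy]; exact hr.1 ⟨x0, hx0Ω, rfl⟩
  have huy : u y = 0 := by
    by_contra h
    exact hyΩ (husupp (subset_tsupport u h))
  have hfc : Continuous (fun z => fderiv ℝ u z) := hu.continuous_fderiv one_ne_zero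
  set V := volume (ball x0 r) with hV
  have hVtop : V ≠ ⊤ := measure_ball_lt_top.ne
  set J := ∫⁻ z in ball x0 r, ‖fderiv ℝ u z‖ₑ ^ q with hJ
  set K := ENNReal.ofReal (2 * r * κ) * (J ^ (1 / q) * V ^ (1 - 1 / q)) with hK
  have hm1 : ∫⁻ z in ball x0 r, ‖u z - u x0‖ₑ ≤ K :=
    aux_morrey u hu x0 x0 r q hr0 (mem_closedBall_self hr0.le) hq1 hNq1
  have hm2 : ∫⁻ z in ball x0 r, ‖u z - u y‖ₑ ≤ K :=
    aux_morrey u hu x0 y r q hr0 (by rw [mem_closedBall, dist_comm]; exact hyr) hq1 hNq1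
  have hMV : ENNReal.ofReal M * V ≤ K + K := by
    calc ENNReal.ofReal M * V = ∫⁻ z in ball x0 r, ‖u x0 - u y‖ₑ := by
          rw [lintegral_const, Measure.restrict_apply_univ, huy, sub_zero, Real.enorm_eq_ofReal_abs]
      _ ≤ ∫⁻ z in ball x0 r, (‖u z - u x0‖ₑ + ‖u z - u y‖ₑ) := by
          refine lintegral_mono fun z => ?_
          have : u x0 - u y = (u z - u y) - (u z - u x0) := by ring
          simp only []
          rw [this, add_comm]
          exact enorm_sub_le
      _ = _ := lintegral_add_left (by fun_prop) _
      _ ≤ K + K := add_le_add hm1 hm2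
  -- Hoelder
  have hGx : ∫⁻ z in ball x0 r, ENNReal.ofReal (v z) ^ (-(1 / (t - 1))) ≤ G := hG.1 ⟨x0, hx0Ω, rfl⟩
  set A := ∫ x in Ω, v x * ‖fderiv ℝ u x‖ ^ p with hA
  have hfp : Continuous (fun x => ‖fderiv ℝ u x‖ ^ p) :=
    hfc.norm.rpow_const (fun _ => Or.inr hp0.le)
  have hfsupp : HasCompactSupport (fun x => ‖fderiv ℝ u x‖ ^ p) :=
    (hucs.fderiv (𝕜 := ℝ)).comp_left (g := fun L => ‖L‖ ^ p) (by simp [Real.zero_rpow hp0.ne'])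
  have hint : Integrable (fun x => v x * ‖fderiv ℝ u x‖ ^ p) := by
    simpa [smul_eq_mul] using hvloc.integrable_smul_right_of_hasCompactSupport hfp hfsupp
  have hnn : ∀ x, 0 ≤ v x * ‖fderiv ℝ u x‖ ^ p := fun x => mul_nonneg (hv0 x) (by positivity)
  have hA0 : 0 ≤ A := integral_nonneg fun x => hnn x
  have hpt : ∀ z, ENNReal.ofReal (v z) * ‖fderiv ℝ u z‖ₑ ^ p = ENNReal.ofReal (v z * ‖fderiv ℝ u z‖ ^ p) := by
    intro z
    rw [ENNReal.ofReal_mul (hv0 z), ← ofReal_norm, ENNReal.ofReal_rpow_of_nonneg (norm_nonneg _) hp0.le]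
  have hAint : ∫⁻ z in ball x0 r, ENNReal.ofReal (v z) * ‖fderiv ℝ u z‖ₑ ^ p ≤ ENNReal.ofReal A := by
    simp_rw [hpt]
    rw [hA, setIntegral_eq_integral_of_forall_compl_eq_zero, ofReal_integral_eq_lintegral_ofReal hint (ae_of_all _ hnn)]
    · exact setLIntegral_le_lintegral _ _
    · intro x hx
      have : fderiv ℝ u x = 0 := by
        by_contra h
        exact hx (husupp (support_fderiv_subset ℝ h))
      rw [this, norm_zero, Real.zero_rpow hp0.ne', mul_zero]
  have hJle : J ≤ ENNReal.ofReal A ^ (1 / t) * G ^ (1 - 1 / t) := by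
    refine (aux_holder (volume.restrict (ball x0 r)) (fun z => ‖fderiv ℝ u z‖ₑ) (fun z => ENNReal.ofReal (v z))
      hfc.enorm.measurable.aemeasurable hvloc.aestronglyMeasurable.aemeasurable.ennreal_ofReal.restrict
      (fun z => ENNReal.ofReal_ne_top) p t ht1 (ne_top_of_le_ne_top hGtop hGx)).trans ?_
    have : 0 ≤ 1 - 1 / t := by rw [sub_nonneg, div_le_one ht0]; exact ht1.le
    gcongr
  have h1t : 0 ≤ 1 - 1 / t := by rw [sub_nonneg, div_le_one ht0]; exact ht1.le
  have h1q : 0 ≤ 1 - 1 / q := by rw [sub_nonneg, div_le_one hq0]; exact hq1.le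
  have hRtop : ENNReal.ofReal A ^ (1 / t) * G ^ (1 - 1 / t) ≠ ⊤ :=
    ENNReal.mul_ne_top (ENNReal.rpow_ne_top_of_nonneg (by positivity) ENNReal.ofReal_ne_top)
      (ENNReal.rpow_ne_top_of_nonneg h1t hGtop)
  have hJtop : J ≠ ⊤ := ne_top_of_le_ne_top hRtop hJle
  -- real versions
  set g := G.toReal with hg
  have hg0 : 0 ≤ g := ENNReal.toReal_nonneg
  set j := J.toReal with hj
  have hj0 : 0 ≤ j := ENNReal.toReal_nonneg
  set m := V.toReal with hm
  have hmeq : m = r ^ (N:ℝ) * ω := by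
    rw [hm, hV, Measure.addHaar_ball_of_pos _ _ hr0, finrank_euclideanSpace_fin, ENNReal.toReal_mul,
      ENNReal.toReal_ofReal (by positivity), Real.rpow_natCast]
  have hm0 : 0 < m := by rw [hmeq]; positivity
  have hjle : j ≤ A ^ (1 / t) * g ^ (1 - 1 / t) := by
    have := ENNReal.toReal_mono hRtop hJle
    rwa [ENNReal.toReal_mul, ← ENNReal.toReal_rpow, ← ENNReal.toReal_rpow, ENNReal.toReal_ofReal hA0] at this
  have hjt : j ^ t ≤ A * g ^ (t - 1) := by
    refine (Real.rpow_le_rpow hj0 hjle ht0.le).trans (le_of_eq ?_)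
    rw [Real.mul_rpow (by positivity) (by positivity), ← Real.rpow_mul hA0, ← Real.rpow_mul hg0,
      one_div_mul_cancel ht0.ne', Real.rpow_one, sub_mul, one_div_mul_cancel ht0.ne', one_mul]
  have hKtop : K ≠ ⊤ := ENNReal.mul_ne_top ENNReal.ofReal_ne_top
    (ENNReal.mul_ne_top (ENNReal.rpow_ne_top_of_nonneg (by positivity) hJtop)
      (ENNReal.rpow_ne_top_of_nonneg h1q hVtop))
  have hKr : K.toReal = 2 * r * κ * (j ^ (1 / q) * m ^ (1 - 1 / q)) := by
    rw [hK, ENNReal.toReal_mul, ENNReal.toReal_mul, ← ENNReal.toReal_rpow, ← ENNReal.toReal_rpow,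
      ENNReal.toReal_ofReal (by positivity)]
  have hMm : M * m ≤ 4 * κ * r * (j ^ (1 / q) * m ^ (1 - 1 / q)) := by
    have := ENNReal.toReal_mono (ENNReal.add_ne_top.2 ⟨hKtop, hKtop⟩) hMV
    rw [ENNReal.toReal_mul, ENNReal.toReal_add hKtop hKtop, hKr, ENNReal.toReal_ofReal hM0.le] at this
    linarith
  have hMle : M ≤ 4 * κ * r * (j ^ (1 / q) * m ^ (-(1 / q))) := by
    rw [sub_eq_add_neg, Real.rpow_add hm0, Real.rpow_one] at hMm
    refine le_of_mul_le_mul_right ?_ hm0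
    linarith
  have hpq : 1 / q * p = t := by rw [hqdef]; field_simp
  have hMp : M ^ p ≤ (4 * κ) ^ p * ω ^ (-t) * r ^ (p - t * N) * j ^ t := by
    refine (Real.rpow_le_rpow hM0.le hMle hp0.le).trans (le_of_eq ?_)
    rw [Real.mul_rpow (by positivity) (by positivity), Real.mul_rpow (by positivity) (by positivity),
      Real.mul_rpow (by positivity) (by positivity),
      Real.mul_rpow (x := j ^ (1 / q)) (by positivity) (by positivity), ← Real.rpow_mul hj0, ← Real.rpow_mul hm0.le,
      neg_mul, hpq, hmeq, Real.mul_rpow (by positivity) (by positivity), ← Real.rpow_mul hr0.le,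
      sub_eq_add_neg, Real.rpow_add hr0]
    rw [show (N:ℝ) * -t = -(t * N) by ring]
    ring
  have hAle : A ≤ M ^ p * ∫ x in Ω, w x := by
    rw [heq, ← integral_const_mul]
    refine integral_mono_of_nonneg ?_ (hwint.const_mul _) ?_
    · filter_upwards [self_mem_ae_restrict hΩ.measurableSet] with x hx
      exact mul_nonneg (hw0 x hx) (by positivity)
    · filter_upwards [self_mem_ae_restrict hΩ.measurableSet] with x hx
      rw [mul_comm]
      exact mul_le_mul_of_nonneg_right (Real.rpow_le_rpow (abs_nonneg _) (hx0 x) hp0.le) (hw0 x hx)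
  have hMp0 : 0 < M ^ p := by positivity
  refine le_of_mul_le_mul_right ?_ hMp0
  calc 1 * M ^ p ≤ (4 * κ) ^ p * ω ^ (-t) * r ^ (p - t * N) * j ^ t := by rw [one_mul]; exact hMp
    _ ≤ (4 * κ) ^ p * ω ^ (-t) * r ^ (p - t * N) * ((M ^ p * ∫ x in Ω, w x) * g ^ (t - 1)) := by
      gcongr
      exact hjt.trans (mul_le_mul_of_nonneg_right hAle (by positivity))
    _ = _ := by ring
end

section
/- Let N ≥ 1, p > N, and 1 < t < p/N. There exists a constant C = C(p,t,N) > 0 such that for every open set Ω ⊆ ℝ^N with finite positive inner radius r_Ω, every nonnegative measurable function v on ℝ^N with g(r_Ω) := sup_{x∈Ω} ∫_{B(x,r_Ω)} v(z)^{−1/(t−1)} dz < ∞, and every C^1 function u with compact support contained in Ω, one has sup_{x∈Ω} |u(x)| ≤ C · r_Ω^{(p−tN)/p} · g(r_Ω)^{(t−1)/p} · (∫_Ω v(x)|∇u(x)|^p dx)^{1/p}. -/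
open MeasureTheory Metric ENNReal

lemma wm_scale {N : ℕ} (F : EuclideanSpace ℝ (Fin N) → ℝ≥0∞) (hF : Measurable F)
    (z : EuclideanSpace ℝ (Fin N)) (s : ℝ) (hs : 0 < s) :
    ∫⁻ w, F (z + s • (w - z)) = ENNReal.ofReal (s ^ (-(N : ℝ))) * ∫⁻ w, F w := by
  have h1 : ∀ w, F (z + s • (w - z)) = (fun y => F ((z - s • z) + y)) (s • w) := by
    intro w
    simp only
    congr 1
    rw [smul_sub]; abel
  simp_rw [h1]
  have hm : Measurable (fun y => F ((z - s • z) + y)) := hF.comp (measurable_const_add _)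
  rw [← lintegral_map hm (measurable_const_smul s), Measure.map_addHaar_smul _ hs.ne',
    lintegral_smul_measure, lintegral_add_left_eq_self]
  congr 2
  rw [Real.rpow_neg hs.le, Real.rpow_natCast, finrank_euclideanSpace_fin, abs_of_pos (by positivity)]

lemma wm_jensen {α : Type*} [MeasurableSpace α] (μ : Measure α) (f : α → ℝ≥0∞)
    (hf : Measurable f) (q : ℝ) (hq : 1 < q) :
    ∫⁻ a, f a ∂μ ≤ (∫⁻ a, f a ^ q ∂μ) ^ (1 / q) * μ Set.univ ^ (1 - 1 / q) := by
  have := ENNReal.lintegral_mul_le_Lp_mul_Lq μ (Real.HolderConjugate.conjExponent hq)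
    hf.aemeasurable (g := fun _ => 1) aemeasurable_const
  simp only [Pi.mul_apply, mul_one, ENNReal.one_rpow, lintegral_const, one_mul] at this
  convert this using 3
  rw [Real.conjExponent]
  field_simp

lemma wm_ftc {N : ℕ} (u : EuclideanSpace ℝ (Fin N) → ℝ) (hu : ContDiff ℝ 1 u)
    (z w : EuclideanSpace ℝ (Fin N)) :
    ‖u w - u z‖ₑ ≤ ∫⁻ s in Set.Ioo (0:ℝ) 1, ‖fderiv ℝ u (z + s • (w - z))‖ₑ * ‖w - z‖ₑ := by
  have hc : ContDiff ℝ 1 (fun s : ℝ => u (z + s • (w - z))) := by fun_prop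
  have h := enorm_sub_le_lintegral_deriv_of_contDiffOn_Icc (a := 0) (b := 1)
    hc.contDiffOn zero_le_one
  simp only [one_smul, zero_smul, add_zero, add_sub_cancel] at h
  refine h.trans ?_
  rw [← restrict_Ioo_eq_restrict_Icc]
  refine lintegral_mono fun s => ?_
  have hd : HasDerivAt (fun s : ℝ => z + s • (w - z)) (w - z) s := by
    simpa using ((hasDerivAt_id s).smul_const (w - z)).const_add z
  have h2 := ((hu.differentiable one_ne_zero) (z + s • (w - z))).hasFDerivAt.comp_hasDerivAt s hd
  have h3 : deriv (fun s : ℝ => u (z + s • (w - z))) s = fderiv ℝ u (z + s • (w - z)) (w - z) :=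
    h2.deriv
  rw [h3]
  exact ContinuousLinearMap.le_opENorm _ _

lemma wm_K (a : ℝ) (ha : a < 1) :
    ∫⁻ s in Set.Ioo (0:ℝ) 1, ENNReal.ofReal (s ^ (-a)) = ENNReal.ofReal (1 / (1 - a)) := by
  have hi : IntegrableOn (fun s : ℝ => s ^ (-a)) (Set.Ioo 0 1) := by
    rw [intervalIntegral.integrableOn_Ioo_rpow_iff one_pos]; linarith
  rw [← ofReal_integral_eq_lintegral_ofReal hi]
  · rw [← integral_Ioc_eq_integral_Ioo, ← intervalIntegral.integral_of_le zero_le_one,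
      integral_rpow (Or.inl (by linarith))]
    rw [Real.one_rpow, Real.zero_rpow (by linarith)]
    congr 1
    ring_nf
  · filter_upwards [self_mem_ae_restrict measurableSet_Ioo] with s hs
    exact Real.rpow_nonneg hs.1.le _

lemma wm_avg {N : ℕ} (u : EuclideanSpace ℝ (Fin N) → ℝ) (hu : ContDiff ℝ 1 u)
    (x z : EuclideanSpace ℝ (Fin N)) (r q : ℝ) (hr : 0 < r) (hq1 : 1 < q) (hqN : N < q)
    (hz : z ∈ closedBall x r) :
    ∫⁻ w in ball x r, ‖u w - u z‖ₑ ≤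
      ENNReal.ofReal (2 * r) * (ENNReal.ofReal (1 / (1 - N / q)) *
        ((∫⁻ w in ball x r, ‖fderiv ℝ u w‖ₑ ^ q) ^ (1 / q) * volume (ball x r) ^ (1 - 1 / q))) := by
  set A := ∫⁻ w in ball x r, ‖fderiv ℝ u w‖ₑ ^ q with hA
  have hq0 : 0 < q := by linarith
  have hDc : Continuous (fun w => fderiv ℝ u w) := hu.continuous_fderiv one_ne_zero
  have hDm : Measurable (fun w => ‖fderiv ℝ u w‖ₑ) := hDc.enorm.measurable
  have step1 : ∀ w ∈ ball x r, ‖u w - u z‖ₑ ≤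
      ENNReal.ofReal (2 * r) * ∫⁻ s in Set.Ioo (0:ℝ) 1, ‖fderiv ℝ u (z + s • (w - z))‖ₑ := by
    intro w hw
    refine (wm_ftc u hu z w).trans ?_
    rw [lintegral_mul_const'' _ (by
      apply Continuous.aemeasurable
      exact (hDc.comp (by fun_prop)).enorm), mul_comm]
    gcongr
    rw [← ofReal_norm]
    apply ENNReal.ofReal_le_ofReal
    rw [← dist_eq_norm]
    have := dist_triangle_right w z x
    rw [mem_ball] at hw
    rw [mem_closedBall] at hz
    linarith
  have step2 : ∀ s ∈ Set.Ioo (0:ℝ) 1, ∫⁻ w in ball x r, ‖fderiv ℝ u (z + s • (w - z))‖ₑ ≤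
      ENNReal.ofReal (s ^ (-(N / q : ℝ))) * (A ^ (1 / q) * volume (ball x r) ^ (1 - 1 / q)) := by
    intro s hs
    refine (wm_jensen _ _ ((hDc.comp (by fun_prop)).enorm.measurable) q hq1).trans ?_
    rw [Measure.restrict_apply_univ, ← mul_assoc]
    gcongr
    have h : ∫⁻ w in ball x r, ‖fderiv ℝ u (z + s • (w - z))‖ₑ ^ q ≤
        ENNReal.ofReal (s ^ (-(N : ℝ))) * A := by
      rw [hA, ← lintegral_indicator measurableSet_ball, ← lintegral_indicator measurableSet_ball,
        ← wm_scale _ ((hDm.pow_const q).indicator measurableSet_ball) z s hs.1]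
      refine lintegral_mono fun w => ?_
      by_cases hw : w ∈ ball x r
      · have hm : z + s • (w - z) ∈ ball x r := by
          have h1 := (convex_ball x r).combo_interior_closure_mem_interior (x := w) (y := z)
            (a := s) (b := 1 - s) (by rwa [isOpen_ball.interior_eq])
            (by rwa [closure_ball _ hr.ne']) hs.1 (by linarith [hs.2]) (by ring)
          rw [isOpen_ball.interior_eq] at h1
          convert h1 using 1
          rw [smul_sub, sub_smul, one_smul]; abel
        rw [Set.indicator_of_mem hw, Set.indicator_of_mem hm]
      · rw [Set.indicator_of_notMem hw]; exact zero_le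
    refine (ENNReal.rpow_le_rpow h (by positivity)).trans ?_
    rw [ENNReal.mul_rpow_of_nonneg _ _ (by positivity),
      ENNReal.ofReal_rpow_of_pos (Real.rpow_pos_of_pos hs.1 _), ← Real.rpow_mul hs.1.le]
    apply le_of_eq
    congr 4
    ring
  calc ∫⁻ w in ball x r, ‖u w - u z‖ₑ
      ≤ ∫⁻ w in ball x r, ENNReal.ofReal (2 * r) *
          ∫⁻ s in Set.Ioo (0:ℝ) 1, ‖fderiv ℝ u (z + s • (w - z))‖ₑ :=
        setLIntegral_mono' measurableSet_ball step1
    _ = ENNReal.ofReal (2 * r) * ∫⁻ w in ball x r,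
          ∫⁻ s in Set.Ioo (0:ℝ) 1, ‖fderiv ℝ u (z + s • (w - z))‖ₑ :=
        lintegral_const_mul' _ _ ENNReal.ofReal_ne_top
    _ = ENNReal.ofReal (2 * r) * ∫⁻ s in Set.Ioo (0:ℝ) 1,
          ∫⁻ w in ball x r, ‖fderiv ℝ u (z + s • (w - z))‖ₑ := by
        congr 1
        apply lintegral_lintegral_swap
        apply Continuous.aemeasurable
        exact (hDc.comp (f := fun a : EuclideanSpace ℝ (Fin N) × ℝ => z + a.2 • (a.1 - z))
          (by fun_prop)).enorm
    _ ≤ ENNReal.ofReal (2 * r) * ∫⁻ s in Set.Ioo (0:ℝ) 1,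
          ENNReal.ofReal (s ^ (-(N / q : ℝ))) *
            (A ^ (1 / q) * volume (ball x r) ^ (1 - 1 / q)) := by
        exact mul_le_mul_right (setLIntegral_mono' measurableSet_Ioo step2) _
    _ = _ := by
        rw [lintegral_mul_const _ (by fun_prop), wm_K _ (by rwa [div_lt_one hq0])]

lemma wm_morrey {N : ℕ} (u : EuclideanSpace ℝ (Fin N) → ℝ) (hu : ContDiff ℝ 1 u)
    (x y : EuclideanSpace ℝ (Fin N)) (r q : ℝ) (hr : 0 < r) (hq1 : 1 < q) (hqN : N < q)
    (hy : y ∈ closedBall x r) :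
    ‖u x - u y‖ₑ ≤ ENNReal.ofReal (4 * r * (1 / (1 - N / q))) *
        (volume (ball x r) ^ (- (1 / q)) * (∫⁻ w in ball x r, ‖fderiv ℝ u w‖ₑ ^ q) ^ (1 / q)) := by
  have hV0 : volume (ball x r) ≠ 0 := (measure_ball_pos _ _ hr).ne'
  have hVt : volume (ball x r) ≠ ⊤ := measure_ball_lt_top.ne
  have h1 := wm_avg u hu x x r q hr hq1 hqN (mem_closedBall_self hr.le)
  have h2 := wm_avg u hu x y r q hr hq1 hqN hy
  have hK : 0 < 1 - N / q := by
    have : N / q < 1 := by rw [div_lt_one (by linarith)]; exact hqN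
    linarith
  have h3 : ‖u x - u y‖ₑ * volume (ball x r) ≤ 
      ∫⁻ w in ball x r, (‖u w - u x‖ₑ + ‖u w - u y‖ₑ) := by
    rw [← setLIntegral_const]
    refine lintegral_mono fun w => ?_
    have := enorm_sub_le (a := u w - u y) (b := u w - u x)
    rw [show u w - u y - (u w - u x) = u x - u y by ring] at this
    rw [add_comm]
    exact this
  rw [lintegral_add_left (show Measurable fun w => ‖u w - u x‖ₑ from
    ((hu.continuous.sub continuous_const).enorm).measurable)] at h3
  have h4 := h3.trans (add_le_add h1 h2)
  rw [← ENNReal.le_div_iff_mul_le (Or.inl hV0) (Or.inl hVt)] at h4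
  refine h4.trans (le_of_eq ?_)
  have e1 : volume (ball x r) ^ (1 - 1 / q) = volume (ball x r) * volume (ball x r) ^ (-(1 / q)) := by
    rw [sub_eq_add_neg, ENNReal.rpow_add _ _ hV0 hVt, ENNReal.rpow_one]
  have e2 : ENNReal.ofReal (4 * r * (1 / (1 - N / q))) =
      2 * (ENNReal.ofReal (2 * r) * ENNReal.ofReal (1 / (1 - N / q))) := by
    rw [← ENNReal.ofReal_mul (by positivity), ← ENNReal.ofReal_ofNat,
      ← ENNReal.ofReal_mul (by positivity)]
    congr 1; ring
  rw [e1, e2, ENNReal.div_eq_inv_mul]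
  set V := volume (ball x r)
  set A := ∫⁻ w in ball x r, ‖fderiv ℝ u w‖ₑ ^ q
  calc _ = (V⁻¹ * V) * (2 * (ENNReal.ofReal (2 * r) * ENNReal.ofReal (1 / (1 - N / q))) *
        (V ^ (-(1 / q)) * A ^ (1 / q))) := by ring
    _ = _ := by rw [ENNReal.inv_mul_cancel hV0 hVt, one_mul]

lemma wm_holder {α : Type*} [MeasurableSpace α] (μ : Measure α) (v : α → ℝ) (hv : Measurable v)
    (D : α → ℝ≥0∞) (hD : Measurable D) (p t : ℝ) (ht : 1 < t)
    (hfin : ∫⁻ z, ENNReal.ofReal (v z) ^ (-(1 / (t - 1))) ∂μ ≠ ⊤) :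
    ∫⁻ z, D z ^ (p / t) ∂μ ≤ (∫⁻ z, ENNReal.ofReal (v z) * D z ^ p ∂μ) ^ (1 / t) *
      (∫⁻ z, ENNReal.ofReal (v z) ^ (-(1 / (t - 1))) ∂μ) ^ ((t - 1) / t) := by
  have ht0 : 0 < t := by linarith
  have ht1 : 0 < t - 1 := by linarith
  have hvm : Measurable (fun z => ENNReal.ofReal (v z)) := hv.ennreal_ofReal
  have h := ENNReal.lintegral_mul_le_Lp_mul_Lq μ (Real.HolderConjugate.conjExponent ht)
    (f := fun z => (ENNReal.ofReal (v z) * D z ^ p) ^ (1 / t))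
    (g := fun z => ENNReal.ofReal (v z) ^ (-(1 / t)))
    ((hvm.mul (hD.pow_const p)).pow_const _).aemeasurable (hvm.pow_const _).aemeasurable
  have hae := ae_lt_top (hvm.pow_const (-(1 / (t - 1)))) hfin
  calc ∫⁻ z, D z ^ (p / t) ∂μ ≤ ∫⁻ z, ((fun z => (ENNReal.ofReal (v z) * D z ^ p) ^ (1 / t)) *
        (fun z => ENNReal.ofReal (v z) ^ (-(1 / t)))) z ∂μ := by
        refine lintegral_mono_ae ?_
        filter_upwards [hae] with z hz
        have hz0 : ENNReal.ofReal (v z) ≠ 0 := by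
          intro h0
          rw [h0, ENNReal.zero_rpow_of_neg (by simpa using ht1)] at hz
          exact lt_irrefl _ hz
        simp only [Pi.mul_apply]
        rw [ENNReal.mul_rpow_of_nonneg _ _ (by positivity), mul_right_comm,
          ← ENNReal.rpow_add _ _ hz0 ENNReal.ofReal_ne_top, add_neg_cancel, ENNReal.rpow_zero,
          one_mul, ← ENNReal.rpow_mul, mul_one_div]
    _ ≤ _ := h
    _ = _ := by
        simp_rw [← ENNReal.rpow_mul]
        rw [Real.conjExponent]
        congr 2
        · refine lintegral_congr fun z => ?_
          rw [one_div_mul_cancel ht0.ne', ENNReal.rpow_one]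
        · refine lintegral_congr fun z => ?_
          congr 1
          field_simp
        · field_simp

theorem weighted_morrey_embedding (N : ℕ) (hN : 1 ≤ N) (p t : ℝ)
    (hp : (N : ℝ) < p) (ht1 : 1 < t) (ht2 : t < p / N) :
    ∃ C : ℝ, 0 < C ∧
      ∀ (Ω : Set (EuclideanSpace ℝ (Fin N))) (rΩ : ℝ) (G : ℝ≥0∞)
        (v u : EuclideanSpace ℝ (Fin N) → ℝ),
        IsOpen Ω →
        -- `rΩ` is the (finite, positive) inner radius of `Ω`
        IsLUB ((fun x => infDist x Ωᶜ) '' Ω) rΩ →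
        0 < rΩ →
        -- `v` is a nonnegative measurable weight
        Measurable v →
        (∀ x, 0 ≤ v x) →
        -- `G = g(rΩ) = sup_{x ∈ Ω} ∫_{B(x,rΩ)} v^(-1/(t-1))` is finite
        IsLUB ((fun x => ∫⁻ z in ball x rΩ, ENNReal.ofReal (v z) ^ (-(1 / (t - 1)))) '' Ω) G →
        G ≠ ⊤ →
        -- `u` is `C¹` with compact support contained in `Ω`
        ContDiff ℝ 1 u →
        HasCompactSupport u →
        tsupport u ⊆ Ω →
        IntegrableOn (fun x => v x * ‖fderiv ℝ u x‖ ^ p) Ω →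
        ∀ x ∈ Ω, |u x| ≤ C * rΩ ^ ((p - t * N) / p) * G.toReal ^ ((t - 1) / p) *
          (∫ z in Ω, v z * ‖fderiv ℝ u z‖ ^ p) ^ (1 / p) := by
  have hN0 : (0 : ℝ) < N := by exact_mod_cast hN
  have hN1 : (1 : ℝ) ≤ N := by exact_mod_cast hN
  have hp0 : 0 < p := by linarith
  have ht0 : 0 < t := by linarith
  have htN : N < p / t := by
    rw [lt_div_iff₀ hN0] at ht2
    rw [lt_div_iff₀ ht0]; linarith
  have hq1 : 1 < p / t := by linarith
  have hK : 0 < 1 - N / (p / t) := by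
    have : N / (p / t) < 1 := by rw [div_lt_one (by linarith)]; exact htN
    linarith
  set ω := volume (ball (0 : EuclideanSpace ℝ (Fin N)) 1) with hω
  have hω0 : ω ≠ 0 := (measure_ball_pos _ _ one_pos).ne'
  have hωt : ω ≠ ⊤ := measure_ball_lt_top.ne
  have hωr : 0 < ω.toReal := ENNReal.toReal_pos hω0 hωt
  refine ⟨4 * (1 / (1 - N / (p / t))) * ω.toReal ^ (-(1 / (p / t))), by positivity, ?_⟩
  intro Ω r G v u hΩ hr hr0 hv hv0 hG hGt hu _ hsupp hint x hx
  have hne : (Ωᶜ).Nonempty := by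
    by_contra hcon
    rw [Set.not_nonempty_iff_eq_empty] at hcon
    have : r ≤ 0 := hr.2 (by
      rintro _ ⟨y, _, rfl⟩
      simp [hcon])
    linarith
  obtain ⟨y, hyΩ, hy⟩ := hΩ.isClosed_compl.exists_infDist_eq_dist hne x
  have hyr : y ∈ closedBall x r := by
    rw [mem_closedBall, dist_comm, ← hy]
    exact hr.1 ⟨x, hx, rfl⟩
  have huy : u y = 0 := image_eq_zero_of_notMem_tsupport fun h => hyΩ (hsupp h)
  have hm := wm_morrey u hu x y r (p / t) hr0 hq1 htN hyr
  rw [huy, sub_zero] at hm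
  have hDc : Continuous (fun w => fderiv ℝ u w) := hu.continuous_fderiv one_ne_zero
  have hGx : ∫⁻ z in ball x r, ENNReal.ofReal (v z) ^ (-(1 / (t - 1))) ≤ G := hG.1 ⟨x, hx, rfl⟩
  have hh := wm_holder (volume.restrict (ball x r)) v hv (fun w => ‖fderiv ℝ u w‖ₑ)
    hDc.enorm.measurable p t ht1 (ne_top_of_le_ne_top hGt hGx)
  set I := ∫ z in Ω, v z * ‖fderiv ℝ u z‖ ^ p with hI
  have hnn : ∀ z, 0 ≤ v z * ‖fderiv ℝ u z‖ ^ p := fun z =>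
    mul_nonneg (hv0 z) (Real.rpow_nonneg (norm_nonneg _) _)
  have hI0 : 0 ≤ I := integral_nonneg hnn
  have hIe : ENNReal.ofReal I = ∫⁻ z in Ω, ENNReal.ofReal (v z) * ‖fderiv ℝ u z‖ₑ ^ p := by
    rw [hI, ofReal_integral_eq_lintegral_ofReal hint (Filter.Eventually.of_forall hnn)]
    refine lintegral_congr fun z => ?_
    rw [ENNReal.ofReal_mul (hv0 z), ← ofReal_norm, ENNReal.ofReal_rpow_of_nonneg (norm_nonneg _) hp0.le]
  have hIle : ∫⁻ z in ball x r, ENNReal.ofReal (v z) * ‖fderiv ℝ u z‖ₑ ^ p ≤ ENNReal.ofReal I := by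
    rw [hIe, ← lintegral_indicator hΩ.measurableSet]
    refine (setLIntegral_le_lintegral _ _).trans (lintegral_mono fun z => ?_)
    by_cases hz : z ∈ Ω
    · rw [Set.indicator_of_mem hz]
    · rw [Set.indicator_of_notMem hz]
      have : fderiv ℝ u z = 0 :=
        image_eq_zero_of_notMem_tsupport fun h => hz (hsupp (tsupport_fderiv_subset ℝ h))
      rw [this, ← ofReal_norm, norm_zero, ENNReal.ofReal_zero, ENNReal.zero_rpow_of_pos hp0, mul_zero]
  have hA : (∫⁻ w in ball x r, ‖fderiv ℝ u w‖ₑ ^ (p / t)) ^ (1 / (p / t)) ≤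
      ENNReal.ofReal I ^ (1 / p) * G ^ ((t - 1) / p) := by
    have ht1' : 0 < t - 1 := by linarith
    have h5 : ∫⁻ w in ball x r, ‖fderiv ℝ u w‖ₑ ^ (p / t) ≤
        ENNReal.ofReal I ^ (1 / t) * G ^ ((t - 1) / t) := hh.trans (by gcongr)
    refine (ENNReal.rpow_le_rpow h5 (by positivity)).trans (le_of_eq ?_)
    rw [ENNReal.mul_rpow_of_nonneg _ _ (by positivity), ← ENNReal.rpow_mul, ← ENNReal.rpow_mul]
    congr 2 <;> field_simp
  have hfin : ‖u x‖ₑ ≤ ENNReal.ofReal (4 * r * (1 / (1 - N / (p / t)))) *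
      (volume (ball x r) ^ (- (1 / (p / t))) * (ENNReal.ofReal I ^ (1 / p) * G ^ ((t - 1) / p))) :=
    hm.trans (by gcongr)
  have hVt : volume (ball x r) ≠ ⊤ := measure_ball_lt_top.ne
  have hV0 : volume (ball x r) ≠ 0 := (measure_ball_pos _ _ hr0).ne'
  have htop : ENNReal.ofReal (4 * r * (1 / (1 - N / (p / t)))) *
      (volume (ball x r) ^ (- (1 / (p / t))) * (ENNReal.ofReal I ^ (1 / p) * G ^ ((t - 1) / p))) ≠ ⊤ := by
    have ht1' : 0 < t - 1 := by linarith
    refine ENNReal.mul_ne_top ENNReal.ofReal_ne_top (ENNReal.mul_ne_top ?_ (ENNReal.mul_ne_top ?_ ?_))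
    · exact ENNReal.rpow_ne_top_of_ne_zero hV0 hVt
    · exact ENNReal.rpow_ne_top_of_nonneg (by positivity) ENNReal.ofReal_ne_top
    · exact ENNReal.rpow_ne_top_of_nonneg (by positivity) hGt
  have hreal := ENNReal.toReal_mono htop hfin
  rw [toReal_enorm, Real.norm_eq_abs, ENNReal.toReal_mul, ENNReal.toReal_mul, ENNReal.toReal_mul,
    ← ENNReal.toReal_rpow, ← ENNReal.toReal_rpow, ← ENNReal.toReal_rpow,
    ENNReal.toReal_ofReal (by positivity), ENNReal.toReal_ofReal hI0,
    Measure.addHaar_ball_of_pos _ _ hr0, finrank_euclideanSpace_fin, ENNReal.toReal_mul,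
    ENNReal.toReal_ofReal (by positivity), ← hω, Real.mul_rpow (by positivity) (by positivity),
    ← Real.rpow_natCast, ← Real.rpow_mul hr0.le] at hreal
  refine hreal.trans (le_of_eq ?_)
  have er : r ^ ((p - t * N) / p) = r * r ^ (N * (-(1 / (p / t)))) := by
    rw [← Real.rpow_one_add' hr0.le]
    · congr 1; field_simp; ring
    · have : 1 + N * (-(1 / (p / t))) = 1 - N / (p / t) := by ring
      rw [this]; exact hK.ne'
  rw [er]
  ring
end

section
/- Let N ≥ 1, p > N, and let t and γ satisfy 1 < t < p/N and −1 < γ < t − 1. There exists a constant C > 0 depending only on N, p, t and γ such that for every bounded open set Ω ⊆ ℝ^N with inner radius r_Ω, every nonnegative w ∈ L^1(Ω), and every C^1 function u, not identically zero, with compact support contained in Ω satisfying ∫_Ω d_Ω(x)^γ |∇u(x)|^p dx = ∫_Ω w(x)|u(x)|^p dx, one has 1 ≤ C · r_Ω^{p−N−γ} · ∫_Ω w(z) dz. -/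
open MeasureTheory Metric
open scoped ENNReal

lemma ly_scale (N : ℕ) (F : EuclideanSpace ℝ (Fin N) → ℝ≥0∞) (hF : Measurable F)
    (c : EuclideanSpace ℝ (Fin N)) (a : ℝ) (ha : 0 < a) :
    ∫⁻ z, F (c + a • z) = ENNReal.ofReal ((a ^ N)⁻¹) * ∫⁻ z, F z := by
  have h1 : ∫⁻ z, F (c + a • z) = ∫⁻ z, F (c + z) ∂(Measure.map (fun z => a • z) volume) := by
    rw [lintegral_map (by fun_prop) (by fun_prop)]
  rw [h1, Measure.map_addHaar_smul _ ha.ne', lintegral_smul_measure, lintegral_add_left_eq_self,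
    finrank_euclideanSpace_fin, abs_of_pos (by positivity), smul_eq_mul]

lemma ly_ftc (N : ℕ) (v : EuclideanSpace ℝ (Fin N) → ℝ) (hv : ContDiff ℝ 1 v)
    (x z : EuclideanSpace ℝ (Fin N)) (hx : ‖x‖ ≤ 1) (hz : ‖z‖ ≤ 1) :
    ‖v z - v x‖ₑ ≤ ∫⁻ τ in Set.Ioc (0:ℝ) 1, 2 * ‖fderiv ℝ v (x + τ • (z - x))‖ₑ := by
  have hc : Continuous (fderiv ℝ v) := hv.continuous_fderiv (by norm_num)
  have h := intervalIntegral.integral_eq_sub_of_hasDerivAt (a := 0) (b := 1)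
    (f := fun τ : ℝ => v (x + τ • (z - x)))
    (f' := fun τ : ℝ => fderiv ℝ v (x + τ • (z - x)) (z - x)) ?_ ?_
  · simp only [one_smul, zero_smul, add_zero, add_sub_cancel] at h
    rw [← h, intervalIntegral.integral_of_le zero_le_one]
    refine (enorm_integral_le_lintegral_enorm _).trans (lintegral_mono fun τ => ?_)
    refine (ContinuousLinearMap.le_opENorm _ _).trans ?_
    rw [mul_comm]
    gcongr
    rw [← ofReal_norm]
    refine le_trans (ENNReal.ofReal_le_ofReal (q := 2) ?_) (by simp)
    linarith [norm_sub_le z x]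
  · intro τ _
    have h1 : HasDerivAt (fun τ : ℝ => x + τ • (z - x)) (z - x) τ := by
      simpa using ((hasDerivAt_id τ).smul_const (z - x)).const_add x
    exact ((hv.differentiable (by norm_num)).differentiableAt.hasFDerivAt).comp_hasDerivAt τ h1
  · apply Continuous.intervalIntegrable
    fun_prop

lemma ly_holder (N : ℕ) (B : Set (EuclideanSpace ℝ (Fin N))) (q : ℝ) (hq : 1 < q)
    (H : EuclideanSpace ℝ (Fin N) → ℝ≥0∞) (hH : Measurable H) :
    ∫⁻ z in B, H z ≤ (∫⁻ z in B, H z ^ q) ^ (1 / q) * volume B ^ (1 - 1 / q) := by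
  have h := ENNReal.lintegral_mul_norm_pow_le (μ := volume.restrict B) (f := fun z => H z ^ q)
    (g := fun _ => 1) (p := 1 / q) (q := 1 - 1 / q) (by fun_prop) (by fun_prop) (by positivity)
    (by rw [sub_nonneg, div_le_one (by linarith)]; exact hq.le) (by ring)
  have e : ∀ z, (H z ^ q) ^ (1 / q) = H z := fun z => by
    rw [← ENNReal.rpow_mul, mul_one_div_cancel (by linarith), ENNReal.rpow_one]
  simpa [e, -one_div] using h

lemma ly_morrey (N : ℕ) (q : ℝ) (hq : 1 < q) (v : EuclideanSpace ℝ (Fin N) → ℝ)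
    (hv : ContDiff ℝ 1 v) (x : EuclideanSpace ℝ (Fin N)) (hx : ‖x‖ ≤ 1) :
    ∫⁻ z in ball (0 : EuclideanSpace ℝ (Fin N)) 1, ‖v z - v x‖ₑ ≤
      (2 * (∫⁻ τ in Set.Ioc (0:ℝ) 1, ENNReal.ofReal (τ ^ (-(N / q)))) *
        volume (ball (0 : EuclideanSpace ℝ (Fin N)) 1) ^ (1 - 1 / q)) *
      (∫⁻ z in ball (0 : EuclideanSpace ℝ (Fin N)) 1, ‖fderiv ℝ v z‖ₑ ^ q) ^ (1 / q) := by
  have hc : Continuous (fderiv ℝ v) := hv.continuous_fderiv (by norm_num)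
  set B := ball (0 : EuclideanSpace ℝ (Fin N)) 1 with hB
  have hBm : MeasurableSet B := measurableSet_ball
  set J := ∫⁻ z in B, ‖fderiv ℝ v z‖ₑ ^ q with hJ
  calc ∫⁻ z in B, ‖v z - v x‖ₑ
      ≤ ∫⁻ z in B, ∫⁻ τ in Set.Ioc (0:ℝ) 1, 2 * ‖fderiv ℝ v (x + τ • (z - x))‖ₑ := by
        refine setLIntegral_mono' hBm fun z hz => ?_
        exact ly_ftc N v hv x z hx (by rw [hB, mem_ball_zero_iff] at hz; exact hz.le)
    _ = ∫⁻ τ in Set.Ioc (0:ℝ) 1, ∫⁻ z in B, 2 * ‖fderiv ℝ v (x + τ • (z - x))‖ₑ := by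
        apply lintegral_lintegral_swap
        apply Measurable.aemeasurable
        apply Continuous.measurable
        have : Continuous (fun a : EuclideanSpace ℝ (Fin N) × ℝ =>
          ‖fderiv ℝ v (x + a.2 • (a.1 - x))‖ₑ) := by fun_prop
        exact ENNReal.continuous_const_mul (by simp) |>.comp this
    _ ≤ ∫⁻ τ in Set.Ioc (0:ℝ) 1, (2 * volume B ^ (1 - 1 / q) * J ^ (1 / q)) *
          ENNReal.ofReal (τ ^ (-(N / q))) := by
        refine setLIntegral_mono' measurableSet_Ioc fun τ hτ => ?_
        have hm : Measurable fun z => ‖fderiv ℝ v (x + τ • (z - x))‖ₑ := by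
          apply Continuous.measurable; fun_prop
        rw [lintegral_const_mul _ hm]
        have h1 := ly_holder N B q hq _ hm
        have h2 : ∫⁻ z in B, ‖fderiv ℝ v (x + τ • (z - x))‖ₑ ^ q ≤
            ENNReal.ofReal ((τ ^ N)⁻¹) * J := by
          rw [hJ, ← lintegral_indicator hBm, ← lintegral_indicator hBm,
            ← ly_scale N _ (by
              apply Measurable.indicator _ hBm
              apply Measurable.pow_const
              apply Continuous.measurable; fun_prop) (x - τ • x) τ hτ.1]
          refine lintegral_mono fun z => ?_
          by_cases hz : z ∈ B
          · have e : x - τ • x + τ • z = x + τ • (z - x) := by rw [smul_sub]; abel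
            have hmem : x + τ • (z - x) ∈ B := by
              rw [← e, hB, mem_ball_zero_iff]
              rw [hB, mem_ball_zero_iff] at hz
              calc ‖x - τ • x + τ • z‖ = ‖(1 - τ) • x + τ • z‖ := by rw [sub_smul, one_smul]
                _ ≤ ‖(1 - τ) • x‖ + ‖τ • z‖ := norm_add_le _ _
                _ = (1 - τ) * ‖x‖ + τ * ‖z‖ := by
                  rw [norm_smul, norm_smul, Real.norm_of_nonneg (by linarith [hτ.2]),
                    Real.norm_of_nonneg hτ.1.le]
                _ < 1 := by nlinarith [hτ.1, hτ.2]
            rw [Set.indicator_of_mem hz, e, Set.indicator_of_mem hmem]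
          · rw [Set.indicator_of_notMem hz]; exact zero_le
        have h3 : (ENNReal.ofReal ((τ ^ N)⁻¹)) ^ (1 / q) = ENNReal.ofReal (τ ^ (-(N / q))) := by
          rw [ENNReal.ofReal_rpow_of_pos (by have := hτ.1; positivity)]
          congr 1
          rw [← Real.rpow_natCast, ← Real.rpow_neg hτ.1.le, ← Real.rpow_mul hτ.1.le]
          congr 1; ring
        calc _ ≤ 2 * ((ENNReal.ofReal ((τ ^ N)⁻¹) * J) ^ (1 / q) * volume B ^ (1 - 1 / q)) := by
              gcongr
              refine h1.trans ?_
              gcongr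
          _ = _ := by
              rw [ENNReal.mul_rpow_of_nonneg _ _ (by positivity), h3]; ring
    _ = _ := by
        rw [lintegral_const_mul _ (by fun_prop)]; ring

lemma ly_radial (N : ℕ) (hN : 1 ≤ N) (s : ℝ) (hs : s < 1) :
    ∫⁻ z in ball (0 : EuclideanSpace ℝ (Fin N)) 1, ENNReal.ofReal ((1 - ‖z‖) ^ (-s)) ≠ ⊤ := by
  have : Nonempty (Fin N) := ⟨⟨0, hN⟩⟩
  have h : IntegrableOn (fun z : EuclideanSpace ℝ (Fin N) => (1 - ‖z‖) ^ (-s))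
      (ball (0 : EuclideanSpace ℝ (Fin N)) 1) volume := by
    rw [integrableOn_fun_norm_addHaar (μ := volume) (f := fun r : ℝ => (1 - r) ^ (-s)) (r := 1)]
    have h1 : IntervalIntegrable (fun r : ℝ => (1 - r) ^ (-s)) volume 0 1 := by
      have h0 : IntervalIntegrable (fun r : ℝ => r ^ (-s)) volume 0 1 :=
        intervalIntegral.intervalIntegrable_rpow' (by linarith)
      simpa using (h0.comp_sub_left 1).symm
    have h2 : IntervalIntegrable (fun r : ℝ => (1 - r) ^ (-s) * 
        r ^ (Module.finrank ℝ (EuclideanSpace ℝ (Fin N)) - 1)) volume 0 1 := 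
      h1.mul_continuousOn (by fun_prop)
    rw [intervalIntegrable_iff_integrableOn_Ioo_of_le zero_le_one] at h2
    refine h2.congr_fun (fun r _ => ?_) measurableSet_Ioo
    simp [mul_comm]
  have h' := h.lintegral_lt_top
  exact h'.ne

lemma ly_unit (N : ℕ) (hN : 1 ≤ N) (p t γ : ℝ)
    (ht1 : 1 < t) (ht2 : t < p / N) (hγ1 : 0 ≤ γ) (hγ2 : γ < t - 1) :
    ∃ K : ℝ≥0∞, K ≠ ⊤ ∧ ∀ v : EuclideanSpace ℝ (Fin N) → ℝ, ContDiff ℝ 1 v →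
      ∀ e : EuclideanSpace ℝ (Fin N), ‖e‖ ≤ 1 →
      ‖v e - v 0‖ₑ ^ p ≤ K * ∫⁻ z in ball (0 : EuclideanSpace ℝ (Fin N)) 1,
        ENNReal.ofReal ((1 - ‖z‖) ^ γ) * ‖fderiv ℝ v z‖ₑ ^ p := by
  set B := ball (0 : EuclideanSpace ℝ (Fin N)) 1 with hB
  have hBm : MeasurableSet B := measurableSet_ball
  have hB0 : volume B ≠ 0 := (measure_ball_pos volume _ one_pos).ne'
  have hBt : volume B ≠ ⊤ := measure_ball_lt_top.ne
  have hN' : (1:ℝ) ≤ N := by exact_mod_cast hN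
  have hNt : N * t < p := by rw [lt_div_iff₀ (by linarith)] at ht2; linarith
  have hp : 0 < p := by nlinarith
  set q := p / t with hq
  have hNq : N < q := by rw [hq, lt_div_iff₀ (by linarith)]; exact hNt
  have hq1 : 1 < q := by linarith
  set T := ∫⁻ τ in Set.Ioc (0:ℝ) 1, ENNReal.ofReal (τ ^ (-(N / q))) with hT
  have hTt : T ≠ ⊤ := by
    have h0 : IntervalIntegrable (fun r : ℝ => r ^ (-(N / q))) volume 0 1 :=
      intervalIntegral.intervalIntegrable_rpow' (by
        rw [neg_lt_neg_iff, div_lt_one (by linarith)]; exact hNq)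
    rw [intervalIntegrable_iff_integrableOn_Ioc_of_le zero_le_one] at h0
    exact h0.lintegral_lt_top.ne
  set s := γ / (t - 1) with hs
  have hs1 : s < 1 := by rw [hs, div_lt_one (by linarith)]; exact hγ2
  set A := ∫⁻ z in B, ENNReal.ofReal ((1 - ‖z‖) ^ (-s)) with hA
  have hAt : A ≠ ⊤ := ly_radial N hN s hs1
  set M1 := 2 * T * volume B ^ (1 - 1 / q) with hM1
  have hq2 : 0 ≤ 1 - 1 / q := by
    rw [sub_nonneg, div_le_one (by linarith)]; exact hq1.le
  have hM1t : M1 ≠ ⊤ := ENNReal.mul_ne_top (ENNReal.mul_ne_top (by simp) hTt)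
    (ENNReal.rpow_ne_top_of_nonneg hq2 hBt)
  set K0 := (volume B)⁻¹ * (2 * M1) with hK0
  have hK0t : K0 ≠ ⊤ := ENNReal.mul_ne_top (ENNReal.inv_ne_top.2 hB0)
    (ENNReal.mul_ne_top (by simp) hM1t)
  refine ⟨K0 ^ p * A ^ (t - 1), ENNReal.mul_ne_top (ENNReal.rpow_ne_top_of_nonneg hp.le hK0t)
    (ENNReal.rpow_ne_top_of_nonneg (by linarith) hAt), fun v hv e he => ?_⟩
  have hc : Continuous (fderiv ℝ v) := hv.continuous_fderiv (by norm_num)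
  set I := ∫⁻ z in B, ENNReal.ofReal ((1 - ‖z‖) ^ γ) * ‖fderiv ℝ v z‖ₑ ^ p with hI
  set J := ∫⁻ z in B, ‖fderiv ℝ v z‖ₑ ^ q with hJ
  have hmg : Measurable fun z => ‖fderiv ℝ v z‖ₑ := by
    apply Continuous.measurable; fun_prop
  have h1 := ly_morrey N q hq1 v hv e he
  have h0 := ly_morrey N q hq1 v hv 0 (by simp)
  rw [← hB, ← hT, ← hM1, ← hJ] at h1 h0
  have hcv : Continuous v := hv.continuous
  have h2 : volume B * ‖v e - v 0‖ₑ ≤ 2 * M1 * J ^ (1 / q) := by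
    calc volume B * ‖v e - v 0‖ₑ = ∫⁻ z in B, ‖v e - v 0‖ₑ := by simp [mul_comm]
      _ ≤ ∫⁻ z in B, (‖v z - v e‖ₑ + ‖v z - v 0‖ₑ) := by
        refine lintegral_mono fun z => ?_
        have : v e - v 0 = -(v z - v e) + (v z - v 0) := by ring
        rw [this]
        refine (enorm_add_le _ _).trans ?_
        rw [enorm_neg]
      _ = (∫⁻ z in B, ‖v z - v e‖ₑ) + ∫⁻ z in B, ‖v z - v 0‖ₑ := by
        apply lintegral_add_left
        apply Continuous.measurable; fun_prop
      _ ≤ M1 * J ^ (1 / q) + M1 * J ^ (1 / q) := add_le_add h1 h0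
      _ = _ := by ring
  have h3 : ‖v e - v 0‖ₑ ≤ K0 * J ^ (1 / q) := by
    calc ‖v e - v 0‖ₑ = (volume B)⁻¹ * (volume B * ‖v e - v 0‖ₑ) := by
          rw [← mul_assoc, ENNReal.inv_mul_cancel hB0 hBt, one_mul]
      _ ≤ (volume B)⁻¹ * (2 * M1 * J ^ (1 / q)) := by gcongr
      _ = _ := by rw [hK0]; ring
  have ht0 : t ≠ 0 := by linarith
  have h4 : J ≤ I ^ (1 / t) * A ^ (1 - 1 / t) := by
    have h := ENNReal.lintegral_mul_norm_pow_le (μ := volume.restrict B)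
      (f := fun z => ENNReal.ofReal ((1 - ‖z‖) ^ γ) * ‖fderiv ℝ v z‖ₑ ^ p)
      (g := fun z => ENNReal.ofReal ((1 - ‖z‖) ^ (-s))) (p := 1 / t) (q := 1 - 1 / t)
      (by fun_prop) (by fun_prop) (by positivity)
      (by rw [sub_nonneg, div_le_one (by linarith)]; exact ht1.le) (by ring)
    refine le_trans (le_of_eq ?_) h
    refine setLIntegral_congr_fun hBm fun z hz => ?_
    have hz1 : 0 < 1 - ‖z‖ := by rw [hB, mem_ball_zero_iff] at hz; linarith
    rw [ENNReal.mul_rpow_of_nonneg _ _ (by positivity), ← ENNReal.rpow_mul,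
      ENNReal.ofReal_rpow_of_pos (by positivity), ENNReal.ofReal_rpow_of_pos (by positivity),
      ← Real.rpow_mul hz1.le, ← Real.rpow_mul hz1.le, mul_right_comm,
      ← ENNReal.ofReal_mul (by positivity), ← Real.rpow_add hz1]
    have e1 : γ * (1 / t) + -s * (1 - 1 / t) = 0 := by
      have : t - 1 ≠ 0 := by linarith
      rw [hs]; field_simp; ring
    rw [e1, Real.rpow_zero, ENNReal.ofReal_one, one_mul, hq, mul_one_div]
  calc ‖v e - v 0‖ₑ ^ p ≤ (K0 * (I ^ (1 / t) * A ^ (1 - 1 / t)) ^ (1 / q)) ^ p := by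
        gcongr
        refine h3.trans ?_
        gcongr
    _ = K0 ^ p * A ^ (t - 1) * I := by
        have e2 : 1 / q * p = t := by rw [hq]; field_simp
        have e3 : (1 - 1 / t) * t = t - 1 := by field_simp
        clear_value K0
        rw [ENNReal.mul_rpow_of_nonneg _ _ hp.le, ← ENNReal.rpow_mul, e2,
          ENNReal.mul_rpow_of_nonneg _ _ (by linarith), ← ENNReal.rpow_mul, ← ENNReal.rpow_mul, e3,
          one_div_mul_cancel ht0, ENNReal.rpow_one]
        ring

lemma ly_weight (γ δ a d : ℝ) (hδ : 0 < δ) (ha : 0 < a) (h1 : a * δ ≤ d) (h2 : d ≤ 2 * a) :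
    δ ^ (max γ 0) ≤ 2 ^ |γ| * a ^ (-γ) * d ^ γ := by
  have hd : 0 < d := lt_of_lt_of_le (by positivity) h1
  rcases le_total 0 γ with h | h
  · rw [max_eq_left h, abs_of_nonneg h]
    have e : δ ^ γ = a ^ (-γ) * (a * δ) ^ γ := by
      rw [Real.mul_rpow ha.le hδ.le, ← mul_assoc, ← Real.rpow_add ha]; simp
    calc δ ^ γ = 1 * a ^ (-γ) * (a * δ) ^ γ := by rw [e, one_mul]
      _ ≤ 2 ^ γ * a ^ (-γ) * d ^ γ := by
        gcongr
        exact Real.one_le_rpow (by norm_num) h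
  · rw [max_eq_right h, abs_of_nonpos h, Real.rpow_zero]
    have e : (1:ℝ) = 2 ^ (-γ) * a ^ (-γ) * (2 * a) ^ γ := by
      rw [← Real.mul_rpow (by norm_num) ha.le, ← Real.rpow_add (by positivity)]; simp
    rw [e]
    gcongr 2 ^ (-γ) * a ^ (-γ) * ?_
    exact Real.rpow_le_rpow_of_nonpos hd h2 h

set_option maxHeartbeats 1000000 in
/-- Lyapunov inequality for the quasilinear operator with coefficient a power `γ` of the
distance to the boundary, case `p > N`, `1 < t < p/N`, `-1 < γ < t - 1`:
`1 ≤ C · rΩ^(p - N - γ) · ∫_Ω w`. -/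
theorem lyapunov_inequality_distance_weight (N : ℕ) (hN : 1 ≤ N) (p t γ : ℝ)
    (hp : (N : ℝ) < p) (ht1 : 1 < t) (ht2 : t < p / N)
    (hγ1 : -1 < γ) (hγ2 : γ < t - 1) :
    ∃ C : ℝ, 0 < C ∧
      ∀ (Ω : Set (EuclideanSpace ℝ (Fin N))) (rΩ : ℝ)
        (w u : EuclideanSpace ℝ (Fin N) → ℝ),
        IsOpen Ω →
        Bornology.IsBounded Ω →
        -- `rΩ` is the inner radius of `Ω`
        IsLUB ((fun x => infDist x Ωᶜ) '' Ω) rΩ →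
        (∀ x ∈ Ω, 0 ≤ w x) →
        IntegrableOn w Ω →
        ContDiff ℝ 1 u →
        HasCompactSupport u →
        tsupport u ⊆ Ω →
        u ≠ 0 →
        (∫ x in Ω, infDist x Ωᶜ ^ γ * ‖fderiv ℝ u x‖ ^ p) =
          (∫ x in Ω, w x * |u x| ^ p) →
        1 ≤ C * rΩ ^ (p - N - γ) * ∫ x in Ω, w x := by
  obtain ⟨K, hKt, hK⟩ := ly_unit N hN p t (max γ 0) ht1 ht2 (le_max_right _ _)
    (max_lt hγ2 (by linarith))
  have hN' : (1:ℝ) ≤ N := by exact_mod_cast hN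
  have hp0 : 0 < p := by linarith
  have hNt : N * t < p := by rw [lt_div_iff₀ (by linarith)] at ht2; linarith
  have hexp : 0 ≤ p - N - γ := by nlinarith
  refine ⟨K.toReal * 2 ^ |γ| + 1, by positivity, ?_⟩
  intro Ω rΩ w u hΩ hbd hr hw hwi hu hcs hsupp hne heq
  have hcf : Continuous (fderiv ℝ u) := hu.continuous_fderiv (by norm_num)
  have hne' : Nonempty (Fin N) := ⟨⟨0, hN⟩⟩
  have hΩc : Ωᶜ.Nonempty := by
    rw [Set.nonempty_compl]
    rintro rfl
    exact NormedSpace.unbounded_univ ℝ (EuclideanSpace ℝ (Fin N)) hbd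
  obtain ⟨x0, hx0⟩ := hu.continuous.norm.exists_forall_ge_of_hasCompactSupport hcs.norm
  have hM : 0 < ‖u x0‖ := by
    obtain ⟨x1, hx1⟩ := Function.ne_iff.1 hne
    exact lt_of_lt_of_le (norm_pos_iff.2 hx1) (hx0 x1)
  have hx0Ω : x0 ∈ Ω := hsupp (subset_tsupport u (by simpa using hM))
  obtain ⟨y, hyΩ, hy⟩ := hΩ.isClosed_compl.exists_infDist_eq_dist hΩc x0
  have hdpos : ∀ x ∈ Ω, 0 < infDist x Ωᶜ := fun x hx =>
    (hΩ.isClosed_compl.notMem_iff_infDist_pos hΩc).1 (by simpa using hx)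
  set a := infDist x0 Ωᶜ with ha'
  have ha : 0 < a := hdpos x0 hx0Ω
  have har : a ≤ rΩ := hr.1 ⟨x0, hx0Ω, rfl⟩
  have huy : u y = 0 := image_eq_zero_of_notMem_tsupport fun h => hyΩ (hsupp h)
  set f : EuclideanSpace ℝ (Fin N) → ℝ := fun x => infDist x Ωᶜ ^ γ * ‖fderiv ℝ u x‖ ^ p with hf
  have hf0 : ∀ x, 0 ≤ f x := fun x => mul_nonneg (Real.rpow_nonneg infDist_nonneg _) (by positivity)
  have hfm : Measurable f := by
    have h1 : Measurable fun x : EuclideanSpace ℝ (Fin N) => infDist x Ωᶜ :=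
      (continuous_infDist_pt _).measurable
    have h2 : Measurable fun x => ‖fderiv ℝ u x‖ := hcf.norm.measurable
    exact (h1.pow_const _).mul (h2.pow_const _)
  have hfi : Integrable f := by
    have hs : Function.support f ⊆ tsupport u := by
      intro x hx
      by_contra hxn
      apply hx
      have : fderiv ℝ u x = 0 := by
        by_contra h
        exact hxn (support_fderiv_subset ℝ h)
      simp [hf, this, Real.zero_rpow hp0.ne']
    rw [← integrableOn_iff_integrable_of_support_subset hs]
    apply ContinuousOn.integrableOn_compact hcs
    apply ContinuousOn.mul
    · exact (continuous_infDist_pt _).continuousOn.rpow_const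
        fun x hx => Or.inl (hdpos x (hsupp hx)).ne'
    · exact (hcf.norm.rpow_const fun x => Or.inr hp0.le).continuousOn
  set I := ∫ x in Ω, f x with hI
  -- the rescaled function on the unit ball
  set v : EuclideanSpace ℝ (Fin N) → ℝ := fun z => u (x0 + a • z) with hv
  have hvd : ContDiff ℝ 1 v := by
    apply hu.comp; fun_prop
  have hfd : ∀ z, fderiv ℝ v z = a • fderiv ℝ u (x0 + a • z) := by
    intro z
    have h1 : HasFDerivAt (fun z : EuclideanSpace ℝ (Fin N) => x0 + a • z)
        (a • ContinuousLinearMap.id ℝ (EuclideanSpace ℝ (Fin N))) z :=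
      ((hasFDerivAt_id z).const_smul a).const_add x0
    have h2 := ((hu.differentiable (by norm_num)) (x0 + a • z)).hasFDerivAt.comp z h1
    rw [show v = u ∘ (fun z => x0 + a • z) from rfl, h2.fderiv]
    ext; simp
  set e := a⁻¹ • (y - x0) with he
  have hen : ‖e‖ ≤ 1 := by
    rw [he, norm_smul, norm_inv, Real.norm_of_nonneg ha.le, hy, dist_comm, dist_eq_norm]
    exact inv_mul_le_one
  have hve : v e = 0 := by
    simp only [hv, he, smul_smul, mul_inv_cancel₀ ha.ne', one_smul, add_sub_cancel, huy]
  have hv0 : v 0 = u x0 := by simp [hv]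
  have hmain := hK v hvd e hen
  rw [hve, hv0, zero_sub, enorm_neg] at hmain
  set c := 2 ^ |γ| * a ^ (-γ) * a ^ p with hc
  have hc0 : 0 ≤ c := by positivity
  have hint : ∫⁻ z in ball (0 : EuclideanSpace ℝ (Fin N)) 1,
      ENNReal.ofReal ((1 - ‖z‖) ^ (max γ 0)) * ‖fderiv ℝ v z‖ₑ ^ p ≤
      ENNReal.ofReal ((a ^ N)⁻¹) * ENNReal.ofReal (c * I) := by
    rw [hI, ← integral_const_mul, ofReal_integral_eq_lintegral_ofReal
      (hfi.integrableOn.const_mul c) (Filter.Eventually.of_forall fun x => mul_nonneg hc0 (hf0 x)),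
      ← lintegral_indicator hΩ.measurableSet, ← lintegral_indicator measurableSet_ball,
      ← ly_scale N _ (by
        apply Measurable.indicator _ hΩ.measurableSet
        exact (hfm.const_mul c).ennreal_ofReal) x0 a ha]
    refine lintegral_mono fun z => ?_
    by_cases hz : z ∈ ball (0 : EuclideanSpace ℝ (Fin N)) 1
    · have hz1 : ‖z‖ < 1 := by simpa using hz
      have hdist : dist x0 (x0 + a • z) = a * ‖z‖ := by
        simp [norm_smul, abs_of_pos ha]
      have hd1 : a * (1 - ‖z‖) ≤ infDist (x0 + a • z) Ωᶜ := by
        have := infDist_le_infDist_add_dist (s := Ωᶜ) (x := x0) (y := x0 + a • z)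
        rw [hdist, ← ha'] at this
        linarith
      have hd2 : infDist (x0 + a • z) Ωᶜ ≤ 2 * a := by
        have := infDist_le_infDist_add_dist (s := Ωᶜ) (x := x0 + a • z) (y := x0)
        rw [dist_comm, hdist, ← ha'] at this
        nlinarith
      have hxΩ : x0 + a • z ∈ Ω := by
        by_contra hn
        have h0 : infDist (x0 + a • z) Ωᶜ = 0 := infDist_zero_of_mem hn
        rw [h0] at hd1
        nlinarith
      rw [Set.indicator_of_mem hz, Set.indicator_of_mem hxΩ, hfd, ← ofReal_norm,
        ENNReal.ofReal_rpow_of_nonneg (norm_nonneg _) hp0.le,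
        ← ENNReal.ofReal_mul (Real.rpow_nonneg (by linarith) _)]
      apply ENNReal.ofReal_le_ofReal
      have hwt := ly_weight γ (1 - ‖z‖) a _ (by linarith) ha hd1 hd2
      rw [norm_smul, Real.norm_of_nonneg ha.le, Real.mul_rpow ha.le (norm_nonneg _)]
      calc _ ≤ (2 ^ |γ| * a ^ (-γ) * infDist (x0 + a • z) Ωᶜ ^ γ) *
            (a ^ p * ‖fderiv ℝ u (x0 + a • z)‖ ^ p) := by gcongr
        _ = _ := by simp only [hc, hf]; ring
    · rw [Set.indicator_of_notMem hz]; exact zero_le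
  have hI0 : 0 ≤ I := integral_nonneg hf0
  clear_value I c
  have hkey : ‖u x0‖ ^ p ≤ K.toReal * 2 ^ |γ| * a ^ (p - N - γ) * I := by
    have h1 := hmain.trans (mul_le_mul_right hint K)
    have hn1 : 0 ≤ (a ^ N)⁻¹ := inv_nonneg.2 (pow_nonneg ha.le N)
    have hn2 : 0 ≤ K.toReal * ((a ^ N)⁻¹ * (c * I)) :=
      mul_nonneg ENNReal.toReal_nonneg (mul_nonneg hn1 (mul_nonneg hc0 hI0))
    rw [← ENNReal.ofReal_toReal hKt, ← ofReal_norm,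
      ENNReal.ofReal_rpow_of_nonneg (norm_nonneg _) hp0.le,
      ← ENNReal.ofReal_mul hn1, ← ENNReal.ofReal_mul ENNReal.toReal_nonneg,
      ENNReal.ofReal_le_ofReal_iff hn2] at h1
    refine h1.trans (le_of_eq ?_)
    have : a ^ (p - N - γ) = a ^ p * (a ^ N)⁻¹ * a ^ (-γ) := by
      rw [← Real.rpow_natCast, ← Real.rpow_neg ha.le, ← Real.rpow_add ha, ← Real.rpow_add ha]
      congr 1
    rw [this, hc]; ring
  have hW0 : 0 ≤ ∫ x in Ω, w x := setIntegral_nonneg hΩ.measurableSet hw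
  have hIw : I ≤ ‖u x0‖ ^ p * ∫ x in Ω, w x := by
    rw [heq, ← integral_const_mul]
    refine integral_mono_of_nonneg ?_ (hwi.const_mul _) ?_
    · filter_upwards [ae_restrict_mem hΩ.measurableSet] with x hx
      exact mul_nonneg (hw x hx) (by positivity)
    · filter_upwards [ae_restrict_mem hΩ.measurableSet] with x hx
      have := hw x hx
      have h2 : |u x| ^ p ≤ ‖u x0‖ ^ p := Real.rpow_le_rpow (abs_nonneg _) (hx0 x) hp0.le
      show w x * |u x| ^ p ≤ ‖u x0‖ ^ p * w x
      rw [mul_comm]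
      gcongr
  have hMp : 0 < ‖u x0‖ ^ p := by positivity
  have hpow : a ^ (p - N - γ) ≤ rΩ ^ (p - N - γ) := Real.rpow_le_rpow ha.le har hexp
  have hfin : ‖u x0‖ ^ p * 1 ≤
      ‖u x0‖ ^ p * ((K.toReal * 2 ^ |γ| + 1) * rΩ ^ (p - N - γ) * ∫ x in Ω, w x) := by
    calc ‖u x0‖ ^ p * 1 ≤ K.toReal * 2 ^ |γ| * a ^ (p - N - γ) * I := by rw [mul_one]; exact hkey
      _ ≤ (K.toReal * 2 ^ |γ| + 1) * rΩ ^ (p - N - γ) * (‖u x0‖ ^ p * ∫ x in Ω, w x) := by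
        have hr0 : 0 ≤ rΩ ^ (p - N - γ) := Real.rpow_nonneg (ha.le.trans har) _
        gcongr
        linarith
      _ = _ := by ring
  exact le_of_mul_le_mul_left hfin hMp
end

section
/- Let 1 < p < N and s > N/p. Let Ω ⊂ ℝ^N be a bounded open set with inner radius r_Ω that satisfies the p-Hardy inequality with constant C_h. Then there exists a constant C > 0, depending only on p, N, s and C_h, such that for every nonnegative w ∈ L^s(Ω) and every C^1 function u, not identically zero, with compact support contained in Ω satisfying the energy identity ∫_Ω |∇u|^p dx = ∫_Ω w(x)|u(x)|^p dx, one has C / r_Ω^{(sp−N)/s} ≤ ‖w‖_{L^s(Ω)}. -/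
open MeasureTheory Metric

lemma holder_three {α : Type*} [MeasurableSpace α] {μ : Measure α} {f g h : α → ℝ}
    (hf : Integrable f μ) (hg : Integrable g μ) (hh : Integrable h μ)
    (f0 : 0 ≤ᵐ[μ] f) (g0 : 0 ≤ᵐ[μ] g) (h0 : 0 ≤ᵐ[μ] h)
    {a b c : ℝ} (ha : 0 ≤ a) (hb : 0 ≤ b) (hc : 0 ≤ c) (habc : a + b + c = 1) :
    Integrable (fun x => f x ^ a * g x ^ b * h x ^ c) μ ∧
    ∫ x, f x ^ a * g x ^ b * h x ^ c ∂μ ≤ (∫ x, f x ∂μ) ^ a * (∫ x, g x ∂μ) ^ b *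
      (∫ x, h x ∂μ) ^ c := by
  have If := integral_nonneg_of_ae f0
  have Ig := integral_nonneg_of_ae g0
  have Ih := integral_nonneg_of_ae h0
  have key := ENNReal.lintegral_prod_norm_pow_le (μ := μ) (Finset.univ : Finset (Fin 3))
    (f := ![fun x => ENNReal.ofReal (f x), fun x => ENNReal.ofReal (g x),
      fun x => ENNReal.ofReal (h x)]) (p := ![a, b, c])
    (by
      intro i _
      fin_cases i
      · exact hf.1.aemeasurable.ennreal_ofReal
      · exact hg.1.aemeasurable.ennreal_ofReal
      · exact hh.1.aemeasurable.ennreal_ofReal)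
    (by simpa [Fin.sum_univ_three] using habc)
    (by
      intro i _
      fin_cases i
      · exact ha
      · exact hb
      · exact hc)
  simp only [Fin.prod_univ_three, Matrix.cons_val_zero, Matrix.cons_val_one, Matrix.cons_val] at key
  rw [← ofReal_integral_eq_lintegral_ofReal hf f0, ← ofReal_integral_eq_lintegral_ofReal hg g0,
    ← ofReal_integral_eq_lintegral_ofReal hh h0, ENNReal.ofReal_rpow_of_nonneg If ha,
    ENNReal.ofReal_rpow_of_nonneg Ig hb, ENNReal.ofReal_rpow_of_nonneg Ih hc,
    ← ENNReal.ofReal_mul (by positivity), ← ENNReal.ofReal_mul (by positivity)] at key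
  have e : ∫⁻ x, ENNReal.ofReal (f x) ^ a * ENNReal.ofReal (g x) ^ b * ENNReal.ofReal (h x) ^ c ∂μ
      = ∫⁻ x, ENNReal.ofReal (f x ^ a * g x ^ b * h x ^ c) ∂μ := by
    apply lintegral_congr_ae
    filter_upwards [f0, g0, h0] with x h1 h2 h3
    simp only [Pi.zero_apply] at h1 h2 h3
    rw [ENNReal.ofReal_rpow_of_nonneg h1 ha,
      ENNReal.ofReal_rpow_of_nonneg h2 hb, ENNReal.ofReal_rpow_of_nonneg h3 hc,
      ← ENNReal.ofReal_mul (by positivity), ← ENNReal.ofReal_mul (by positivity)]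
  rw [e] at key
  have nn : 0 ≤ᵐ[μ] (fun x => f x ^ a * g x ^ b * h x ^ c) := by
    filter_upwards [f0, g0, h0] with x h1 h2 h3
    simp only [Pi.zero_apply] at h1 h2 h3 ⊢
    positivity
  have int : Integrable (fun x => f x ^ a * g x ^ b * h x ^ c) μ := by
    refine ⟨(((hf.1.aemeasurable.pow_const a).mul (hg.1.aemeasurable.pow_const b)).mul
      (hh.1.aemeasurable.pow_const c)).aestronglyMeasurable, ?_⟩
    rw [hasFiniteIntegral_iff_ofReal nn]
    exact key.trans_lt ENNReal.ofReal_lt_top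
  refine ⟨int, ?_⟩
  rw [← ofReal_integral_eq_lintegral_ofReal int nn] at key
  exact (ENNReal.ofReal_le_ofReal_iff (by positivity)).1 key

lemma sobolev_real (N : ℕ) (hN : 1 ≤ N) (p q : ℝ) (hp1 : 1 < p) (hq0 : 0 < q)
    (hq : q⁻¹ = p⁻¹ - (N : ℝ)⁻¹) :
    ∃ S : ℝ, 0 < S ∧ ∀ u : EuclideanSpace ℝ (Fin N) → ℝ, ContDiff ℝ 1 u → HasCompactSupport u →
      (∫ x, |u x| ^ q) ^ q⁻¹ ≤ S * (∫ x, ‖fderiv ℝ u x‖ ^ p) ^ p⁻¹ := by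
  have hp0 : 0 < p := by linarith
  lift p to NNReal using hp0.le
  lift q to NNReal using hq0.le
  set K := SNormLESNormFDerivOfEqConst ℝ (volume : Measure (EuclideanSpace ℝ (Fin N))) p with hK
  refine ⟨(K : ℝ) + 1, by positivity, fun u hu hc => ?_⟩
  have key := eLpNorm_le_eLpNorm_fderiv_of_eq (volume : Measure (EuclideanSpace ℝ (Fin N)))
    hu hc (p := p) (p' := q) (by exact_mod_cast hp1.le)
    (by rw [finrank_euclideanSpace_fin]; exact hN)
    (by rw [finrank_euclideanSpace_fin, hq, NNReal.coe_inv])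
  have m1 : MemLp u (q : ENNReal) volume :=
    hu.continuous.memLp_of_hasCompactSupport hc
  have m2 : MemLp (fderiv ℝ u) (p : ENNReal) volume :=
    (hu.continuous_fderiv one_ne_zero).memLp_of_hasCompactSupport (hc.fderiv ℝ)
  have hq1 : (q : ENNReal) ≠ 0 := by
    rw [ENNReal.coe_ne_zero, ← NNReal.coe_ne_zero]; exact hq0.ne'
  have hp2 : (p : ENNReal) ≠ 0 := by
    rw [ENNReal.coe_ne_zero, ← NNReal.coe_ne_zero]; exact hp0.ne'
  rw [m1.eLpNorm_eq_integral_rpow_norm hq1 ENNReal.coe_ne_top,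
    m2.eLpNorm_eq_integral_rpow_norm hp2 ENNReal.coe_ne_top, ← hK,
    ← ENNReal.ofReal_coe_nnreal (p := K), ← ENNReal.ofReal_mul (by positivity),
    ENNReal.ofReal_le_ofReal_iff (by positivity)] at key
  simp only [ENNReal.coe_toReal, Real.norm_eq_abs] at key
  refine key.trans ?_
  have : 0 ≤ (∫ x, ‖fderiv ℝ u x‖ ^ (p : ℝ)) ^ (p : ℝ)⁻¹ := by positivity
  nlinarith

theorem lyapunov_inequality_p_lt_N (N : ℕ) (hN : 1 ≤ N) (p s Ch : ℝ)
    (hp1 : 1 < p) (hpN : p < N) (hs : (N : ℝ) / p < s) :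
    ∃ C : ℝ, 0 < C ∧
      ∀ (Ω : Set (EuclideanSpace ℝ (Fin N))) (rΩ : ℝ)
        (w u : EuclideanSpace ℝ (Fin N) → ℝ),
        IsOpen Ω →
        Bornology.IsBounded Ω →
        -- `rΩ` is the inner radius of `Ω`
        IsLUB ((fun x => infDist x Ωᶜ) '' Ω) rΩ →
        -- `Ω` satisfies the `p`-Hardy inequality with constant `Ch`
        (∀ φ : EuclideanSpace ℝ (Fin N) → ℝ,
          ContDiff ℝ 1 φ → HasCompactSupport φ → tsupport φ ⊆ Ω →
            (∫ x in Ω, |φ x| ^ p / infDist x Ωᶜ ^ p) ≤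
              Ch * ∫ x in Ω, ‖fderiv ℝ φ x‖ ^ p) →
        -- `w ≥ 0` belongs to `L^s(Ω)`
        (∀ x ∈ Ω, 0 ≤ w x) →
        IntegrableOn (fun x => w x ^ s) Ω →
        -- `u` is a nontrivial solution, tested against itself
        ContDiff ℝ 1 u →
        HasCompactSupport u →
        tsupport u ⊆ Ω →
        u ≠ 0 →
        (∫ x in Ω, ‖fderiv ℝ u x‖ ^ p) = (∫ x in Ω, w x * |u x| ^ p) →
        C / rΩ ^ ((s * p - N) / s) ≤ (∫ x in Ω, w x ^ s) ^ (1 / s) := by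
  have hp0 : 0 < p := by linarith
  have hN0 : (0 : ℝ) < N := by linarith
  have hs0 : 0 < s := lt_trans (by positivity) hs
  have hsp : (N : ℝ) < s * p := (div_lt_iff₀ hp0).1 hs
  have hNp : 0 < (N : ℝ) - p := by linarith
  obtain ⟨q, hqdef⟩ : ∃ q : ℝ, q = N * p / (N - p) := ⟨_, rfl⟩
  have hq0 : 0 < q := by rw [hqdef]; positivity
  have hq : q⁻¹ = p⁻¹ - (N : ℝ)⁻¹ := by
    rw [hqdef]; field_simp
  obtain ⟨a, hadef⟩ : ∃ a : ℝ, a = 1 - N / (s * p) := ⟨_, rfl⟩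
  obtain ⟨b, hbdef⟩ : ∃ b : ℝ, b = (N - p) / (s * p) := ⟨_, rfl⟩
  have ha : 0 < a := by
    rw [hadef, sub_pos, div_lt_one (by positivity)]; exact hsp
  have hb : 0 < b := by rw [hbdef]; positivity
  have hab : 1 / s + a + b = 1 := by rw [hadef, hbdef]; field_simp; ring
  have hqb : q * b = N / s := by rw [hqdef, hbdef]; field_simp
  have hpa : p * a = (s * p - N) / s := by rw [hadef]; field_simp
  have hpq : p * a + q * b = p := by rw [hqb, hpa]; field_simp; ring
  obtain ⟨S, hS, sob⟩ := sobolev_real N hN p q hp1 hq0 hq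
  obtain ⟨M, hMdef⟩ : ∃ M : ℝ, M = max Ch 1 := ⟨_, rfl⟩
  have hM : 0 < M := by rw [hMdef]; positivity
  have hChM : Ch ≤ M := by rw [hMdef]; exact le_max_left _ _
  refine ⟨(M ^ a * S ^ (q * b))⁻¹, by positivity, ?_⟩
  intro Ω r w u hΩ hbd hr hardy hw hwi hu hc hsupp hu0 hen
  have : Nonempty (Fin N) := ⟨⟨0, hN⟩⟩
  have hne : (Ωᶜ).Nonempty := by
    rw [Set.nonempty_compl]
    rintro rfl
    exact NormedSpace.unbounded_univ ℝ (EuclideanSpace ℝ (Fin N)) hbd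
  have hd : ∀ x ∈ Ω, 0 < infDist x Ωᶜ := fun x hx =>
    (hΩ.isClosed_compl.notMem_iff_infDist_pos hne).1 (by simpa using hx)
  have hdr : ∀ x ∈ Ω, infDist x Ωᶜ ≤ r := fun x hx => hr.1 ⟨x, hx, rfl⟩
  obtain ⟨x₀, hx₀⟩ : ∃ x, u x ≠ 0 := by
    by_contra! h
    exact hu0 (funext h)
  have hx₀Ω : x₀ ∈ Ω := hsupp (subset_tsupport u hx₀)
  have hr0 : 0 < r := (hd _ hx₀Ω).trans_le (hdr _ hx₀Ω)
  have hout : ∀ x, x ∉ Ω → u x = 0 := fun x hx =>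
    image_eq_zero_of_notMem_tsupport (fun h => hx (hsupp h))
  have hout' : ∀ x, x ∉ Ω → fderiv ℝ u x = 0 := fun x hx =>
    image_eq_zero_of_notMem_tsupport (fun h => hx (hsupp (tsupport_fderiv_subset ℝ h)))
  -- integrals over Ω and over the whole space
  have eG : ∫ x in Ω, ‖fderiv ℝ u x‖ ^ p = ∫ x, ‖fderiv ℝ u x‖ ^ p :=
    setIntegral_eq_integral_of_forall_compl_eq_zero (fun x hx => by
      simp [hout' x hx, hp0.ne'])
  have eP : ∫ x in Ω, |u x| ^ q = ∫ x, |u x| ^ q :=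
    setIntegral_eq_integral_of_forall_compl_eq_zero (fun x hx => by
      simp [hout x hx, hq0.ne'])
  have cq : Continuous (fun x => |u x| ^ q) :=
    hu.continuous.abs.rpow_const (fun _ => Or.inr hq0.le)
  have sq : HasCompactSupport (fun x => |u x| ^ q) :=
    hc.comp_left (g := fun t : ℝ => |t| ^ q) (by simp [hq0.ne'])
  have iq : Integrable (fun x => |u x| ^ q) := cq.integrable_of_hasCompactSupport sq
  have hP : 0 < ∫ x, |u x| ^ q :=
    cq.integral_pos_of_hasCompactSupport_nonneg_nonzero sq (fun x => by positivity)
      (x := x₀) (by positivity)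
  have hsob := sob u hu hc
  have ih : Integrable (fun x => |u x| ^ p / infDist x Ωᶜ ^ p) := by
    have hsub : Function.support (fun x => |u x| ^ p / infDist x Ωᶜ ^ p) ⊆ Function.support u := by
      intro x hx h
      exact hx (by simp [h, hp0.ne'])
    refine Continuous.integrable_of_hasCompactSupport ?_ (hc.mono hsub)
    refine continuous_of_tsupport fun x hx => ?_
    have hxΩ := hd x (hsupp (closure_mono hsub hx))
    refine ContinuousAt.div ?_ ?_ (by positivity)
    · exact (hu.continuous.abs.rpow_const (fun _ => Or.inr hp0.le)).continuousAt
    · exact ((continuous_infDist_pt _).rpow_const (fun _ => Or.inr hp0.le)).continuousAt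
  have hH := hardy u hu hc hsupp
  obtain ⟨hint, hhol⟩ := holder_three (μ := volume.restrict Ω) hwi ih.integrableOn iq.integrableOn
    ((ae_restrict_iff' hΩ.measurableSet).2 (.of_forall fun x hx => by
      have := hw x hx
      simp only [Pi.zero_apply]; positivity))
    (.of_forall fun x => by
      have := infDist_nonneg (x := x) (s := Ωᶜ)
      simp only [Pi.zero_apply]; positivity) (.of_forall fun x => by
      simp only [Pi.zero_apply]; positivity)
    (a := 1 / s) (by positivity) ha.le hb.le hab
  have hmono : ∫ x in Ω, w x * |u x| ^ p ≤ ∫ x in Ω, r ^ (p * a) *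
      ((w x ^ s) ^ (1 / s) * (|u x| ^ p / infDist x Ωᶜ ^ p) ^ a * (|u x| ^ q) ^ b) := by
    refine integral_mono_of_nonneg ?_ (hint.const_mul _) ?_
    · refine (ae_restrict_iff' hΩ.measurableSet).2 (.of_forall fun x hx => ?_)
      have := hw x hx
      simp only [Pi.zero_apply]; positivity
    · refine (ae_restrict_iff' hΩ.measurableSet).2 (.of_forall fun x hx => ?_)
      have hwx := hw x hx
      have hdx := hd x hx
      simp only
      have e1 : (w x ^ s) ^ (1 / s) = w x := by
        rw [one_div, Real.rpow_rpow_inv hwx hs0.ne']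
      have e2 : |u x| ^ p = |u x| ^ (p * a) * |u x| ^ (q * b) := by
        rw [← Real.rpow_add' (abs_nonneg _) (by rw [hpq]; exact hp0.ne'), hpq]
      rw [e1, Real.div_rpow (by positivity) (by positivity), ← Real.rpow_mul (abs_nonneg _),
        ← Real.rpow_mul hdx.le, ← Real.rpow_mul (abs_nonneg _), e2]
      have h1 : 1 ≤ r ^ (p * a) / infDist x Ωᶜ ^ (p * a) := by
        rw [one_le_div (by positivity)]
        exact Real.rpow_le_rpow hdx.le (hdr x hx) (by positivity)
      calc w x * (|u x| ^ (p * a) * |u x| ^ (q * b))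
          ≤ (w x * (|u x| ^ (p * a) * |u x| ^ (q * b))) *
            (r ^ (p * a) / infDist x Ωᶜ ^ (p * a)) := le_mul_of_one_le_right (by positivity) h1
        _ = _ := by ring
  rw [integral_const_mul, ← hen] at hmono
  rw [eP] at hhol
  rw [eG] at hmono hH
  rw [← hpa]
  have hG0 : 0 ≤ ∫ x, ‖fderiv ℝ u x‖ ^ p := integral_nonneg fun x => by positivity
  have hH0 : 0 ≤ ∫ x in Ω, |u x| ^ p / infDist x Ωᶜ ^ p := integral_nonneg fun x => by
    have := infDist_nonneg (x := x) (s := Ωᶜ)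
    positivity
  have hW0 : 0 ≤ ∫ x in Ω, w x ^ s := setIntegral_nonneg hΩ.measurableSet fun x hx => by
    have := hw x hx
    positivity
  generalize (∫ x, ‖fderiv ℝ u x‖ ^ p) = G at *
  generalize (∫ x in Ω, |u x| ^ p / infDist x Ωᶜ ^ p) = H at *
  generalize (∫ x, |u x| ^ q) = P at *
  generalize (∫ x in Ω, w x ^ s) = W at *
  have hG : 0 < G := by
    rcases hG0.eq_or_lt with h | h
    · rw [← h, Real.zero_rpow (by positivity), mul_zero] at hsob
      have : 0 < P ^ q⁻¹ := by positivity
      linarith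
    · exact h
  have hHa : H ^ a ≤ M ^ a * G ^ a := by
    rw [← Real.mul_rpow hM.le hG.le]
    exact Real.rpow_le_rpow hH0 (hH.trans (by gcongr)) ha.le
  have hPb : P ^ b ≤ S ^ (q * b) * G ^ (p⁻¹ * (q * b)) := by
    have := Real.rpow_le_rpow (by positivity) hsob (z := q * b) (by positivity)
    rwa [← Real.rpow_mul hP.le, inv_mul_cancel_left₀ hq0.ne', Real.mul_rpow hS.le (by positivity),
      ← Real.rpow_mul hG.le] at this
  have hexp : a + p⁻¹ * (q * b) = 1 := by rw [hqb, hadef]; field_simp; ring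
  have hfin : G ≤ r ^ (p * a) * (W ^ (1 / s) * (M ^ a * S ^ (q * b))) * G := by
    calc G ≤ r ^ (p * a) * (W ^ (1 / s) * H ^ a * P ^ b) :=
          hmono.trans (mul_le_mul_of_nonneg_left hhol (by positivity))
      _ ≤ r ^ (p * a) * (W ^ (1 / s) * (M ^ a * G ^ a) * (S ^ (q * b) * G ^ (p⁻¹ * (q * b)))) := by
          gcongr
      _ = r ^ (p * a) * (W ^ (1 / s) * (M ^ a * S ^ (q * b))) * (G ^ a * G ^ (p⁻¹ * (q * b))) := by
          ring
      _ = _ := by rw [← Real.rpow_add hG, hexp, Real.rpow_one]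
  have h1 : 1 ≤ r ^ (p * a) * (W ^ (1 / s) * (M ^ a * S ^ (q * b))) := by
    by_contra! h
    nlinarith
  rw [div_le_iff₀ (by positivity), inv_le_iff_one_le_mul₀ (by positivity)]
  linarith
end

section
/- Let N ≥ 1 and p > N. There exists a constant C > 0 depending only on N and p such that for every open set Ω ⊆ ℝ^N with finite positive inner radius r_Ω and every nonnegative w ∈ L^1(Ω) with ‖w‖_{L^1(Ω)} > 0, the first Dirichlet eigenvalue λ_1 of −Δ_p u = λ w(x)|u|^{p−2}u on Ω, characterized variationally as λ_1 = inf ∫_Ω |∇u|^p dx / ∫_Ω w|u|^p dx over all C^1 functions u with compact support contained in Ω such that ∫_Ω w|u|^p dx > 0, satisfies C / (r_Ω^{p−N} ‖w‖_{L^1(Ω)}) ≤ λ_1. -/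
open MeasureTheory Metric

lemma aux_scale_s7 {N : ℕ} (f : EuclideanSpace ℝ (Fin N) → ℝ) (a : EuclideanSpace ℝ (Fin N))
    {t : ℝ} (ht : 0 < t) :
    ∫ z, f (a + t • (z - a)) = (t ^ N)⁻¹ * ∫ z, f z := by
  have h1 := integral_sub_right_eq_self (μ := (volume : Measure (EuclideanSpace ℝ (Fin N))))
    (fun z => f (a + t • z)) a
  rw [h1]
  have h2 := Measure.integral_comp_smul (volume : Measure (EuclideanSpace ℝ (Fin N)))
    (fun z => f (a + z)) t
  rw [h2, integral_add_left_eq_self (μ := (volume : Measure (EuclideanSpace ℝ (Fin N)))) f a]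
  simp [abs_of_pos ht]

lemma aux_holder_s7 {N : ℕ} (p : ℝ) (hp1 : 1 < p) (g : EuclideanSpace ℝ (Fin N) → ℝ)
    (hg : Continuous g) (hgs : HasCompactSupport g) (hg0 : ∀ z, 0 ≤ g z)
    (a c : EuclideanSpace ℝ (Fin N)) (r : ℝ) {t : ℝ} (ht : 0 < t) :
    ∫ z in ball c r, g (a + t • (z - a)) ≤
      t ^ (-(N / p)) * ((volume.real (ball c r)) ^ (1 - 1 / p) * (∫ z, g z ^ p) ^ (1 / p)) := by
  have hp0 : 0 < p := by linarith
  have hpq := Real.HolderConjugate.conjExponent hp1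
  have hcont : Continuous fun z => g (a + t • (z - a)) := by fun_prop
  have hcs : HasCompactSupport fun z => g (a + t • (z - a)) := by
    have : (fun z => g (a + t • (z - a))) =
      g ∘ ((Homeomorph.subRight a).trans ((Homeomorph.smulOfNeZero t ht.ne').trans
        (Homeomorph.addLeft a))) := by
      ext z; simp
    rw [this]
    exact hgs.comp_homeomorph _
  have h := integral_mul_le_Lp_mul_Lq_of_nonneg (μ := volume.restrict (ball c r)) hpq
    (f := fun z => g (a + t • (z - a))) (g := fun _ => (1 : ℝ))
    (.of_forall fun z => hg0 _) (.of_forall fun z => zero_le_one)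
    ((hcont.memLp_of_hasCompactSupport hcs).restrict _)
    (by
      have : IsFiniteMeasure (volume.restrict (ball c r)) :=
        ⟨by simpa using measure_ball_lt_top⟩
      exact memLp_const 1)
  simp only [mul_one, Real.one_rpow, integral_const, smul_eq_mul, measureReal_restrict_apply_univ] at h
  have hq : 1 / p.conjExponent = 1 - 1 / p := by
    rw [one_div, one_div]; exact hpq.one_sub_inv.symm
  rw [hq] at h
  have hpc : Continuous fun z => g (a + t • (z - a)) ^ p :=
    hcont.rpow_const (fun _ => Or.inr hp0.le)
  have hps : HasCompactSupport fun z => g (a + t • (z - a)) ^ p :=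
    hcs.comp_left (g := fun x : ℝ => x ^ p) (Real.zero_rpow hp0.ne')
  have hint : Integrable fun z => g (a + t • (z - a)) ^ p :=
    hpc.integrable_of_hasCompactSupport hps
  have h2 : ∫ z in ball c r, g (a + t • (z - a)) ^ p ≤ (t ^ N)⁻¹ * ∫ z, g z ^ p := by
    rw [← aux_scale_s7 (fun z => g z ^ p) a ht]
    exact setIntegral_le_integral hint (.of_forall fun z => Real.rpow_nonneg (hg0 _) _)
  have hG : 0 ≤ ∫ z, g z ^ p := integral_nonneg fun z => Real.rpow_nonneg (hg0 _) _
  have h3 : (∫ z in ball c r, g (a + t • (z - a)) ^ p) ^ (1 / p) ≤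
      t ^ (-(N / p)) * (∫ z, g z ^ p) ^ (1 / p) := by
    calc _ ≤ ((t ^ N)⁻¹ * ∫ z, g z ^ p) ^ (1 / p) := by
          apply Real.rpow_le_rpow (integral_nonneg fun z => Real.rpow_nonneg (hg0 _) _) h2
          positivity
      _ = _ := by
          rw [Real.mul_rpow (by positivity) hG]
          congr 1
          rw [← Real.rpow_natCast, ← Real.rpow_neg ht.le, ← Real.rpow_mul ht.le]
          congr 1; ring
  calc _ ≤ _ := h
    _ ≤ _ := mul_le_mul_of_nonneg_right h3 (by positivity)
    _ = _ := by ring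

lemma aux_deriv {N : ℕ} (u : EuclideanSpace ℝ (Fin N) → ℝ) (hu : ContDiff ℝ 1 u)
    (hus : HasCompactSupport u) (a c : EuclideanSpace ℝ (Fin N)) (r R : ℝ)
    (hR : ∀ z ∈ ball c r, ‖z - a‖ ≤ R) (t : ℝ) :
    Integrable (fun z => fderiv ℝ u (a + t • (z - a)) (z - a)) (volume.restrict (ball c r)) ∧
    HasDerivAt (fun s : ℝ => ∫ z in ball c r, u (a + s • (z - a)))
      (∫ z in ball c r, fderiv ℝ u (a + t • (z - a)) (z - a)) t := by
  have hdc : Continuous (fderiv ℝ u) := hu.continuous_fderiv one_ne_zero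
  obtain ⟨M, hM⟩ := (hus.fderiv ℝ).exists_bound_of_continuous hdc
  have huc := hu.continuous
  have : IsFiniteMeasure (volume.restrict (ball c r)) :=
        ⟨by simpa using measure_ball_lt_top⟩
  obtain ⟨M', hM'⟩ := hus.exists_bound_of_continuous huc
  refine hasDerivAt_integral_of_dominated_loc_of_deriv_le (bound := fun _ => M * R)
    (F := fun (s : ℝ) z => u (a + s • (z - a)))
    (F' := fun s z => fderiv ℝ u (a + s • (z - a)) (z - a))
    (s := Set.univ) Filter.univ_mem ?_ ?_ ?_ ?_ ?_ ?_
  · refine .of_forall fun s => Continuous.aestronglyMeasurable (by fun_prop)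
  · exact Integrable.of_bound (Continuous.aestronglyMeasurable (by fun_prop)) M' (.of_forall fun z => hM' _)
  · refine Continuous.aestronglyMeasurable ?_
    exact (hdc.comp (by fun_prop)).clm_apply (by fun_prop)
  · filter_upwards [ae_restrict_mem measurableSet_ball] with z hz s _
    refine (ContinuousLinearMap.le_opNorm _ _).trans ?_
    have := hM (a + s • (z - a))
    exact mul_le_mul this (hR z hz) (norm_nonneg _) ((norm_nonneg _).trans this)
  · exact integrable_const _
  · refine .of_forall fun z s _ => ?_
    have h1 : HasDerivAt (fun s : ℝ => a + s • (z - a)) (z - a) s := by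
      simpa using ((hasDerivAt_id s).smul_const (z - a)).const_add a
    exact ((hu.differentiable one_ne_zero _).hasFDerivAt).comp_hasDerivAt s h1

lemma aux_morrey1 {N : ℕ} (p : ℝ) (hp1 : 1 < p) (hp : (N : ℝ) < p)
    (u : EuclideanSpace ℝ (Fin N) → ℝ) (hu : ContDiff ℝ 1 u)
    (hus : HasCompactSupport u) (a c : EuclideanSpace ℝ (Fin N)) (r R : ℝ) (hR0 : 0 ≤ R)
    (hR : ∀ z ∈ ball c r, ‖z - a‖ ≤ R) :
    (∫ z in ball c r, u z) - volume.real (ball c r) * u a ≤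
      R * ((volume.real (ball c r)) ^ (1 - 1 / p) * (∫ z, ‖fderiv ℝ u z‖ ^ p) ^ (1 / p))
        / (1 - N / p) := by
  have hp0 : 0 < p := by linarith
  have hs : 0 < 1 - N / p := by rw [sub_pos, div_lt_one hp0]; exact hp
  set A := (volume.real (ball c r)) ^ (1 - 1 / p) * (∫ z, ‖fderiv ℝ u z‖ ^ p) ^ (1 / p) with hA
  have hdc : Continuous (fderiv ℝ u) := hu.continuous_fderiv one_ne_zero
  have hD := aux_deriv u hu hus a c r R hR
  set φ := fun s : ℝ => ∫ z in ball c r, u (a + s • (z - a)) with hφ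
  have hB : ∀ t : ℝ, 0 < t → HasDerivAt (fun s : ℝ => R * A / (1 - N / p) * s ^ (1 - N / p))
      (R * A * t ^ (-(N / p))) t := by
    intro t ht
    have := (Real.hasDerivAt_rpow_const (p := 1 - N / p) (Or.inl ht.ne')).const_mul (R * A / (1 - N / p))
    rw [show (1 - N / p - 1 : ℝ) = -(N / p) by ring] at this
    have e : R * A / (1 - N / p) * ((1 - N / p) * t ^ (-(N / p))) = R * A * t ^ (-(N / p)) := by
      rw [← mul_assoc, div_mul_cancel₀ _ hs.ne']
    rwa [e] at this
  have hmono : MonotoneOn (fun s : ℝ => R * A / (1 - N / p) * s ^ (1 - N / p) - φ s)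
      (Set.Icc 0 1) := by
    apply monotoneOn_of_deriv_nonneg (convex_Icc 0 1)
    · apply ContinuousOn.sub
      · exact (continuous_const.mul (Real.continuous_rpow_const hs.le)).continuousOn
      · exact fun s _ => (hD s).2.continuousAt.continuousWithinAt
    · intro s hs
      rw [interior_Icc] at hs
      exact ((hB s hs.1).sub (hD s).2).differentiableAt.differentiableWithinAt
    · intro t ht
      rw [interior_Icc] at ht
      have ht0 := ht.1
      rw [((hB t ht0).fun_sub (hD t).2).deriv, sub_nonneg]
      have hh := aux_holder_s7 p hp1 (fun z => ‖fderiv ℝ u z‖) hdc.norm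
        (hus.fderiv ℝ).norm (fun z => norm_nonneg _) a c r ht0
      have hint : IntegrableOn (fun z => R * ‖fderiv ℝ u (a + t • (z - a))‖) (ball c r) := by
        have : IsFiniteMeasure (volume.restrict (ball c r)) :=
          ⟨by simpa using measure_ball_lt_top⟩
        obtain ⟨M, hM⟩ := (hus.fderiv ℝ).exists_bound_of_continuous hdc
        refine Integrable.const_mul ?_ R
        refine Integrable.of_bound (Continuous.aestronglyMeasurable ?_) M
          (.of_forall fun z => by simpa using hM _)
        exact (hdc.comp (by fun_prop)).norm
      calc _ ≤ ∫ z in ball c r, R * ‖fderiv ℝ u (a + t • (z - a))‖ := by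
            refine setIntegral_mono_on (hD t).1 hint measurableSet_ball fun z hz => ?_
            refine (Real.le_norm_self _).trans ((ContinuousLinearMap.le_opNorm _ _).trans ?_)
            rw [mul_comm]
            exact mul_le_mul_of_nonneg_right (hR z hz) (norm_nonneg _)
        _ ≤ R * (t ^ (-(N / p)) * A) := by
            rw [integral_const_mul]
            exact mul_le_mul_of_nonneg_left hh hR0
        _ = _ := by ring
  have h01 := hmono (Set.left_mem_Icc.2 zero_le_one) (Set.right_mem_Icc.2 zero_le_one) zero_le_one
  have e1 : φ 1 = ∫ z in ball c r, u z := by simp [hφ]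
  have e0 : φ 0 = volume.real (ball c r) * u a := by simp [hφ]
  simp only [e1, e0, Real.zero_rpow hs.ne', Real.one_rpow] at h01
  linarith

lemma aux_morrey2 {N : ℕ} (p : ℝ) (hp1 : 1 < p) (hp : (N : ℝ) < p)
    (u : EuclideanSpace ℝ (Fin N) → ℝ) (hu : ContDiff ℝ 1 u)
    (hus : HasCompactSupport u) (x y : EuclideanSpace ℝ (Fin N)) (r : ℝ) (hr : 0 < r)
    (hxy : dist x y ≤ r) (hy : u y = 0) :
    volume.real (ball x r) * |u x| ≤ 2 * (
      (2 * r) * ((volume.real (ball x r)) ^ (1 - 1 / p) * (∫ z, ‖fderiv ℝ u z‖ ^ p) ^ (1 / p))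
        / (1 - N / p)) := by
  have key : ∀ v : EuclideanSpace ℝ (Fin N) → ℝ, ContDiff ℝ 1 v → HasCompactSupport v →
      ∀ a, dist x a ≤ r → (∫ z in ball x r, v z) - volume.real (ball x r) * v a ≤
      (2 * r) * ((volume.real (ball x r)) ^ (1 - 1 / p) * (∫ z, ‖fderiv ℝ v z‖ ^ p) ^ (1 / p))
        / (1 - N / p) := by
    intro v hv hvs a ha
    refine aux_morrey1 p hp1 hp v hv hvs a x r (2 * r) (by positivity) fun z hz => ?_
    rw [← dist_eq_norm]
    have := dist_triangle z x a
    rw [mem_ball] at hz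
    linarith
  have hx : dist x x ≤ r := by simpa using hr.le
  have a1 := key u hu hus x hx
  have a2 := key u hu hus y hxy
  have hneg : HasCompactSupport fun z => - u z := hus.comp_left (g := fun s : ℝ => -s) neg_zero
  have b1 := key (fun z => - u z) hu.neg hneg x hx
  have b2 := key (fun z => - u z) hu.neg hneg y hxy
  simp only [fderiv_fun_neg, norm_neg, integral_neg, hy] at b1 b2 a2
  have hV : (0:ℝ) ≤ volume.real (ball x r) := measureReal_nonneg
  rw [← abs_of_nonneg hV, ← abs_mul, abs_of_nonneg hV, abs_le]
  constructor <;> linarith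

lemma aux_morrey3 {N : ℕ} (p : ℝ) (hp1 : 1 < p) (hp : (N : ℝ) < p)
    (u : EuclideanSpace ℝ (Fin N) → ℝ) (hu : ContDiff ℝ 1 u)
    (hus : HasCompactSupport u) (x y : EuclideanSpace ℝ (Fin N)) (r : ℝ) (hr : 0 < r)
    (hxy : dist x y ≤ r) (hy : u y = 0) :
    |u x| ^ p ≤ (4 / (1 - N / p)) ^ p / volume.real (ball (0 : EuclideanSpace ℝ (Fin N)) 1) *
      r ^ (p - N) * ∫ z, ‖fderiv ℝ u z‖ ^ p := by
  have h := aux_morrey2 p hp1 hp u hu hus x y r hr hxy hy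
  have hp0 : 0 < p := by linarith
  have hs : 0 < 1 - N / p := by rw [sub_pos, div_lt_one hp0]; exact hp
  have hG : 0 ≤ ∫ z, ‖fderiv ℝ u z‖ ^ p := integral_nonneg fun z => Real.rpow_nonneg (norm_nonneg _) _
  set G := ∫ z, ‖fderiv ℝ u z‖ ^ p
  have hω : 0 < volume.real (ball (0 : EuclideanSpace ℝ (Fin N)) 1) :=
    ENNReal.toReal_pos (measure_ball_pos _ _ one_pos).ne' measure_ball_lt_top.ne
  have hV : volume.real (ball x r) = r ^ N * volume.real (ball (0 : EuclideanSpace ℝ (Fin N)) 1) := by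
    simp only [Measure.real]
    rw [Measure.addHaar_ball_of_pos _ _ hr, ENNReal.toReal_mul, ENNReal.toReal_ofReal (by positivity)]
    simp
  set ω := volume.real (ball (0 : EuclideanSpace ℝ (Fin N)) 1)
  have hVp : 0 < volume.real (ball x r) := by rw [hV]; positivity
  set V := volume.real (ball x r)
  have h2 : |u x| ≤ 4 / (1 - N / p) * r * (V ^ (-(1 / p)) * G ^ (1 / p)) := by
    rw [sub_eq_add_neg 1 (1 / p), Real.rpow_add hVp, Real.rpow_one] at h
    refine le_of_mul_le_mul_left (h.trans (le_of_eq ?_)) hVp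
    ring
  calc |u x| ^ p ≤ (4 / (1 - N / p) * r * (V ^ (-(1 / p)) * G ^ (1 / p))) ^ p :=
        Real.rpow_le_rpow (abs_nonneg _) h2 hp0.le
    _ = (4 / (1 - N / p)) ^ p * r ^ p * (V⁻¹ * G) := by
        rw [Real.mul_rpow (by positivity) (by positivity), Real.mul_rpow (by positivity) hr.le,
          Real.mul_rpow (by positivity) (by positivity), ← Real.rpow_mul hVp.le, ← Real.rpow_mul hG]
        rw [show -(1 / p) * p = -1 by field_simp, show 1 / p * p = 1 by field_simp,
          Real.rpow_one, Real.rpow_neg_one]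
    _ = _ := by
        rw [Real.rpow_sub hr, Real.rpow_natCast, hV]
        field_simp

theorem eigenvalue_lower_bound_p_gt_N (N : ℕ) (hN : 1 ≤ N) (p : ℝ) (hp : (N : ℝ) < p) :
    ∃ C : ℝ, 0 < C ∧
      ∀ (Ω : Set (EuclideanSpace ℝ (Fin N))) (rΩ : ℝ)
        (w : EuclideanSpace ℝ (Fin N) → ℝ),
        IsOpen Ω →
        IsLUB ((fun x => infDist x Ωᶜ) '' Ω) rΩ →
        0 < rΩ →
        (∀ x ∈ Ω, 0 ≤ w x) →
        IntegrableOn w Ω →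
        0 < (∫ x in Ω, w x) →
        C / (rΩ ^ (p - N) * ∫ x in Ω, w x) ≤
          sInf {R : ℝ | ∃ u : EuclideanSpace ℝ (Fin N) → ℝ,
            ContDiff ℝ 1 u ∧ HasCompactSupport u ∧ tsupport u ⊆ Ω ∧
            0 < (∫ x in Ω, w x * |u x| ^ p) ∧
            R = (∫ x in Ω, ‖fderiv ℝ u x‖ ^ p) / (∫ x in Ω, w x * |u x| ^ p)} := by
  have hN1 : (1 : ℝ) ≤ N := by exact_mod_cast hN
  have hp1 : 1 < p := by linarith
  have hp0 : 0 < p := by linarith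
  have hs : 0 < 1 - N / p := by rw [sub_pos, div_lt_one hp0]; exact hp
  have hω : 0 < volume.real (ball (0 : EuclideanSpace ℝ (Fin N)) 1) :=
    ENNReal.toReal_pos (measure_ball_pos _ _ one_pos).ne' measure_ball_lt_top.ne
  set K := (4 / (1 - N / p)) ^ p / volume.real (ball (0 : EuclideanSpace ℝ (Fin N)) 1) with hK
  have hK0 : 0 < K := by positivity
  refine ⟨K⁻¹, by positivity, ?_⟩
  intro Ω r w hΩ hlub hr hw hwi hwpos
  have hne : (Ωᶜ).Nonempty := by
    by_contra hcon
    rw [Set.not_nonempty_iff_eq_empty] at hcon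
    have : r ≤ 0 := hlub.2 (by
      rintro _ ⟨x, _, rfl⟩
      simp [hcon])
    linarith
  have hint : ∀ u : EuclideanSpace ℝ (Fin N) → ℝ, Continuous u → HasCompactSupport u →
      IntegrableOn (fun x => w x * |u x| ^ p) Ω := by
    intro u huc hus
    obtain ⟨M, hM⟩ := hus.exists_bound_of_continuous huc
    refine Integrable.mul_bdd (c := M ^ p) hwi
      (huc.abs.rpow_const fun _ => Or.inr hp0.le).aestronglyMeasurable (.of_forall fun x => ?_)
    rw [Real.norm_of_nonneg (by positivity)]
    exact Real.rpow_le_rpow (abs_nonneg _) (hM x) hp0.le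
  apply le_csInf
  · by_contra hcon
    have hz : ∀ᵐ x ∂(volume : Measure (EuclideanSpace ℝ (Fin N))), x ∈ Ω → w x = 0 := by
      refine hΩ.ae_eq_zero_of_integral_contDiff_smul_eq_zero hwi.locallyIntegrableOn ?_
      intro g hg hgs hgt
      have hg1 : ContDiff ℝ 1 g := hg.of_le (by exact_mod_cast le_top)
      have hle : ¬ 0 < ∫ x in Ω, w x * |g x| ^ p := fun hpos =>
        hcon ⟨_, g, hg1, hgs, hgt, hpos, rfl⟩
      have hnn : 0 ≤ᵐ[volume.restrict Ω] fun x => w x * |g x| ^ p := by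
        filter_upwards [ae_restrict_mem hΩ.measurableSet] with x hx
        exact mul_nonneg (hw x hx) (by positivity)
      have h0 : ∫ x in Ω, w x * |g x| ^ p = 0 :=
        le_antisymm (not_lt.1 hle) (integral_nonneg_of_ae hnn)
      rw [integral_eq_zero_iff_of_nonneg_ae hnn (hint g hg1.continuous hgs)] at h0
      rw [← setIntegral_eq_integral_of_forall_compl_eq_zero (s := Ω)]
      · apply integral_eq_zero_of_ae
        filter_upwards [h0] with x hx
        rcases mul_eq_zero.1 hx with h | h
        · simp [h]
        · rw [Real.rpow_eq_zero (abs_nonneg _) hp0.ne', abs_eq_zero] at h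
          simp [h]
      · intro x hx
        rw [image_eq_zero_of_notMem_tsupport fun h => hx (hgt h), zero_smul]
    have : ∫ x in Ω, w x = 0 := integral_eq_zero_of_ae
      ((ae_restrict_iff' hΩ.measurableSet).2 hz)
    linarith
  · rintro _ ⟨u, hu, hus, hut, hpos, rfl⟩
    have hu0 : ∀ x ∉ Ω, u x = 0 := fun x hx =>
      image_eq_zero_of_notMem_tsupport fun h => hx (hut h)
    have hG : ∫ x in Ω, ‖fderiv ℝ u x‖ ^ p = ∫ x, ‖fderiv ℝ u x‖ ^ p := by
      apply setIntegral_eq_integral_of_forall_compl_eq_zero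
      intro x hx
      have : fderiv ℝ u x = 0 := by
        by_contra h
        exact hx (hut (support_fderiv_subset ℝ h))
      simp [this, hp0.ne']
    rw [hG]
    set G := ∫ x, ‖fderiv ℝ u x‖ ^ p
    have hb : ∀ x ∈ Ω, |u x| ^ p ≤ K * r ^ (p - N) * G := by
      intro x hx
      obtain ⟨y, hy, hxy⟩ := hΩ.isClosed_compl.exists_infDist_eq_dist hne x
      refine aux_morrey3 p hp1 hp u hu hus x y r hr ?_ (hu0 y hy)
      rw [← hxy]
      exact hlub.1 ⟨x, hx, rfl⟩
    have hI : ∫ x in Ω, w x * |u x| ^ p ≤ (∫ x in Ω, w x) * (K * r ^ (p - N) * G) := by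
      rw [← integral_mul_const]
      exact setIntegral_mono_on (hint u hu.continuous hus) (hwi.mul_const _) hΩ.measurableSet
        fun x hx => mul_le_mul_of_nonneg_left (hb x hx) (hw x hx)
    have hrp : 0 < r ^ (p - N) := Real.rpow_pos_of_pos hr _
    rw [div_le_div_iff₀ (by positivity) hpos, inv_mul_le_iff₀ hK0]
    refine hI.trans (le_of_eq (by ring))
end

section
/- Let 1 < p < N and s > N/p. Let Ω ⊂ ℝ^N be a bounded open set with inner radius r_Ω that satisfies the p-Hardy inequality with constant C_h, and let w ∈ L^s(Ω) be nonnegative with ‖w‖_{L^s(Ω)} > 0. Then there exists a constant C > 0 depending only on p, N, s and C_h such that the first Dirichlet eigenvalue λ_1 of −Δ_p u = λ w(x)|u|^{p−2}u on Ω, characterized variationally as λ_1 = inf ∫_Ω |∇u|^p dx / ∫_Ω w|u|^p dx over all C^1 functions u with compact support contained in Ω such that ∫_Ω w|u|^p dx > 0, satisfies C / (r_Ω^{(sp−N)/s} ‖w‖_{L^s(Ω)}) ≤ λ_1. -/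
open MeasureTheory Metric

lemma aux_holder3 {α : Type*} [MeasurableSpace α] {μ : Measure α} {f g h : α → ℝ}
    (hf : Integrable f μ) (hg : Integrable g μ) (hh : Integrable h μ)
    (hf0 : 0 ≤ᵐ[μ] f) (hg0 : 0 ≤ᵐ[μ] g) (hh0 : 0 ≤ᵐ[μ] h)
    {a b c : ℝ} (ha : 0 ≤ a) (hb : 0 ≤ b) (hc : 0 ≤ c) (habc : a + b + c = 1) :
    Integrable (fun x => f x ^ a * g x ^ b * h x ^ c) μ ∧
    ∫ x, f x ^ a * g x ^ b * h x ^ c ∂μ ≤ (∫ x, f x ∂μ) ^ a * (∫ x, g x ∂μ) ^ b * (∫ x, h x ∂μ) ^ c := by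
  have key := ENNReal.lintegral_prod_norm_pow_le (μ := μ) (Finset.univ : Finset (Fin 3))
    (f := ![fun x => ENNReal.ofReal (f x), fun x => ENNReal.ofReal (g x), fun x => ENNReal.ofReal (h x)])
    (p := ![a, b, c]) (by
      intro i _
      fin_cases i
      · exact hf.1.aemeasurable.ennreal_ofReal
      · exact hg.1.aemeasurable.ennreal_ofReal
      · exact hh.1.aemeasurable.ennreal_ofReal)
    (by simp [Fin.sum_univ_three, habc]) (by intro i _; fin_cases i <;> simpa)
  simp only [Fin.prod_univ_three, Matrix.cons_val_zero, Matrix.cons_val_one, Matrix.cons_val] at key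
  rw [← ofReal_integral_eq_lintegral_ofReal hf hf0, ← ofReal_integral_eq_lintegral_ofReal hg hg0,
    ← ofReal_integral_eq_lintegral_ofReal hh hh0] at key
  have If := integral_nonneg_of_ae hf0
  have Ig := integral_nonneg_of_ae hg0
  have Ih := integral_nonneg_of_ae hh0
  rw [ENNReal.ofReal_rpow_of_nonneg If ha, ENNReal.ofReal_rpow_of_nonneg Ig hb,
    ENNReal.ofReal_rpow_of_nonneg Ih hc, ← ENNReal.ofReal_mul (by positivity),
    ← ENNReal.ofReal_mul (by positivity)] at key
  have e : ∫⁻ x, ENNReal.ofReal (f x) ^ a * ENNReal.ofReal (g x) ^ b * ENNReal.ofReal (h x) ^ c ∂μ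
      = ∫⁻ x, ENNReal.ofReal (f x ^ a * g x ^ b * h x ^ c) ∂μ := by
    apply lintegral_congr_ae
    filter_upwards [hf0, hg0, hh0] with x h1 h2 h3
    simp only [Pi.zero_apply] at h1 h2 h3
    rw [ENNReal.ofReal_rpow_of_nonneg h1 ha, ENNReal.ofReal_rpow_of_nonneg h2 hb,
    ENNReal.ofReal_rpow_of_nonneg h3 hc, ← ENNReal.ofReal_mul (by positivity),
    ← ENNReal.ofReal_mul (by positivity)]
  rw [e] at key
  have n0 : 0 ≤ᵐ[μ] (fun x => f x ^ a * g x ^ b * h x ^ c) := by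
    filter_upwards [hf0, hg0, hh0] with x h1 h2 h3
    simp only [Pi.zero_apply] at h1 h2 h3 ⊢
    positivity
  have I : Integrable (fun x => f x ^ a * g x ^ b * h x ^ c) μ := by
    refine (lintegral_ofReal_ne_top_iff_integrable ?_ n0).1 (ne_top_of_le_ne_top ENNReal.ofReal_ne_top key)
    exact (((hf.1.aemeasurable.pow_const a).mul (hg.1.aemeasurable.pow_const b)).mul
      (hh.1.aemeasurable.pow_const c)).aestronglyMeasurable
  refine ⟨I, ?_⟩
  rw [← ofReal_integral_eq_lintegral_ofReal I n0] at key
  exact (ENNReal.ofReal_le_ofReal_iff (by positivity)).1 key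

lemma aux_sobolev (N : ℕ) (p q : ℝ) (hp1 : 1 < p) (hpN : p < N) (hq : q = N * p / (N - p)) :
    ∃ S : ℝ, 0 < S ∧ ∀ u : EuclideanSpace ℝ (Fin N) → ℝ,
      ContDiff ℝ 1 u → HasCompactSupport u →
      (∫ x, |u x| ^ q) ^ (p / q) ≤ S * ∫ x, ‖fderiv ℝ u x‖ ^ p := by
  have hp0 : 0 < p := by linarith
  have hN0 : (0:ℝ) < N := by linarith
  have hNp : (0:ℝ) < N - p := by linarith
  have hq0 : 0 < q := by rw [hq]; positivity
  let P : NNReal := ⟨p, hp0.le⟩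
  let Q : NNReal := ⟨q, hq0.le⟩
  let K : NNReal := eLpNormLESNormFDerivOfEqInnerConst (volume : Measure (EuclideanSpace ℝ (Fin N))) P
  refine ⟨((K:ℝ) + 1) ^ p, by positivity, fun u hu hcu => ?_⟩
  have h := eLpNorm_le_eLpNorm_fderiv_of_eq_inner (volume : Measure (EuclideanSpace ℝ (Fin N))) hu hcu
    (p := P) (p' := Q) (by exact_mod_cast hp1.le)
    (by simp; exact_mod_cast hN0) (by
      simp only [finrank_euclideanSpace, Fintype.card_fin]
      change q⁻¹ = p⁻¹ - _
      rw [hq]; field_simp)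
  have hPn : (P : ENNReal) ≠ 0 := by
    simp only [ne_eq, ENNReal.coe_eq_zero]; intro h; exact hp0.ne' (congrArg NNReal.toReal h)
  have hQn : (Q : ENNReal) ≠ 0 := by
    simp only [ne_eq, ENNReal.coe_eq_zero]; intro h; exact hq0.ne' (congrArg NNReal.toReal h)
  rw [(hu.continuous.memLp_of_hasCompactSupport hcu).eLpNorm_eq_integral_rpow_norm hQn ENNReal.coe_ne_top,
    ((hu.continuous_fderiv one_ne_zero).memLp_of_hasCompactSupport (hcu.fderiv ℝ)).eLpNorm_eq_integral_rpow_norm hPn ENNReal.coe_ne_top] at h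
  simp only [ENNReal.coe_toReal] at h
  change ENNReal.ofReal ((∫ x, |u x| ^ q) ^ q⁻¹) ≤ (K : ENNReal) * ENNReal.ofReal ((∫ x, ‖fderiv ℝ u x‖ ^ p) ^ p⁻¹) at h
  have I1 : 0 ≤ ∫ x, |u x| ^ q := integral_nonneg fun x => by positivity
  have I2 : 0 ≤ ∫ x, ‖fderiv ℝ u x‖ ^ p := integral_nonneg fun x => by positivity
  rw [← ENNReal.ofReal_coe_nnreal, ← ENNReal.ofReal_mul (by positivity),
    ENNReal.ofReal_le_ofReal_iff (by positivity)] at h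
  calc (∫ x, |u x| ^ q) ^ (p / q) = ((∫ x, |u x| ^ q) ^ q⁻¹) ^ p := by
        rw [← Real.rpow_mul I1]; congr 1; field_simp
    _ ≤ (((K:ℝ)+1) * (∫ x, ‖fderiv ℝ u x‖ ^ p) ^ p⁻¹) ^ p := by
        apply Real.rpow_le_rpow (by positivity) _ hp0.le
        refine h.trans ?_
        gcongr
        linarith
    _ = _ := by
        rw [Real.mul_rpow (by positivity) (by positivity), ← Real.rpow_mul I2,
          inv_mul_cancel₀ hp0.ne', Real.rpow_one]

theorem eigenvalue_lower_bound_p_lt_N (N : ℕ) (hN : 1 ≤ N) (p s Ch : ℝ)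
    (hp1 : 1 < p) (hpN : p < N) (hs : (N : ℝ) / p < s) :
    ∃ C : ℝ, 0 < C ∧
      ∀ (Ω : Set (EuclideanSpace ℝ (Fin N))) (rΩ : ℝ)
        (w : EuclideanSpace ℝ (Fin N) → ℝ),
        IsOpen Ω →
        Bornology.IsBounded Ω →
        -- `rΩ` is the inner radius of `Ω`
        IsLUB ((fun x => infDist x Ωᶜ) '' Ω) rΩ →
        -- `Ω` satisfies the `p`-Hardy inequality with constant `Ch`
        (∀ φ : EuclideanSpace ℝ (Fin N) → ℝ,
          ContDiff ℝ 1 φ → HasCompactSupport φ → tsupport φ ⊆ Ω →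
            (∫ x in Ω, |φ x| ^ p / infDist x Ωᶜ ^ p) ≤
              Ch * ∫ x in Ω, ‖fderiv ℝ φ x‖ ^ p) →
        -- `w ≥ 0` belongs to `L^s(Ω)` with positive norm
        (∀ x ∈ Ω, 0 ≤ w x) →
        IntegrableOn (fun x => w x ^ s) Ω →
        0 < (∫ x in Ω, w x ^ s) ^ (1 / s) →
        C / (rΩ ^ ((s * p - N) / s) * (∫ x in Ω, w x ^ s) ^ (1 / s)) ≤
          sInf {R : ℝ | ∃ u : EuclideanSpace ℝ (Fin N) → ℝ,
            ContDiff ℝ 1 u ∧ HasCompactSupport u ∧ tsupport u ⊆ Ω ∧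
            0 < (∫ x in Ω, w x * |u x| ^ p) ∧
            R = (∫ x in Ω, ‖fderiv ℝ u x‖ ^ p) / (∫ x in Ω, w x * |u x| ^ p)} := by
  have hp0 : 0 < p := by linarith
  have hN0 : (0:ℝ) < N := by linarith
  have hNp : (0:ℝ) < N - p := by linarith
  have hs0 : 0 < s := lt_trans (by positivity) hs
  have hsp : (N:ℝ) < s * p := by rwa [div_lt_iff₀ hp0] at hs
  obtain ⟨q, hq⟩ : ∃ q : ℝ, q = N * p / (N - p) := ⟨_, rfl⟩
  have hq0 : 0 < q := by rw [hq]; positivity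
  obtain ⟨S, hS, hSob⟩ := aux_sobolev N p q hp1 hpN hq
  obtain ⟨a, ha⟩ : ∃ a : ℝ, a = 1 - N / (p * s) := ⟨_, rfl⟩
  have ha0 : 0 ≤ a := by
    rw [ha, sub_nonneg, div_le_one (by positivity)]; linarith
  have hpa : p * a = (s * p - N) / s := by rw [ha]; field_simp
  set c : ℝ := (N - p) / (p * s) with hc
  set b : ℝ := N / (p * s) with hb
  have hb0 : 0 ≤ b := by positivity
  have hc0 : 0 ≤ c := by positivity
  have hab : a + b = 1 := by rw [ha]; ring
  set M := max Ch 1 with hM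
  have hM0 : 0 < M := lt_of_lt_of_le one_pos (le_max_right _ _)
  refine ⟨(M ^ a * S ^ b)⁻¹, by positivity, ?_⟩
  intro Ω rΩ w hΩo hΩb hr hHardy hw hwi hwpos
  have hAne : (∫ x in Ω, w x ^ s) ≠ 0 := by
    intro h; rw [h, Real.zero_rpow (by positivity)] at hwpos; exact lt_irrefl _ hwpos
  have hA0 : 0 ≤ ∫ x in Ω, w x ^ s :=
    setIntegral_nonneg hΩo.measurableSet fun x hx => Real.rpow_nonneg (hw x hx) _
  have hΩne : Ω.Nonempty := by
    by_contra h
    rw [Set.not_nonempty_iff_eq_empty] at h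
    simp [h] at hAne
  have : Nontrivial (EuclideanSpace ℝ (Fin N)) := by
    have : Nonempty (Fin N) := ⟨⟨0, hN⟩⟩
    infer_instance
  have hΩc : Ωᶜ.Nonempty := by
    rw [Set.nonempty_compl]
    rintro rfl
    exact NormedSpace.unbounded_univ ℝ (EuclideanSpace ℝ (Fin N)) hΩb
  have hdpos : ∀ x ∈ Ω, 0 < infDist x Ωᶜ := fun x hx =>
    (hΩo.isClosed_compl.notMem_iff_infDist_pos hΩc).1 (by simpa using hx)
  have hdle : ∀ x ∈ Ω, infDist x Ωᶜ ≤ rΩ := fun x hx => hr.1 ⟨x, hx, rfl⟩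
  have hr0 : 0 < rΩ := by
    obtain ⟨x, hx⟩ := hΩne
    exact (hdpos x hx).trans_le (hdle x hx)
  -- Hölder
  have hmain : ∀ u : EuclideanSpace ℝ (Fin N) → ℝ, ContDiff ℝ 1 u → HasCompactSupport u →
      IntegrableOn (fun x => w x * |u x| ^ p) Ω ∧ (∫ x in Ω, w x * |u x| ^ p) ≤
      (∫ x in Ω, w x ^ s) ^ (1/s) * (∫ x in Ω, |u x| ^ p) ^ a * (∫ x in Ω, |u x| ^ q) ^ c := by
    intro u hu hcu
    have ci : ∀ r : ℝ, 0 < r → Integrable (fun x => |u x| ^ r) := fun r hr =>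
      (hu.continuous.abs.rpow_const (fun _ => Or.inr hr.le)).integrable_of_hasCompactSupport
        (hcu.comp_left (g := fun t => |t| ^ r) (by simp [hr.ne']))
    have := aux_holder3 (μ := volume.restrict Ω) hwi (ci p hp0).integrableOn (ci q hq0).integrableOn
      (ae_restrict_of_forall_mem hΩo.measurableSet fun x hx => Real.rpow_nonneg (hw x hx) _)
      (.of_forall fun x => by simp only [Pi.zero_apply]; positivity)
      (.of_forall fun x => by simp only [Pi.zero_apply]; positivity)
      (a := 1/s) (b := a) (c := c) (by positivity) ha0 hc0
      (by rw [ha, hb, hc]; field_simp; ring)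
    have e : Set.EqOn (fun x => (w x ^ s) ^ (1/s) * (|u x| ^ p) ^ a * (|u x| ^ q) ^ c)
        (fun x => w x * |u x| ^ p) Ω := by
      intro x hx
      simp only
      rw [← Real.rpow_mul (hw x hx), mul_one_div_cancel hs0.ne', Real.rpow_one, mul_assoc,
        ← Real.rpow_mul (abs_nonneg _), ← Real.rpow_mul (abs_nonneg _),
        ← Real.rpow_add_of_nonneg (abs_nonneg _) (by positivity) (by positivity)]
      congr 2
      rw [hpa, hq, hc]; field_simp; ring
    rw [setIntegral_congr_fun hΩo.measurableSet e] at this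
    exact ⟨(integrableOn_congr_fun e hΩo.measurableSet).1 this.1, this.2⟩
  apply le_csInf
  · by_contra hemp
    apply hAne
    rw [Set.not_nonempty_iff_eq_empty, Set.eq_empty_iff_forall_notMem] at hemp
    have hz : ∀ u : EuclideanSpace ℝ (Fin N) → ℝ, ContDiff ℝ 1 u → HasCompactSupport u →
        tsupport u ⊆ Ω → ∀ᵐ x ∂(volume.restrict Ω), w x * |u x| ^ p = 0 := by
      intro u hu hcu hsu
      have h1 : ¬ 0 < (∫ x in Ω, w x * |u x| ^ p) := fun h => hemp _ ⟨u, hu, hcu, hsu, h, rfl⟩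
      have h0 : ∀ x ∈ Ω, 0 ≤ w x * |u x| ^ p := fun x hx => mul_nonneg (hw x hx) (by positivity)
      have h2 := le_antisymm (not_lt.1 h1) (setIntegral_nonneg hΩo.measurableSet h0)
      exact (setIntegral_eq_zero_iff_of_nonneg_ae
        (ae_restrict_of_forall_mem hΩo.measurableSet h0) (hmain u hu hcu).1).1 h2
    have hw0 : ∀ᵐ x ∂volume, x ∈ Ω → w x = 0 := by
      have : volume {x | x ∈ Ω ∧ w x ≠ 0} = 0 := by
        apply measure_null_of_locally_null
        rintro x ⟨hx, -⟩
        obtain ⟨f, hf1, hf2, hf3, hf4, hf5⟩ := exists_contDiff_tsupport_subset (n := 1) (hΩo.mem_nhds hx)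
        refine ⟨{x | x ∈ Ω ∧ w x ≠ 0} ∩ {y | f y ≠ 0}, ?_, ?_⟩
        · refine Filter.inter_mem self_mem_nhdsWithin (mem_nhdsWithin_of_mem_nhds ?_)
          exact (isOpen_ne_fun hf3.continuous continuous_const).mem_nhds (by simp [hf5])
        · have := hz f (by exact_mod_cast hf3) hf2 hf1
          rw [ae_restrict_iff' hΩo.measurableSet, ae_iff] at this
          refine measure_mono_null ?_ this
          rintro y ⟨⟨hy1, hy2⟩, hy3⟩
          simp only [Set.mem_ofPred_eq, Classical.not_imp]
          refine ⟨hy1, mul_ne_zero hy2 ?_⟩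
          have : 0 < |f y| := abs_pos.2 hy3
          positivity
      rw [ae_iff]
      convert this using 3
      simp
    rw [← ae_restrict_iff' hΩo.measurableSet] at hw0
    apply integral_eq_zero_of_ae
    filter_upwards [hw0] with x hx
    simp [hx, hs0.ne']
  · rintro R ⟨u, hu, hcu, hsu, hpos, rfl⟩
    have hGfull : ∫ x in Ω, ‖fderiv ℝ u x‖ ^ p = ∫ x, ‖fderiv ℝ u x‖ ^ p := by
      apply setIntegral_eq_integral_of_forall_compl_eq_zero
      intro x hx
      have : fderiv ℝ u x = 0 := by
        by_contra h
        exact hx (hsu (support_fderiv_subset ℝ h))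
      simp [this, hp0.ne']
    have hVfull : ∫ x in Ω, |u x| ^ q = ∫ x, |u x| ^ q := by
      apply setIntegral_eq_integral_of_forall_compl_eq_zero
      intro x hx
      have : u x = 0 := by
        by_contra h
        exact hx (hsu (subset_tsupport _ h))
      simp [this, hq0.ne']
    have hG0 : 0 ≤ ∫ x in Ω, ‖fderiv ℝ u x‖ ^ p := integral_nonneg fun x => by positivity
    have hU0 : 0 ≤ ∫ x in Ω, |u x| ^ p := integral_nonneg fun x => by positivity
    have hV0 : 0 ≤ ∫ x in Ω, |u x| ^ q := integral_nonneg fun x => by positivity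
    have hSu := hSob u hu hcu
    rw [← hGfull, ← hVfull] at hSu
    have hHol := (hmain u hu hcu).2
    have hHint : IntegrableOn (fun x => |u x| ^ p / infDist x Ωᶜ ^ p) Ω := by
      have hcont : Continuous (fun x => |u x| ^ p / infDist x Ωᶜ ^ p) := by
        rw [continuous_iff_continuousAt]
        intro x
        by_cases hx : x ∈ Ω
        · exact ((hu.continuous.abs.rpow_const (fun _ => Or.inr hp0.le)).continuousAt).div
            ((continuous_infDist_pt _).rpow_const (fun _ => Or.inr hp0.le)).continuousAt
            (Real.rpow_pos_of_pos (hdpos x hx) _).ne'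
        · have : (fun x => |u x| ^ p / infDist x Ωᶜ ^ p) =ᶠ[nhds x] fun _ => 0 := by
            have h2 : (tsupport u)ᶜ ∈ nhds x :=
              (isClosed_tsupport u).isOpen_compl.mem_nhds (fun h => hx (hsu h))
            filter_upwards [h2] with y hy
            simp [image_eq_zero_of_notMem_tsupport hy, hp0.ne']
          exact continuousAt_const.congr this.symm
      refine (hcont.integrable_of_hasCompactSupport ?_).integrableOn
      refine hcu.mono ?_
      intro x hx hx'
      apply hx
      simp [hx', hp0.ne']
    have hUle : ∫ x in Ω, |u x| ^ p ≤ rΩ ^ p * (M * ∫ x in Ω, ‖fderiv ℝ u x‖ ^ p) := by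
      have h1 : ∫ x in Ω, |u x| ^ p ≤ ∫ x in Ω, rΩ ^ p * (|u x| ^ p / infDist x Ωᶜ ^ p) := by
        refine integral_mono_of_nonneg (.of_forall fun x => by simp only [Pi.zero_apply]; positivity)
          (hHint.const_mul _) (ae_restrict_of_forall_mem hΩo.measurableSet fun x hx => ?_)
        have hd := Real.rpow_pos_of_pos (hdpos x hx) p
        have hd2 := Real.rpow_le_rpow (hdpos x hx).le (hdle x hx) hp0.le
        simp only
        rw [← mul_div_assoc, le_div_iff₀ hd, mul_comm]
        exact mul_le_mul_of_nonneg_right hd2 (by positivity)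
      rw [integral_const_mul] at h1
      refine h1.trans (mul_le_mul_of_nonneg_left ?_ (by positivity))
      exact (hHardy u hu hcu hsu).trans (mul_le_mul_of_nonneg_right (le_max_left _ _) hG0)
    set A := ∫ x in Ω, w x ^ s
    set G := ∫ x in Ω, ‖fderiv ℝ u x‖ ^ p
    set U := ∫ x in Ω, |u x| ^ p
    set V := ∫ x in Ω, |u x| ^ q
    set W := ∫ x in Ω, w x * |u x| ^ p
    have hVc : V ^ c ≤ (S * G) ^ b := by
      have : V ^ c = (V ^ (p / q)) ^ b := by
        rw [← Real.rpow_mul hV0]; congr 1; rw [hc, hq, hb]; field_simp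
      rw [this]
      exact Real.rpow_le_rpow (by positivity) hSu hb0
    have hUa : U ^ a ≤ (rΩ ^ p * (M * G)) ^ a := Real.rpow_le_rpow hU0 hUle ha0
    have hfin : W ≤ A ^ (1/s) * rΩ ^ ((s * p - N) / s) * (M ^ a * S ^ b) * G := by
      calc W ≤ A ^ (1/s) * U ^ a * V ^ c := hHol
        _ ≤ A ^ (1/s) * (rΩ ^ p * (M * G)) ^ a * (S * G) ^ b := by gcongr
        _ = A ^ (1/s) * rΩ ^ ((s * p - N) / s) * (M ^ a * S ^ b) * (G ^ a * G ^ b) := by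
          rw [Real.mul_rpow (by positivity) (by positivity), Real.mul_rpow hM0.le hG0,
            Real.mul_rpow hS.le hG0, ← Real.rpow_mul hr0.le, hpa]
          ring
        _ = _ := by
          rw [← Real.rpow_add_of_nonneg hG0 ha0 hb0, hab, Real.rpow_one]
    have hrr : 0 < rΩ ^ ((s * p - N) / s) := by positivity
    rw [div_le_div_iff₀ (by positivity) hpos, inv_mul_le_iff₀ (by positivity)]
    linarith
end

section
/- Let N ≥ 1, p > N, and let β < p − N and C > 0 be given. Then there exist R > 1, a nonnegative weight w ∈ L^1(B(0,R)), and a C^1 function u, not identically zero, with compact support contained in the ball B(0,R) ⊂ ℝ^N, such that ∫_{B(0,R)} |∇u|^p dx = ∫_{B(0,R)} w(x)|u(x)|^p dx and ∫_{B(0,R)} w(x) dx < C / R^β. In other words, the exponent p − N of the inner radius in the Lyapunov inequality for p > N cannot be replaced by any smaller exponent β with a uniform constant valid for all large balls. -/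
open MeasureTheory Metric

/-- Optimality of the exponent `p - N` in the Lyapunov inequality for `p > N`:
for any `β < p - N` and any `C > 0` there are a large ball `B(0,R)`, a weight `w`
and a nontrivial solution `u` violating `C / R^β ≤ ∫ w`. -/
theorem lyapunov_exponent_optimal_large_balls (N : ℕ) (hN : 1 ≤ N) (p β C : ℝ)
    (hp : (N : ℝ) < p) (hβ : β < p - N) (hC : 0 < C) :
    ∃ (R : ℝ) (w u : EuclideanSpace ℝ (Fin N) → ℝ),
      1 < R ∧
      (∀ x, 0 ≤ w x) ∧
      IntegrableOn w (ball (0 : EuclideanSpace ℝ (Fin N)) R) ∧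
      ContDiff ℝ 1 u ∧
      HasCompactSupport u ∧
      tsupport u ⊆ ball (0 : EuclideanSpace ℝ (Fin N)) R ∧
      u ≠ 0 ∧
      (∫ x in ball (0 : EuclideanSpace ℝ (Fin N)) R, ‖fderiv ℝ u x‖ ^ p) =
        (∫ x in ball (0 : EuclideanSpace ℝ (Fin N)) R, w x * |u x| ^ p) ∧
      (∫ x in ball (0 : EuclideanSpace ℝ (Fin N)) R, w x) < C / R ^ β := by
  have hp0 : 0 ≤ p := le_trans (Nat.cast_nonneg N) hp.le
  let f : ContDiffBump (0 : EuclideanSpace ℝ (Fin N)) := ⟨1/4, 1/2, by norm_num, by norm_num⟩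
  have hf1 : ContDiff ℝ 1 (f : EuclideanSpace ℝ (Fin N) → ℝ) := f.contDiff
  obtain ⟨M, hM⟩ : ∃ M, ∀ x, ‖fderiv ℝ (f : EuclideanSpace ℝ (Fin N) → ℝ) x‖ ≤ M :=
    (hf1.continuous_fderiv one_ne_zero).bounded_above_of_compact_support
      (f.hasCompactSupport.fderiv ℝ)
  have hM0 : 0 ≤ M := (norm_nonneg _).trans (hM 0)
  set V : ℝ := volume.real (ball (0 : EuclideanSpace ℝ (Fin N)) 1) with hV
  obtain ⟨R, hR1, hRlt⟩ : ∃ R : ℝ, 1 < R ∧ M ^ p * V * R ^ (-(p - N - β)) < C := by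
    have h1 := (tendsto_rpow_neg_atTop (y := p - N - β) (by linarith)).const_mul (M ^ p * V)
    rw [mul_zero] at h1
    obtain ⟨R, h, h'⟩ := ((Filter.eventually_gt_atTop (1:ℝ)).and
      (h1.eventually (gt_mem_nhds hC))).exists
    exact ⟨R, h, h'⟩
  have hR0 : 0 < R := by linarith
  let u : EuclideanSpace ℝ (Fin N) → ℝ := fun x => f (R⁻¹ • x)
  have hus : tsupport u ⊆ closedBall 0 (R / 2) := by
    refine closure_minimal ?_ isClosed_closedBall
    intro x hx
    by_contra hcon
    apply hx
    apply f.zero_of_le_dist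
    change (1/2 : ℝ) ≤ _
    rw [mem_closedBall, not_le, dist_zero_right] at hcon
    rw [dist_zero_right, norm_smul, norm_inv, Real.norm_of_nonneg hR0.le, inv_mul_eq_div,
      le_div_iff₀ hR0]
    linarith
  have hu1 : ∀ x ∈ ball (0 : EuclideanSpace ℝ (Fin N)) (R / 4), u x = 1 := by
    intro x hx
    apply f.one_of_mem_closedBall
    change _ ∈ closedBall 0 (1/4 : ℝ)
    rw [mem_ball, dist_zero_right] at hx
    rw [mem_closedBall, dist_zero_right, norm_smul, norm_inv, Real.norm_of_nonneg hR0.le,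
      inv_mul_eq_div, div_le_iff₀ hR0]
    linarith
  have hfd : ∀ x, ‖fderiv ℝ u x‖ ≤ M / R := by
    intro x
    have : fderiv ℝ u x = R⁻¹ • fderiv ℝ f (R⁻¹ • x) := fderiv_comp_smul R⁻¹
    rw [this, norm_smul, norm_inv, Real.norm_of_nonneg hR0.le, inv_mul_eq_div]
    gcongr
    exact hM _
  set G : ℝ := ∫ x in ball (0 : EuclideanSpace ℝ (Fin N)) R, ‖fderiv ℝ u x‖ ^ p with hG
  have hG0 : 0 ≤ G := integral_nonneg fun x => Real.rpow_nonneg (norm_nonneg _) _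
  have hvolR : volume.real (ball (0 : EuclideanSpace ℝ (Fin N)) R) = R ^ N * V := by
    have := Measure.addHaar_ball_of_pos (volume : Measure (EuclideanSpace ℝ (Fin N))) 0 hR0
    rw [hV, measureReal_def, measureReal_def, this, ENNReal.toReal_mul,
      ENNReal.toReal_ofReal (by positivity), finrank_euclideanSpace_fin]
  have hGle : G ≤ (M / R) ^ p * (R ^ N * V) := by
    rw [← hvolR]
    refine (Real.le_norm_self G).trans ?_
    refine norm_setIntegral_le_of_norm_le_const measure_ball_lt_top ?_
    intro x _
    rw [Real.norm_of_nonneg (Real.rpow_nonneg (norm_nonneg _) _)]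
    exact Real.rpow_le_rpow (norm_nonneg _) (hfd x) hp0
  have hGlt : G < C / R ^ β := by
    rw [lt_div_iff₀ (Real.rpow_pos_of_pos hR0 _)]
    refine lt_of_le_of_lt (mul_le_mul_of_nonneg_right hGle (Real.rpow_nonneg hR0.le _)) ?_
    refine lt_of_eq_of_lt ?_ hRlt
    have : -(p - N - β) = (N : ℝ) + β - p := by ring
    rw [this, Real.rpow_sub hR0, Real.rpow_add hR0, Real.rpow_natCast, Real.div_rpow hM0 hR0.le]
    ring
  set v : ℝ := volume.real (ball (0 : EuclideanSpace ℝ (Fin N)) (R/4)) with hv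
  have hv0 : 0 < v := ENNReal.toReal_pos (measure_ball_pos _ _ (by linarith)).ne' measure_ball_lt_top.ne
  let w : EuclideanSpace ℝ (Fin N) → ℝ := (ball 0 (R/4)).indicator fun _ => G / v
  have hwint : ∫ x in ball (0 : EuclideanSpace ℝ (Fin N)) R, w x = G := by
    rw [setIntegral_indicator measurableSet_ball,
      Set.inter_eq_self_of_subset_right (ball_subset_ball (by linarith)), setIntegral_const,
      ← hv, smul_eq_mul]
    field_simp
  have hwu : ∀ x, w x * |u x| ^ p = w x := by
    intro x
    by_cases hx : x ∈ ball (0 : EuclideanSpace ℝ (Fin N)) (R/4)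
    · simp [hu1 x hx]
    · simp [w, Set.indicator_of_notMem hx]
  refine ⟨R, w, u, hR1, ?_, ?_, ?_, ?_, ?_, ?_, ?_, ?_⟩
  · exact fun x => Set.indicator_nonneg (fun _ _ => div_nonneg hG0 hv0.le) x
  · exact (integrableOn_const measure_ball_lt_top.ne).indicator measurableSet_ball
  · exact hf1.comp (contDiff_id.const_smul _)
  · exact (isCompact_closedBall _ _).of_isClosed_subset (isClosed_tsupport _) hus
  · exact hus.trans (closedBall_subset_ball (by linarith))
  · intro h
    have := hu1 0 (mem_ball_self (by linarith))
    simp [h] at this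
  · simp only [hwu]
    rw [hwint]
  · rw [hwint]; exact hGlt
end

section
/- Let N ≥ 1, p > N, and let β > p − N and C > 0 be given. Then there exist R with 0 < R < 1, a nonnegative weight w ∈ L^1(B(0,R)), and a C^1 function u, not identically zero, with compact support contained in the ball B(0,R) ⊂ ℝ^N, such that ∫_{B(0,R)} |∇u|^p dx = ∫_{B(0,R)} w(x)|u(x)|^p dx and ∫_{B(0,R)} w(x) dx < C / R^β. In other words, the exponent p − N of the inner radius in the Lyapunov inequality for p > N cannot be replaced by any larger exponent β with a uniform constant valid for all small balls. -/
open MeasureTheory Metric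

/-- Optimality of the exponent `p - N` in the Lyapunov inequality for `p > N`:
for any `β > p - N` and any `C > 0` there are a small ball `B(0,R)`, a weight `w`
and a nontrivial solution `u` violating `C / R^β ≤ ∫ w`. -/
theorem lyapunov_exponent_optimal_small_balls (N : ℕ) (hN : 1 ≤ N) (p β C : ℝ)
    (hp : (N : ℝ) < p) (hβ : p - N < β) (hC : 0 < C) :
    ∃ (R : ℝ) (w u : EuclideanSpace ℝ (Fin N) → ℝ),
      0 < R ∧ R < 1 ∧
      (∀ x, 0 ≤ w x) ∧
      IntegrableOn w (ball (0 : EuclideanSpace ℝ (Fin N)) R) ∧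
      ContDiff ℝ 1 u ∧
      HasCompactSupport u ∧
      tsupport u ⊆ ball (0 : EuclideanSpace ℝ (Fin N)) R ∧
      u ≠ 0 ∧
      (∫ x in ball (0 : EuclideanSpace ℝ (Fin N)) R, ‖fderiv ℝ u x‖ ^ p) =
        (∫ x in ball (0 : EuclideanSpace ℝ (Fin N)) R, w x * |u x| ^ p) ∧
      (∫ x in ball (0 : EuclideanSpace ℝ (Fin N)) R, w x) < C / R ^ β := by
  have hp0 : 0 < p := lt_of_le_of_lt (Nat.cast_nonneg N) hp
  let φ : ContDiffBump (0 : EuclideanSpace ℝ (Fin N)) := ⟨1/4, 1/2, by norm_num, by norm_num⟩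
  have hφc : ContDiff ℝ 1 φ := φ.contDiff
  have hφ1 : φ 0 = 1 := φ.one_of_mem_closedBall (by simp [φ])
  have hφts : tsupport φ = closedBall 0 (1/2) := φ.tsupport_eq
  set A := ∫ x, ‖fderiv ℝ φ x‖ ^ p with hA
  set B := ∫ x, |φ x| ^ p with hB
  set V := (volume : Measure (EuclideanSpace ℝ (Fin N))).real (ball 0 1) with hV
  have hA0 : 0 ≤ A := integral_nonneg fun x => by positivity
  have hB0 : 0 < B := by
    apply Continuous.integral_pos_of_hasCompactSupport_nonneg_nonzero (x := 0)
    · exact (hφc.continuous.abs).rpow_const fun x => Or.inr hp0.le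
    · exact φ.hasCompactSupport.comp_left (g := fun t : ℝ => |t| ^ p) (by simp [hp0.ne'])
    · intro x; positivity
    · simp [hφ1]
  have hV0 : 0 ≤ V := measureReal_nonneg
  obtain ⟨R, hR0, hR1, hR⟩ : ∃ R : ℝ, 0 < R ∧ R < 1 ∧ A / B * V * R ^ (β - (p - N)) < C := by
    have h1 : Filter.Tendsto (fun R : ℝ => A / B * V * R ^ (β - (p - N))) (nhdsWithin 0 (Set.Ioi 0))
        (nhds 0) := by
      have : ContinuousAt (fun R : ℝ => A / B * V * R ^ (β - (p - N))) 0 :=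
        continuousAt_const.mul (Real.continuousAt_rpow_const 0 _ (Or.inr (by linarith)))
      have h2 := this.tendsto
      rw [Real.zero_rpow (by linarith), mul_zero] at h2
      exact h2.mono_left nhdsWithin_le_nhds
    have h3 := h1.eventually (gt_mem_nhds hC)
    have h4 : ∀ᶠ R : ℝ in nhdsWithin 0 (Set.Ioi 0), R < 1 :=
      nhdsWithin_le_nhds (gt_mem_nhds one_pos)
    obtain ⟨R, ⟨h5, h6⟩, h7⟩ := ((h3.and h4).and self_mem_nhdsWithin).exists
    exact ⟨R, h7, h6, h5⟩
  have hRi : 0 < R⁻¹ := inv_pos.2 hR0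
  let u : EuclideanSpace ℝ (Fin N) → ℝ := fun x => φ (R⁻¹ • x)
  have hts : tsupport u ⊆ closedBall 0 (R / 2) := by
    apply closure_minimal _ isClosed_closedBall
    intro x hx
    have : R⁻¹ • x ∈ tsupport φ := subset_tsupport _ hx
    rw [hφts, mem_closedBall_zero_iff, norm_smul, Real.norm_of_nonneg hRi.le,
      inv_mul_le_iff₀ hR0] at this
    rw [mem_closedBall_zero_iff]; linarith
  have hts' : tsupport u ⊆ ball 0 R :=
    hts.trans (closedBall_subset_ball (by linarith))
  have hfd : ∀ x, fderiv ℝ u x = R⁻¹ • fderiv ℝ φ (R⁻¹ • x) := fun x => fderiv_comp_smul _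
  have I1 : (∫ x in ball (0 : EuclideanSpace ℝ (Fin N)) R, ‖fderiv ℝ u x‖ ^ p)
      = R⁻¹ ^ p * (R ^ N * A) := by
    rw [setIntegral_eq_integral_of_forall_compl_eq_zero]
    · simp_rw [hfd, norm_smul, Real.norm_of_nonneg hRi.le, Real.mul_rpow hRi.le (norm_nonneg _)]
      rw [integral_const_mul, Measure.integral_comp_smul volume (fun y => ‖fderiv ℝ φ y‖ ^ p) R⁻¹]
      simp [abs_of_pos hR0, hA]
    · intro x hx
      have : fderiv ℝ u x = 0 := by
        by_contra h
        exact hx (hts' (support_fderiv_subset ℝ h))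
      simp [this, hp0.ne']
  have I2 : (∫ x in ball (0 : EuclideanSpace ℝ (Fin N)) R, |u x| ^ p) = R ^ N * B := by
    rw [setIntegral_eq_integral_of_forall_compl_eq_zero]
    · rw [Measure.integral_comp_smul volume (fun y => |φ y| ^ p) R⁻¹]
      simp [abs_of_pos hR0, hB]
    · intro x hx
      have : u x = 0 := by
        by_contra h
        exact hx (hts' (subset_tsupport _ h))
      simp [this, hp0.ne']
  refine ⟨R, fun _ => A / B * R⁻¹ ^ p, u, hR0, hR1, fun x => by positivity, ?_,
    hφc.comp (contDiff_const_smul _), ?_, hts', ?_, ?_, ?_⟩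
  · exact integrableOn_const measure_ball_lt_top.ne
  · exact (isCompact_closedBall 0 (R/2)).of_isClosed_subset (isClosed_tsupport _) hts
  · intro h
    have := congrFun h 0
    simp [u, hφ1] at this
  · rw [I1, integral_const_mul, I2]
    field_simp
  · have hvol : (volume : Measure (EuclideanSpace ℝ (Fin N))).real (ball 0 R) = R ^ N * V := by
      rw [hV, Measure.real, Measure.addHaar_ball_of_pos volume _ hR0, ENNReal.toReal_mul,
        ENNReal.toReal_ofReal (by positivity)]
      simp [Measure.real]
    rw [setIntegral_const, hvol, smul_eq_mul, lt_div_iff₀ (by positivity)]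
    calc _ = A / B * V * (R ^ (N:ℝ) * R ^ (-p) * R ^ β) := by
            rw [Real.inv_rpow hR0.le, Real.rpow_neg hR0.le, Real.rpow_natCast]; ring
      _ = A / B * V * R ^ (β - (p - N)) := by
            rw [← Real.rpow_add hR0, ← Real.rpow_add hR0]; ring_nf
      _ < C := hR
end

section
/- Let 1 < p < N, s > N/p, and let β < (sp − N)/s and C > 0 be given. Then there exist R > 1, a nonnegative weight w ∈ L^s(B(0,R)), and a C^1 function u, not identically zero, with compact support contained in the ball B(0,R) ⊂ ℝ^N, such that ∫_{B(0,R)} |∇u|^p dx = ∫_{B(0,R)} w(x)|u(x)|^p dx and ‖w‖_{L^s(B(0,R))} < C / R^β. In other words, the exponent (sp − N)/s of the inner radius in the Lyapunov inequality for p < N cannot be replaced by any smaller exponent β with a uniform constant valid for all large balls. -/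
open MeasureTheory Metric
open scoped Pointwise

/-- Optimality of the exponent `(sp - N)/s` in the Lyapunov inequality for `1 < p < N`,
`s > N/p`: for any `β < (sp - N)/s` and any `C > 0` there are a large ball `B(0,R)`,
a weight `w ∈ L^s` and a nontrivial solution `u` violating `C / R^β ≤ ‖w‖_{L^s}`. -/
theorem lyapunov_exponent_optimal_p_lt_N (N : ℕ) (hN : 1 ≤ N) (p s β C : ℝ)
    (hp1 : 1 < p) (hpN : p < N) (hs : (N : ℝ) / p < s)
    (hβ : β < (s * p - N) / s) (hC : 0 < C) :
    ∃ (R : ℝ) (w u : EuclideanSpace ℝ (Fin N) → ℝ),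
      1 < R ∧
      (∀ x, 0 ≤ w x) ∧
      IntegrableOn (fun x => w x ^ s) (ball (0 : EuclideanSpace ℝ (Fin N)) R) ∧
      ContDiff ℝ 1 u ∧
      HasCompactSupport u ∧
      tsupport u ⊆ ball (0 : EuclideanSpace ℝ (Fin N)) R ∧
      u ≠ 0 ∧
      (∫ x in ball (0 : EuclideanSpace ℝ (Fin N)) R, ‖fderiv ℝ u x‖ ^ p) =
        (∫ x in ball (0 : EuclideanSpace ℝ (Fin N)) R, w x * |u x| ^ p) ∧
      (∫ x in ball (0 : EuclideanSpace ℝ (Fin N)) R, w x ^ s) ^ (1 / s) < C / R ^ β := by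
  have hNpos : (0 : ℝ) < N := by linarith
  have hs0 : 0 < s := lt_trans (div_pos hNpos (by linarith)) hs
  have hp0 : 0 < p := by linarith
  let E := EuclideanSpace ℝ (Fin N)
  let φ : ContDiffBump (0 : E) := ⟨1 / 4, 1 / 2, by norm_num, by norm_num⟩
  have hφ1 : ContDiff ℝ 1 (φ : E → ℝ) := φ.contDiff
  set A : ℝ := ∫ x in ball (0 : E) 1, ‖fderiv ℝ φ x‖ ^ p with hA
  set B : ℝ := ∫ x in ball (0 : E) 1, |φ x| ^ p with hB
  have hA0 : 0 ≤ A := by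
    rw [hA]
    exact integral_nonneg (fun x => by positivity)
  have hcont : Continuous (fun x : E => |φ x| ^ p) :=
    φ.continuous.abs.rpow_const (fun x => Or.inr hp0.le)
  have hB0 : 0 < B := by
    rw [hB, setIntegral_pos_iff_support_of_nonneg_ae]
    · refine lt_of_lt_of_le (measure_ball_pos volume (0 : E) (by norm_num : (0 : ℝ) < 1 / 4))
        (measure_mono ?_)
      intro x hx
      refine ⟨?_, ball_subset_ball (by norm_num) hx⟩
      have : φ x = 1 := φ.one_of_mem_closedBall (ball_subset_closedBall hx)
      simp [this]
    · exact Filter.Eventually.of_forall (fun x => by positivity)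
    · exact (hcont.continuousOn.integrableOn_compact (isCompact_closedBall (0 : E) 1)).mono_set
        ball_subset_closedBall
  set v : ℝ := volume.real (ball (0 : E) 1) with hv
  have hlim : Filter.Tendsto (fun R : ℝ => A / B * v ^ (1 / s) * R ^ (-(p - N / s - β)))
      Filter.atTop (nhds (A / B * v ^ (1 / s) * 0)) := by
    apply Filter.Tendsto.const_mul
    apply tendsto_rpow_neg_atTop
    have : (s * p - N) / s = p - N / s := by field_simp
    linarith
  rw [mul_zero] at hlim
  obtain ⟨R, hRC, hR1⟩ := ((hlim.eventually_lt_const hC).and (Filter.eventually_gt_atTop 1)).exists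
  have hR0 : 0 < R := by linarith
  have hv0 : 0 ≤ v := measureReal_nonneg
  have hw0 : 0 ≤ A / B * R ^ (-p) := by positivity
  have hball : R⁻¹ • ball (0 : E) R = ball (0 : E) 1 := by
    rw [_root_.smul_ball (by positivity)]
    simp [abs_of_pos hR0, hR0.ne']
  have hcv : ∀ f : E → ℝ, ∫ x in ball (0 : E) R, f (R⁻¹ • x) =
      R ^ N * ∫ x in ball (0 : E) 1, f x := by
    intro f
    rw [Measure.setIntegral_comp_smul_of_pos _ _ _ (by positivity), hball]
    have hd : Module.finrank ℝ E = N := finrank_euclideanSpace_fin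
    simp [hd]
  have hvol : volume.real (ball (0 : E) R) = R ^ N * v := by
    have h := Measure.addHaar_ball_of_pos (volume : Measure E) 0 hR0
    rw [measureReal_def, h, ENNReal.toReal_mul, ENNReal.toReal_ofReal (by positivity)]
    simp [hv, measureReal_def, E]
  refine ⟨R, fun _ => A / B * R ^ (-p), fun x => φ (R⁻¹ • x), hR1, fun _ => hw0, ?_, ?_, ?_,
    ?_, ?_, ?_, ?_⟩
  · exact integrableOn_const (measure_ball_lt_top.ne)
  · exact hφ1.comp (contDiff_const_smul _)
  · exact φ.hasCompactSupport.comp_smul (by positivity)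
  · have h1 : tsupport (fun x : E => φ (R⁻¹ • x)) ⊆ (fun x : E => R⁻¹ • x) ⁻¹' tsupport φ :=
      tsupport_comp_subset_preimage φ (continuous_const_smul _)
    intro x hx
    have h2 := h1 hx
    rw [Set.mem_preimage, φ.tsupport_eq, mem_closedBall_zero_iff, norm_smul, norm_inv,
      Real.norm_of_nonneg hR0.le, inv_mul_le_iff₀ hR0] at h2
    rw [mem_ball_zero_iff]
    have h3 : φ.rOut = 1 / 2 := rfl
    rw [h3] at h2
    linarith
  · intro h
    have h0 := congrFun h 0
    have h1 : φ (0 : E) = 1 := φ.one_of_mem_closedBall (mem_closedBall_self φ.rIn_pos.le)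
    simp [h1] at h0
  · have hf : ∀ x : E, ‖fderiv ℝ (fun x : E => φ (R⁻¹ • x)) x‖ ^ p =
        R ^ (-p) * ‖fderiv ℝ φ (R⁻¹ • x)‖ ^ p := by
      intro x
      rw [fderiv_comp_smul, norm_smul, norm_inv, Real.norm_of_nonneg hR0.le,
        Real.mul_rpow (by positivity) (by positivity), Real.inv_rpow hR0.le, Real.rpow_neg hR0.le]
    refine (integral_congr_ae (Filter.Eventually.of_forall hf)).trans ?_
    rw [integral_const_mul, integral_const_mul, hcv (fun x => ‖fderiv ℝ φ x‖ ^ p),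
      hcv (fun x => |φ x| ^ p), ← hA, ← hB]
    field_simp
  · rw [setIntegral_const, hvol, smul_eq_mul, Real.mul_rpow (by positivity) (by positivity),
      ← Real.rpow_mul hw0, mul_one_div_cancel hs0.ne', Real.rpow_one,
      Real.mul_rpow (by positivity) hv0, ← Real.rpow_natCast, ← Real.rpow_mul hR0.le,
      lt_div_iff₀ (by positivity)]
    refine lt_of_eq_of_lt ?_ hRC
    have : -(p - N / s - β) = N * (1 / s) + -p + β := by ring
    rw [this, Real.rpow_add hR0, Real.rpow_add hR0]
    ring
end

section
/- Let 1 < p < N and s > N/p. There exists a constant C > 0 depending only on p, N and s such that for every bounded open convex set Ω ⊂ ℝ^N with inner radius r_Ω, every nonnegative w ∈ L^s(Ω), and every C^1 function u, not identically zero, with compact support contained in Ω satisfying the energy identity ∫_Ω |∇u|^p dx = ∫_Ω w(x)|u(x)|^p dx, one has C / r_Ω^{(sp−N)/s} ≤ ‖w‖_{L^s(Ω)}. -/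
open MeasureTheory Metric

namespace LyapAux

/-- The `2N` coordinate displacement vectors of length `L`. -/
noncomputable def disp (N : ℕ) (L : ℝ) (k : Fin N × Bool) : EuclideanSpace ℝ (Fin N) :=
  EuclideanSpace.single k.1 (if k.2 then L else -L)

lemma norm_disp (N : ℕ) (L : ℝ) (hL : 0 ≤ L) (k : Fin N × Bool) : ‖disp N L k‖ = L := by
  unfold disp
  rw [PiLp.norm_single]
  split_ifs <;> simp [abs_of_nonneg hL]

lemma exists_exit (N : ℕ) (hN : 1 ≤ N) (Ω : Set (EuclideanSpace ℝ (Fin N)))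
    (ho : IsOpen Ω) (hc : Convex ℝ Ω) (hne : (Ωᶜ).Nonempty) (r : ℝ)
    (x : EuclideanSpace ℝ (Fin N)) (hx : infDist x Ωᶜ ≤ r) :
    ∃ k, x + disp N (N * r) k ∉ Ω := by
  obtain ⟨y, hy, hxy⟩ := ho.isClosed_compl.exists_infDist_eq_dist hne x
  obtain ⟨f, hf⟩ := geometric_hahn_banach_open_point hc ho hy
  have : Nonempty (Fin N) := ⟨⟨0, hN⟩⟩
  obtain ⟨i, hi⟩ := Finite.exists_max (fun j : Fin N => |f (EuclideanSpace.single j 1)|)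
  have hr : 0 ≤ r := infDist_nonneg.trans hx
  have hs : ∀ (j : Fin N) (t : ℝ), f (EuclideanSpace.single j t)
      = t * f (EuclideanSpace.single j 1) := by
    intro j t
    rw [← smul_eq_mul, ← map_smul]
    congr 1
    ext l
    simp
  have hdec : y - x = ∑ j, EuclideanSpace.single j ((y - x) j) := by
    ext l
    simp
  have hb : f y - f x ≤ N * r * |f (EuclideanSpace.single i 1)| := by
    rw [← map_sub, hdec, map_sum]
    calc ∑ j, f (EuclideanSpace.single j ((y - x) j))
        ≤ ∑ j : Fin N, r * |f (EuclideanSpace.single i 1)| := by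
          apply Finset.sum_le_sum
          intro j _
          rw [hs]
          refine (le_abs_self _).trans ?_
          rw [abs_mul]
          have h1 : |(y - x) j| ≤ r := by
            have h2 := PiLp.norm_apply_le (y - x) j
            rw [Real.norm_eq_abs] at h2
            refine h2.trans ?_
            rw [← dist_eq_norm, dist_comm, ← hxy]
            exact hx
          exact mul_le_mul h1 (hi j) (abs_nonneg _) hr
      _ = N * r * |f (EuclideanSpace.single i 1)| := by
          simp [mul_assoc]
  rcases le_total 0 (f (EuclideanSpace.single i 1)) with h | h
  · refine ⟨(i, true), fun hm => ?_⟩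
    have := hf _ hm
    rw [map_add, disp, hs] at this
    rw [abs_of_nonneg h] at hb
    simp only [if_true] at this
    linarith
  · refine ⟨(i, false), fun hm => ?_⟩
    have := hf _ hm
    rw [map_add, disp, hs] at this
    rw [abs_of_nonpos h] at hb
    simp only [Bool.false_eq_true, if_false] at this
    linarith

lemma line_bound {E : Type*} [NormedAddCommGroup E] [NormedSpace ℝ E]
    (u : E → ℝ) (hu : ContDiff ℝ 1 u) (x v : E) (h0 : u (x + v) = 0)
    (p : ℝ) (hp : 1 < p) :
    ‖u x‖ₑ ^ p ≤ ‖v‖ₑ ^ p * ∫⁻ t in Set.Ioc (0:ℝ) 1, ‖fderiv ℝ u (x + t • v)‖ₑ ^ p := by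
  have hp0 : 0 < p := by linarith
  have hcf : Continuous (fderiv ℝ u) := hu.continuous_fderiv one_ne_zero
  have hl : Continuous (fun t : ℝ => x + t • v) := by fun_prop
  have hc : Continuous (fun t : ℝ => fderiv ℝ u (x + t • v)) := hcf.comp hl
  have hFTC : ∫ t in (0:ℝ)..1, fderiv ℝ u (x + t • v) v = u (x + v) - u x := by
    have := intervalIntegral.integral_eq_sub_of_hasDerivAt (a := 0) (b := 1)
      (f := fun t : ℝ => u (x + t • v)) (f' := fun t : ℝ => fderiv ℝ u (x + t • v) v) ?_ ?_
    · simpa using this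
    · intro t _
      have h1 : HasDerivAt (fun t : ℝ => x + t • v) v t := by
        simpa using ((hasDerivAt_id t).smul_const v).const_add x
      exact ((hu.differentiable one_ne_zero) (x + t • v)).hasFDerivAt.comp_hasDerivAt t h1
    · exact (hc.clm_apply continuous_const).intervalIntegrable _ _
  rw [h0, zero_sub, intervalIntegral.integral_of_le zero_le_one] at hFTC
  have h1 : ‖u x‖ₑ ≤ ∫⁻ t in Set.Ioc (0:ℝ) 1, ‖v‖ₑ * ‖fderiv ℝ u (x + t • v)‖ₑ := by
    rw [← enorm_neg, ← hFTC]
    refine (enorm_integral_le_lintegral_enorm _).trans (lintegral_mono fun t => ?_)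
    rw [mul_comm]
    exact ContinuousLinearMap.le_opENorm _ _
  rw [lintegral_const_mul _ hc.enorm.measurable] at h1
  have h2 : ∫⁻ t in Set.Ioc (0:ℝ) 1, ‖fderiv ℝ u (x + t • v)‖ₑ ≤
      (∫⁻ t in Set.Ioc (0:ℝ) 1, ‖fderiv ℝ u (x + t • v)‖ₑ ^ p) ^ (1 / p) := by
    have := ENNReal.lintegral_mul_le_Lp_mul_Lq (volume.restrict (Set.Ioc (0:ℝ) 1))
      (Real.HolderConjugate.conjExponent hp) (f := fun t => ‖fderiv ℝ u (x + t • v)‖ₑ)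
      (g := fun _ => 1) hc.enorm.measurable.aemeasurable (by fun_prop)
    simpa using this
  calc ‖u x‖ₑ ^ p ≤ (‖v‖ₑ * (∫⁻ t in Set.Ioc (0:ℝ) 1, ‖fderiv ℝ u (x + t • v)‖ₑ ^ p) ^ (1 / p)) ^ p := by
        gcongr
        exact h1.trans (by gcongr)
    _ = _ := by
        rw [ENNReal.mul_rpow_of_nonneg _ _ hp0.le, ← ENNReal.rpow_mul]
        rw [one_div_mul_cancel hp0.ne', ENNReal.rpow_one]

lemma poincare (N : ℕ) (hN : 1 ≤ N) (Ω : Set (EuclideanSpace ℝ (Fin N)))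
    (ho : IsOpen Ω) (hc : Convex ℝ Ω) (hne : (Ωᶜ).Nonempty) (r : ℝ) (hr0 : 0 ≤ r)
    (hr : ∀ x ∈ Ω, infDist x Ωᶜ ≤ r) (u : EuclideanSpace ℝ (Fin N) → ℝ) (hu : ContDiff ℝ 1 u)
    (hsu : tsupport u ⊆ Ω) (p : ℝ) (hp : 1 < p) :
    ∫⁻ x, ‖u x‖ₑ ^ p ≤
      ENNReal.ofReal (2 * N * (N * r) ^ p) * ∫⁻ x, ‖fderiv ℝ u x‖ₑ ^ p := by
  have hp0 : 0 < p := by linarith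
  have hL : 0 ≤ N * r := by positivity
  have hcf : Continuous (fderiv ℝ u) := hu.continuous_fderiv one_ne_zero
  have hz : ∀ x ∉ Ω, u x = 0 := fun x hx => image_eq_zero_of_notMem_tsupport fun h => hx (hsu h)
  have hpt : ∀ x, ‖u x‖ₑ ^ p ≤ ∑ k, ENNReal.ofReal (N * r) ^ p *
      ∫⁻ t in Set.Ioc (0:ℝ) 1, ‖fderiv ℝ u (x + t • disp N (N * r) k)‖ₑ ^ p := by
    intro x
    by_cases hx : x ∈ Ω
    · obtain ⟨k, hk⟩ := exists_exit N hN Ω ho hc hne r x (hr x hx)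
      have h1 := line_bound u hu x _ (hz _ hk) p hp
      rw [← ofReal_norm (disp N (N * r) k), norm_disp N _ hL] at h1
      exact h1.trans (Finset.single_le_sum (f := fun k => ENNReal.ofReal (N * r) ^ p *
        ∫⁻ t in Set.Ioc (0:ℝ) 1, ‖fderiv ℝ u (x + t • disp N (N * r) k)‖ₑ ^ p)
        (fun _ _ => zero_le) (Finset.mem_univ k))
    · rw [hz x hx]
      simp [hp0]
  have hint : ∀ k, ∫⁻ x, ∫⁻ t in Set.Ioc (0:ℝ) 1,
      ‖fderiv ℝ u (x + t • disp N (N * r) k)‖ₑ ^ p = ∫⁻ x, ‖fderiv ℝ u x‖ₑ ^ p := by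
    intro k
    rw [lintegral_lintegral_swap]
    · have : ∀ t : ℝ, ∫⁻ x, ‖fderiv ℝ u (x + t • disp N (N * r) k)‖ₑ ^ p
          = ∫⁻ x, ‖fderiv ℝ u x‖ₑ ^ p := fun t =>
        lintegral_add_right_eq_self (fun x => ‖fderiv ℝ u x‖ₑ ^ p) _
      simp [this]
    · apply Measurable.aemeasurable
      have : Continuous (fun z : EuclideanSpace ℝ (Fin N) × ℝ =>
        fderiv ℝ u (z.1 + z.2 • disp N (N * r) k)) := hcf.comp (by fun_prop)
      exact this.enorm.measurable.pow_const p
  have hmeas : ∀ k, Measurable (fun x => ∫⁻ t in Set.Ioc (0:ℝ) 1,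
      ‖fderiv ℝ u (x + t • disp N (N * r) k)‖ₑ ^ p) := by
    intro k
    have : Continuous (fun z : EuclideanSpace ℝ (Fin N) × ℝ =>
        fderiv ℝ u (z.1 + z.2 • disp N (N * r) k)) := hcf.comp (by fun_prop)
    exact (this.enorm.measurable.pow_const p).lintegral_prod_right'
  calc ∫⁻ x, ‖u x‖ₑ ^ p ≤ ∫⁻ x, ∑ k, ENNReal.ofReal (N * r) ^ p *
      ∫⁻ t in Set.Ioc (0:ℝ) 1, ‖fderiv ℝ u (x + t • disp N (N * r) k)‖ₑ ^ p := lintegral_mono hpt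
    _ = ∑ k : Fin N × Bool, ENNReal.ofReal (N * r) ^ p * ∫⁻ x, ‖fderiv ℝ u x‖ₑ ^ p := by
      rw [lintegral_finsetSum _ (fun k _ => (hmeas k).const_mul _)]
      congr 1
      ext k
      rw [lintegral_const_mul _ (hmeas k), hint]
    _ = _ := by
      rw [Finset.sum_const, ENNReal.ofReal_rpow_of_nonneg hL hp0.le,
        ENNReal.ofReal_mul (p := 2 * (N : ℝ)) (by positivity)]
      simp [ENNReal.ofReal_mul, mul_comm, mul_assoc, mul_left_comm]

lemma sobolev (N : ℕ) (hN : 1 ≤ N) (p : ℝ) (hp : 1 < p) (hpN : p < N) :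
    ∃ K : ℝ, 0 < K ∧ ∀ u : EuclideanSpace ℝ (Fin N) → ℝ, ContDiff ℝ 1 u → HasCompactSupport u →
      (∫⁻ x, ‖u x‖ₑ ^ (p⁻¹ - (N:ℝ)⁻¹)⁻¹) ^ (1 - p / N) ≤
        ENNReal.ofReal K * ∫⁻ x, ‖fderiv ℝ u x‖ₑ ^ p := by
  have hp0 : 0 < p := by linarith
  have hN0 : (0:ℝ) < N := by linarith
  have hq : 0 < p⁻¹ - (N:ℝ)⁻¹ := by
    rw [sub_pos]; exact inv_strictAnti₀ hp0 hpN
  set q := (p⁻¹ - (N:ℝ)⁻¹)⁻¹ with hqdef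
  have hq0 : 0 < q := by positivity
  let K0 : NNReal := eLpNormLESNormFDerivOfEqInnerConst (volume : Measure (EuclideanSpace ℝ (Fin N))) p
  refine ⟨(K0 + 1 : ℝ) ^ p, by positivity, fun u hu hcu => ?_⟩
  have h := eLpNorm_le_eLpNorm_fderiv_of_eq_inner (volume : Measure (EuclideanSpace ℝ (Fin N)))
    hu hcu (p := p.toNNReal) (p' := q.toNNReal) (by simpa using hp.le) (by simp; omega)
    (by rw [Real.coe_toNNReal _ hq0.le, hqdef]; simp [hp0.le])
  rw [Real.coe_toNNReal p hp0.le] at h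
  have e1 := eLpNorm_nnreal_pow_eq_lintegral (f := u) (p := q.toNNReal)
    (μ := (volume : Measure (EuclideanSpace ℝ (Fin N)))) (by simpa using hq0)
  have e2 := eLpNorm_nnreal_pow_eq_lintegral (f := fderiv ℝ u) (p := p.toNNReal)
    (μ := (volume : Measure (EuclideanSpace ℝ (Fin N)))) (by simpa using hp0)
  rw [Real.coe_toNNReal _ hq0.le] at e1
  rw [Real.coe_toNNReal _ hp0.le] at e2
  rw [← e1, ← e2, ← ENNReal.rpow_mul]
  have : q * (1 - p / N) = p := by
    have : (N:ℝ) - p ≠ 0 := by linarith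
    rw [hqdef]; field_simp
  rw [this, ← ENNReal.ofReal_rpow_of_nonneg (by positivity) hp0.le,
    ← ENNReal.mul_rpow_of_nonneg _ _ hp0.le]
  gcongr
  refine h.trans ?_
  gcongr
  change (K0 : ENNReal) ≤ _
  rw [← ENNReal.ofReal_coe_nnreal]
  exact ENNReal.ofReal_le_ofReal (by linarith)

end LyapAux

/-- Lyapunov inequality for the `p`-Laplacian on bounded convex domains, case
`1 < p < N`, `s > N/p`, with a constant depending only on `p`, `N` and `s`:
`C / rΩ^((sp-N)/s) ≤ ‖w‖_{L^s(Ω)}`. -/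
theorem lyapunov_inequality_p_lt_N_convex (N : ℕ) (hN : 1 ≤ N) (p s : ℝ)
    (hp1 : 1 < p) (hpN : p < N) (hs : (N : ℝ) / p < s) :
    ∃ C : ℝ, 0 < C ∧
      ∀ (Ω : Set (EuclideanSpace ℝ (Fin N))) (rΩ : ℝ)
        (w u : EuclideanSpace ℝ (Fin N) → ℝ),
        IsOpen Ω →
        Bornology.IsBounded Ω →
        Convex ℝ Ω →
        -- `rΩ` is the inner radius of `Ω`
        IsLUB ((fun x => infDist x Ωᶜ) '' Ω) rΩ →
        -- `w ≥ 0` belongs to `L^s(Ω)`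
        (∀ x ∈ Ω, 0 ≤ w x) →
        IntegrableOn (fun x => w x ^ s) Ω →
        -- `u` is a nontrivial solution, tested against itself
        ContDiff ℝ 1 u →
        HasCompactSupport u →
        tsupport u ⊆ Ω →
        u ≠ 0 →
        (∫ x in Ω, ‖fderiv ℝ u x‖ ^ p) = (∫ x in Ω, w x * |u x| ^ p) →
        C / rΩ ^ ((s * p - N) / s) ≤ (∫ x in Ω, w x ^ s) ^ (1 / s) := by
  have hp0 : 0 < p := by linarith
  have hN0 : (0:ℝ) < N := by linarith
  have hs1 : 1 < s := lt_trans ((one_lt_div hp0).2 hpN) hs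
  have hs0 : 0 < s := by linarith
  have hsp : (N:ℝ) < s * p := (div_lt_iff₀ hp0).1 hs
  obtain ⟨K, hK, hsob⟩ := LyapAux.sobolev N hN p hp1 hpN
  set θ : ℝ := (s * p - N) / (s * p) with hθ
  have hθ0 : 0 < θ := div_pos (by linarith) (by positivity)
  have hθ1 : 0 < 1 - θ := by
    have : 1 - θ = N / (s * p) := by rw [hθ]; field_simp; ring
    rw [this]; positivity
  have hq : 0 < p⁻¹ - (N:ℝ)⁻¹ := by
    rw [sub_pos]; exact inv_strictAnti₀ hp0 hpN
  set q := (p⁻¹ - (N:ℝ)⁻¹)⁻¹ with hqdef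
  have hq0 : 0 < q := by positivity
  have hpN1 : 0 < 1 - p / N := by rw [sub_pos, div_lt_one hN0]; exact hpN
  have hqe : q * (1 - p / N) = p := by
    have : (N:ℝ) - p ≠ 0 := by linarith
    rw [hqdef]; field_simp
  refine ⟨1 / ((2 * N * (N:ℝ) ^ p) ^ θ * K ^ (1 - θ)), by positivity, ?_⟩
  intro Ω r w u ho hb hc hr hw hwi hu hcu hsu hune hE
  have hΩ : MeasurableSet Ω := ho.measurableSet
  have hr' : ∀ x ∈ Ω, infDist x Ωᶜ ≤ r := fun x hx => hr.1 ⟨x, hx, rfl⟩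
  have hne : (Ωᶜ).Nonempty := by
    have : Nonempty (Fin N) := ⟨⟨0, hN⟩⟩
    rw [Set.nonempty_compl]
    rintro rfl
    exact NormedSpace.unbounded_univ ℝ (EuclideanSpace ℝ (Fin N)) hb
  obtain ⟨x0, hx0⟩ : ∃ x, u x ≠ 0 := Function.ne_iff.1 hune
  have hx0Ω : x0 ∈ Ω := hsu (subset_tsupport u hx0)
  have hr0 : 0 < r := by
    refine lt_of_lt_of_le ?_ (hr' x0 hx0Ω)
    exact (ho.isClosed_compl.notMem_iff_infDist_pos hne).1 (by simpa using hx0Ω)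
  have hcf : Continuous (fderiv ℝ u) := hu.continuous_fderiv one_ne_zero
  have hpoin := LyapAux.poincare N hN Ω ho hc hne r hr0.le hr' u hu hsu p hp1
  have hsob' := hsob u hu hcu
  set I := ∫⁻ x, ‖fderiv ℝ u x‖ₑ ^ p with hI
  have hgi : Integrable (fun x => ‖fderiv ℝ u x‖ ^ p) := by
    apply Continuous.integrable_of_hasCompactSupport
    · exact hcf.norm.rpow_const fun _ => Or.inr hp0.le
    · exact (hcu.fderiv (𝕜 := ℝ)).comp_left (g := fun y => ‖y‖ ^ p) (by simp [hp0.ne'])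
  have hen : ∀ y : EuclideanSpace ℝ (Fin N) →L[ℝ] ℝ, ‖‖y‖ ^ p‖ₑ = ‖y‖ₑ ^ p := by
    intro y
    rw [Real.enorm_rpow_of_nonneg (norm_nonneg _) hp0.le, enorm_norm]
  have hIe : ENNReal.ofReal (∫ x, ‖fderiv ℝ u x‖ ^ p) = I := by
    have := ofReal_integral_norm_eq_lintegral_enorm hgi
    simp only [hen] at this
    rw [← hI] at this
    rw [← this]
    congr 2
    ext x
    rw [Real.norm_of_nonneg (by positivity)]
  have hItop : I ≠ ⊤ := by rw [← hIe]; exact ENNReal.ofReal_ne_top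
  have hI0 : I ≠ 0 := by
    intro h0
    rw [h0, mul_zero, nonpos_iff_eq_zero, lintegral_eq_zero_iff
      (hu.continuous.enorm.measurable.pow_const p)] at hpoin
    have h2 : u =ᵐ[volume] 0 := by
      filter_upwards [hpoin] with x hx
      simpa [hp0, hp0.le] using hx
    exact hune ((hu.continuous.ae_eq_iff_eq volume continuous_zero).1 h2)
  have hEΩ : ∫ x in Ω, ‖fderiv ℝ u x‖ ^ p = ∫ x, ‖fderiv ℝ u x‖ ^ p := by
    apply setIntegral_eq_integral_of_forall_compl_eq_zero
    intro x hx
    have : fderiv ℝ u x = 0 := by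
      by_contra h
      exact hx (hsu (support_fderiv_subset ℝ h))
    simp [this, hp0.ne']
  set W := ∫⁻ x in Ω, ‖w x ^ s‖ₑ with hW
  have hWe : ENNReal.ofReal (∫ x in Ω, w x ^ s) = W := by
    rw [hW, ← ofReal_integral_norm_eq_lintegral_enorm hwi]
    congr 1
    apply setIntegral_congr_fun hΩ
    intro x hx
    exact (Real.norm_of_nonneg (Real.rpow_nonneg (hw x hx) s)).symm
  have hmain : I ≤ W ^ (1 / s) * (∫⁻ x, ‖u x‖ₑ ^ p) ^ θ *
      (∫⁻ x, ‖u x‖ₑ ^ q) ^ ((1 - p / N) * (1 - θ)) := by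
    have h1 : I ≤ ∫⁻ x in Ω, ‖w x * |u x| ^ p‖ₑ := by
      rw [← hIe, ← hEΩ, hE]
      refine le_trans ?_ (enorm_integral_le_lintegral_enorm _)
      rw [← ofReal_norm]
      exact ENNReal.ofReal_le_ofReal (le_abs_self _)
    have h2 := ENNReal.lintegral_prod_norm_pow_le (μ := volume.restrict Ω) Finset.univ
      (f := ![fun x => ‖w x ^ s‖ₑ, fun x => ‖u x‖ₑ ^ p, fun x => ‖u x‖ₑ ^ q])
      (p := ![1 / s, θ, (1 - p / N) * (1 - θ)]) ?_ ?_ ?_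
    · simp only [Fin.prod_univ_three, Matrix.cons_val_zero, Matrix.cons_val_one,
        Matrix.cons_val] at h2
      refine h1.trans (le_trans (le_of_eq ?_) (h2.trans ?_))
      · apply setLIntegral_congr_fun hΩ
        intro x hx
        have hwx := hw x hx
        simp only
        rw [Real.enorm_rpow_of_nonneg hwx hs0.le, ← ENNReal.rpow_mul, mul_one_div_cancel hs0.ne',
          ENNReal.rpow_one, enorm_mul, Real.enorm_rpow_of_nonneg (abs_nonneg _) hp0.le,
          Real.enorm_abs, mul_assoc, ← ENNReal.rpow_mul, ← ENNReal.rpow_mul,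
          ← ENNReal.rpow_add_of_nonneg _ _ (by positivity) (by positivity), ← mul_assoc, hqe]
        congr 2
        ring
      · gcongr <;> exact Measure.restrict_le_self
    · intro i _
      fin_cases i
      · exact hwi.aestronglyMeasurable.enorm
      · exact (hu.continuous.enorm.measurable.pow_const p).aemeasurable
      · exact (hu.continuous.enorm.measurable.pow_const q).aemeasurable
    · simp only [Fin.sum_univ_three, Matrix.cons_val_zero, Matrix.cons_val_one, Matrix.cons_val]
      rw [hθ]
      field_simp
      ring
    · intro i _
      fin_cases i
      · simp [hs0.le]
      · simpa using hθ0.le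
      · simpa using (by positivity : 0 ≤ (1 - p / N) * (1 - θ))
  rw [ENNReal.rpow_mul] at hmain
  have hfin : I ≤ W ^ (1 / s) * (ENNReal.ofReal (2 * N * (N * r) ^ p) * I) ^ θ *
      (ENNReal.ofReal K * I) ^ (1 - θ) := by
    refine hmain.trans ?_
    gcongr
  set a := ∫ x, ‖fderiv ℝ u x‖ ^ p with ha
  set b := ∫ x in Ω, w x ^ s with hb'
  have hb0 : 0 ≤ b := setIntegral_nonneg hΩ fun x hx => Real.rpow_nonneg (hw x hx) s
  have ha0 : 0 < a := by
    rw [← ENNReal.ofReal_pos, hIe]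
    exact pos_iff_ne_zero.2 hI0
  have hreal : a ≤ b ^ (1 / s) * (2 * N * (N * r) ^ p * a) ^ θ * (K * a) ^ (1 - θ) := by
    rw [← hIe, ← hWe, ← ENNReal.ofReal_mul (by positivity), ← ENNReal.ofReal_mul (by positivity),
      ENNReal.ofReal_rpow_of_nonneg hb0 (by positivity),
      ENNReal.ofReal_rpow_of_nonneg (by positivity) hθ0.le,
      ENNReal.ofReal_rpow_of_nonneg (by positivity) hθ1.le,
      ← ENNReal.ofReal_mul (by positivity), ← ENNReal.ofReal_mul (by positivity)] at hfin
    exact (ENNReal.ofReal_le_ofReal_iff (by positivity)).1 hfin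
  have e1 : (2 * N * (N * r) ^ p * a) ^ θ * (K * a) ^ (1 - θ) =
      (2 * N * (N:ℝ) ^ p) ^ θ * K ^ (1 - θ) * r ^ ((s * p - N) / s) * a := by
    have e2 : a ^ θ * a ^ (1 - θ) = a := by
      rw [← Real.rpow_add ha0]; simp
    have e3 : (r ^ p) ^ θ = r ^ ((s * p - N) / s) := by
      rw [← Real.rpow_mul hr0.le]
      congr 1
      rw [hθ]; field_simp
    rw [Real.mul_rpow hN0.le hr0.le, ← mul_assoc, Real.mul_rpow (by positivity) ha0.le,
      Real.mul_rpow (by positivity) (by positivity), Real.mul_rpow hK.le ha0.le, e3]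
    linear_combination (2 * N * (N:ℝ) ^ p) ^ θ * K ^ (1 - θ) * r ^ ((s * p - N) / s) * e2
  rw [mul_assoc, e1] at hreal
  have hR : 0 < r ^ ((s * p - N) / s) := by positivity
  rw [div_div, div_le_iff₀ (by positivity)]
  refine le_of_mul_le_mul_right ?_ ha0
  linarith
end
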